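/- For all α, d₀ > 0 there exist η > 0 and n₀ ∈ ℕ such that the following holds for all n ≥ n₀ and all d ≥ d₀: if G is an n-vertex (η,d)-quasirandom graph and φ is an edge-colouring of G that is (1−α)dn/2-bounded and locally ηn/(log n)⁴-bounded, then G has an α-decomposition into rainbow Hamilton cycles. -/

import Mathlib

namespace Paper

variable {V : Type*} {W : Type*} {C : Type*}

/-- The set of edges of `G` receiving colour `c` under `φ`. -/
def colourCls (G : SimpleGraph V) (φ : Sym2 V → C) (c : C) : Set (Sym2 V) :=
  {e | e ∈ G.edgeSet ∧ φ e = c}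

/-- `φ` is a (globally) `g`-bounded edge-colouring of `G`:
every colour is used on at most `g` edges. -/
def GBounded (G : SimpleGraph V) (φ : Sym2 V → C) (g : ℝ) : Prop :=
  ∀ c : C, ((colourCls G φ c).ncard : ℝ) ≤ g

/-- `φ` is a locally `l`-bounded edge-colouring of `G`:
every vertex is incident to at most `l` edges of each colour. -/
def LBounded (G : SimpleGraph V) (φ : Sym2 V → C) (l : ℝ) : Prop :=
  ∀ (v : V) (c : C), (({u | G.Adj v u ∧ φ s(v, u) = c}).ncard : ℝ) ≤ l

/-- A set of edges is rainbow if the colouring is injective on it. -/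
def Rainbow (φ : Sym2 V → C) (E : Set (Sym2 V)) : Prop :=
  Set.InjOn φ E

/-- The set of common neighbours `w` of `u` and `v` with `φ(uw) = φ(vw)`. -/
def monoSet (G : SimpleGraph V) (φ : Sym2 V → C) (u v : V) : Set V :=
  {w | G.Adj u w ∧ G.Adj v w ∧ φ s(u, w) = φ s(v, w)}

/-- The monochromatic codegree `c^φ_G(u,v)`. -/
noncomputable def monoCodeg (G : SimpleGraph V) (φ : Sym2 V → C) (u v : V) : ℕ :=
  (monoSet G φ u v).ncard

/-- Degree of `u` into the set `S`. -/
noncomputable def degIn (G : SimpleGraph V) (u : V) (S : Set V) : ℕ :=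
  (G.neighborSet u ∩ S).ncard

/-- Codegree of `u,v` into the set `S`. -/
noncomputable def codegIn (G : SimpleGraph V) (u v : V) (S : Set V) : ℕ :=
  (G.neighborSet u ∩ G.neighborSet v ∩ S).ncard

/-- `G` restricted to `S` is `(ε,d)`-quasirandom: all degrees (within `S`)
are `(d ± ε)|S|` and all but at most `ε|S|²` unordered pairs of distinct
vertices of `S` have codegree (within `S`) equal to `(d² ± ε)|S|`. -/
def QuasirandomOn (G : SimpleGraph V) (S : Set V) (ε d : ℝ) : Prop :=
  (∀ v ∈ S, |(degIn G v S : ℝ) - d * S.ncard| ≤ ε * S.ncard) ∧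
  ((({p : Sym2 V | ∃ u v, p = s(u, v) ∧ u ≠ v ∧ u ∈ S ∧ v ∈ S ∧
        ¬ (|(codegIn G u v S : ℝ) - d ^ 2 * S.ncard| ≤ ε * S.ncard)}).ncard : ℝ)
      ≤ ε * (S.ncard : ℝ) ^ 2)

/-- `G` is `(ε,d)`-quasirandom. -/
def Quasirandom (G : SimpleGraph V) (ε d : ℝ) : Prop :=
  QuasirandomOn G Set.univ ε d

/-- Edges of `G` with one endpoint in `X` and the other in `Y`. -/
def edgesBetween (G : SimpleGraph V) (X Y : Set V) : Set (Sym2 V) :=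
  {e | e ∈ G.edgeSet ∧ ∃ u v, e = s(u, v) ∧ u ∈ X ∧ v ∈ Y}

/-- The pair `(A,B)` is `(ε,d)`-regular in `G`. -/
def RegularPair (G : SimpleGraph V) (A B : Set V) (ε d : ℝ) : Prop :=
  ∀ X ⊆ A, ∀ Y ⊆ B, ε * A.ncard ≤ (X.ncard : ℝ) → ε * B.ncard ≤ (Y.ncard : ℝ) →
    |((edgesBetween G X Y).ncard : ℝ) / ((X.ncard : ℝ) * (Y.ncard : ℝ)) - d| ≤ ε

/-- The pair `(A,B)` is `(ε,d)`-superregular in `G`. -/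
def SuperregularPair (G : SimpleGraph V) (A B : Set V) (ε d : ℝ) : Prop :=
  RegularPair G A B ε d ∧
  (∀ u ∈ A, |(degIn G u B : ℝ) - d * B.ncard| ≤ ε * B.ncard) ∧
  (∀ v ∈ B, |(degIn G v A : ℝ) - d * A.ncard| ≤ ε * A.ncard)

/-- `H` is a copy of `F`: a subgraph of `G` isomorphic to `F`. -/
def IsCopy (F : SimpleGraph W) {G : SimpleGraph V} (H : G.Subgraph) : Prop :=
  Nonempty (F ≃g H.coe)

/-- `L` is the union of the family `𝒞` of pairwise vertex-disjoint copies of `F`. -/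
def IsFactorFrom (F : SimpleGraph W) {G : SimpleGraph V} (L : G.Subgraph)
    (𝒞 : Set G.Subgraph) : Prop :=
  (∀ H ∈ 𝒞, IsCopy F H) ∧
  𝒞.Pairwise (fun H₁ H₂ => Disjoint H₁.verts H₂.verts) ∧
  L = sSup 𝒞

/-- `L` consists of vertex-disjoint copies of `F`. -/
def IsFFactorSub (F : SimpleGraph W) {G : SimpleGraph V} (L : G.Subgraph) : Prop :=
  ∃ 𝒞 : Set G.Subgraph, IsFactorFrom F L 𝒞

/-- An `ε`-decomposition: pairwise edge-disjoint subgraphs of `G` which together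
contain all but at most an `ε`-proportion of the edges of `G`. -/
def ApxDecomp (G : SimpleGraph V) (ε : ℝ) {t : ℕ} (L : Fin t → G.Subgraph) : Prop :=
  (Pairwise fun i j => Disjoint (L i).edgeSet (L j).edgeSet) ∧
  ((G.edgeSet \ ⋃ i, (L i).edgeSet).ncard : ℝ) ≤ ε * (G.edgeSet.ncard : ℝ)

/-- `a(F) ≤ a`, where `a(F) = max {Δ(F), a'(F), a''(F)}`. -/
def AParamLe (F : SimpleGraph W) (a : ℕ) : Prop :=
  (∀ v, (F.neighborSet v).ncard ≤ a) ∧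
  (∀ u v, F.Adj u v →
    (F.neighborSet u).ncard + (F.neighborSet v).ncard - 2 ≤ a) ∧
  (∀ u v w, F.Adj u v → F.Adj v w → u ≠ w →
    (F.neighborSet u).ncard + (F.neighborSet v).ncard + (F.neighborSet w).ncard - 4 ≤ a)

end Paper

open Paper

section RandomSubset
variable {C : Type*}

/-- Expectation of `F` over a random subset of `s` containing each element independently with
probability `γ`. -/
noncomputable def subsetExp (γ : ℝ) (s : Finset C) (F : Finset C → ℝ) : ℝ :=
  ∑ T ∈ s.powerset, γ ^ T.card * (1 - γ) ^ (s.card - T.card) * F T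

theorem subsetExp_empty (γ : ℝ) (F : Finset C → ℝ) : subsetExp γ ∅ F = F ∅ := by
  simp [subsetExp]

theorem subsetExp_mono {γ : ℝ} (h0 : 0 ≤ γ) (h1 : γ ≤ 1) {s : Finset C} {F F' : Finset C → ℝ}
    (h : ∀ T ⊆ s, F T ≤ F' T) : subsetExp γ s F ≤ subsetExp γ s F' := by
  refine Finset.sum_le_sum fun T hT => ?_
  have : 0 ≤ 1 - γ := by linarith
  exact mul_le_mul_of_nonneg_left (h T (Finset.mem_powerset.1 hT)) (by positivity)

theorem subsetExp_mul_const (γ : ℝ) (s : Finset C) (F : Finset C → ℝ) (c : ℝ) :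
    subsetExp γ s (fun T => F T * c) = subsetExp γ s F * c := by
  simp only [subsetExp, Finset.sum_mul, mul_assoc]

theorem subsetExp_sum {ι : Type*} (γ : ℝ) (s : Finset C) (I : Finset ι) (F : ι → Finset C → ℝ) :
    subsetExp γ s (fun T => ∑ i ∈ I, F i T) = ∑ i ∈ I, subsetExp γ s (F i) := by
  simp only [subsetExp, Finset.mul_sum]
  rw [Finset.sum_comm]

theorem convex_exp_le {γ x c : ℝ} (h0 : 0 ≤ γ) (h1 : γ ≤ 1) (hx : |x| ≤ c) (hc : c ≤ 1) :
    (1 - γ) + γ * Real.exp x ≤ Real.exp (γ * x + c ^ 2) := by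
  have h2 := Real.abs_exp_sub_one_sub_id_le (hx.trans hc)
  have h3 : Real.exp x ≤ 1 + x + x ^ 2 := by linarith [(abs_le.1 h2).2]
  have h4 : x ^ 2 ≤ c ^ 2 := sq_le_sq.2 (hx.trans (le_abs_self c))
  have h5 : γ * x ^ 2 ≤ 1 * c ^ 2 := mul_le_mul h1 h4 (sq_nonneg _) zero_le_one
  have h6 := Real.add_one_le_exp (γ * x + c ^ 2)
  have h7 := mul_le_mul_of_nonneg_left h3 h0
  linarith

variable [DecidableEq C]

theorem subsetExp_insert (γ : ℝ) {s : Finset C} {a : C} (ha : a ∉ s) (F : Finset C → ℝ) :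
    subsetExp γ (insert a s) F = subsetExp γ s fun T => (1 - γ) * F T + γ * F (insert a T) := by
  unfold subsetExp
  rw [Finset.sum_powerset_insert ha, ← Finset.sum_add_distrib]
  refine Finset.sum_congr rfl fun T hT => ?_
  have hTs := Finset.mem_powerset.1 hT
  have h1 : T.card ≤ s.card := Finset.card_le_card hTs
  rw [Finset.card_insert_of_notMem ha, Finset.card_insert_of_notMem fun h => ha (hTs h),
    Nat.succ_sub h1, Nat.add_sub_add_right, Nat.succ_eq_add_one, pow_succ, pow_succ]
  ring

theorem subsetExp_const (γ : ℝ) (s : Finset C) (c : ℝ) : subsetExp γ s (fun _ => c) = c := by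
  induction s using Finset.induction_on with
  | empty => rw [subsetExp_empty]
  | insert a s ha ih =>
    rw [subsetExp_insert γ ha]
    convert ih using 2
    ext; ring

theorem subsetExp_ite_subset (γ : ℝ) {s : Finset C} :
    ∀ {A : Finset C}, A ⊆ s → subsetExp γ s (fun T => if A ⊆ T then 1 else 0) = γ ^ A.card := by
  induction s using Finset.induction_on with
  | empty =>
    intro A hA
    rw [subsetExp_empty, Finset.subset_empty.1 hA]; simp
  | insert a s ha ih =>
    intro A hA
    rw [subsetExp_insert γ ha]
    by_cases haA : a ∈ A
    · have h1 : A.erase a ⊆ s := by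
        rw [Finset.subset_insert_iff] at hA; exact hA
      rw [← Finset.card_erase_add_one haA, pow_succ, ← ih h1, ← subsetExp_mul_const]
      unfold subsetExp
      refine Finset.sum_congr rfl fun T hT => ?_
      have h2 : ¬ A ⊆ T := fun h => ha (Finset.mem_powerset.1 hT (h haA))
      simp only [h2, if_false, Finset.subset_insert_iff]
      ring
    · have h1 : A ⊆ s := by
        rw [Finset.subset_insert_iff, Finset.erase_eq_of_notMem haA] at hA; exact hA
      rw [← ih h1]
      unfold subsetExp
      refine Finset.sum_congr rfl fun T hT => ?_
      have h2 : A ⊆ insert a T ↔ A ⊆ T := by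
        rw [Finset.subset_insert_iff, Finset.erase_eq_of_notMem haA]
      simp only [h2]
      ring

theorem subsetExp_exp_le {γ : ℝ} (h0 : 0 ≤ γ) (h1 : γ ≤ 1) (c : C → ℝ) {s : Finset C}
    (hc : ∀ a ∈ s, c a ≤ 1) :
    ∀ F : Finset C → ℝ, (∀ a ∈ s, ∀ T, |F (insert a T) - F T| ≤ c a) →
      subsetExp γ s (fun T => Real.exp (F T)) ≤
        Real.exp (subsetExp γ s F + ∑ a ∈ s, c a ^ 2) := by
  induction s using Finset.induction_on with
  | empty => intro F _; simp [subsetExp_empty]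
  | insert a s ha ih =>
    intro F hF
    rw [subsetExp_insert γ ha, subsetExp_insert γ ha, Finset.sum_insert ha]
    set F' : Finset C → ℝ := fun T => (1 - γ) * F T + γ * F (insert a T) with hF'
    have h2 := ih (fun b hb => hc b (Finset.mem_insert_of_mem hb)) F' (fun b hb T => by
      have e1 := hF b (Finset.mem_insert_of_mem hb) T
      have e2 := hF b (Finset.mem_insert_of_mem hb) (insert a T)
      rw [Finset.insert_comm] at e2
      rw [abs_le] at e1 e2 ⊢
      have h1' : 0 ≤ 1 - γ := by linarith
      have e3 : F' (insert b T) - F' T = (1 - γ) * (F (insert b T) - F T) +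
        γ * (F (insert a (insert b T)) - F (insert a T)) := by simp only [hF']; ring
      rw [e3]
      have f1 := mul_le_mul_of_nonneg_left e1.1 h1'
      have f2 := mul_le_mul_of_nonneg_left e1.2 h1'
      have f3 := mul_le_mul_of_nonneg_left e2.1 h0
      have f4 := mul_le_mul_of_nonneg_left e2.2 h0
      constructor <;> linarith)
    calc _ ≤ subsetExp γ s (fun T => Real.exp (F' T) * Real.exp (c a ^ 2)) := by
          refine subsetExp_mono h0 h1 fun T _ => ?_
          have h3 := convex_exp_le h0 h1 (hF a (Finset.mem_insert_self _ _) T)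
            (hc a (Finset.mem_insert_self _ _))
          have h4 := mul_le_mul_of_nonneg_left h3 (Real.exp_pos (F T)).le
          refine (le_of_eq ?_).trans (h4.trans (le_of_eq ?_))
          · rw [Real.exp_sub]
            field_simp
          · rw [← Real.exp_add, ← Real.exp_add]
            congr 1; simp only [hF']; ring
      _ = subsetExp γ s (fun T => Real.exp (F' T)) * Real.exp (c a ^ 2) :=
          subsetExp_mul_const _ _ _ _
      _ ≤ Real.exp (subsetExp γ s F' + ∑ a ∈ s, c a ^ 2) * Real.exp (c a ^ 2) := by gcongr
      _ = _ := by rw [← Real.exp_add]; congr 1; ring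

/-- Concentration for the number of sets of a family that are contained in a random set. -/
theorem exists_subset_concentrated {W Q : Type*} {γ : ℝ} (h0 : 0 ≤ γ) (h1 : γ ≤ 1)
    (s : Finset C) (Qs : Finset Q) (N : Q → Finset W) (A : Q → W → Finset C) {lam m n D : ℝ}
    (hA : ∀ q ∈ Qs, ∀ w ∈ N q, A q w ⊆ s ∧ (A q w).card ≤ 2)
    (hN : ∀ q ∈ Qs, ((N q).card : ℝ) ≤ n)
    (hm : ∀ q ∈ Qs, ∀ a, (((N q).filter fun w => a ∈ A q w).card : ℝ) ≤ m) (hm0 : 0 ≤ m)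
    (hlam : 0 ≤ lam) (hlm : lam * m ≤ 1)
    (hexp : 2 * Qs.card * Real.exp (2 * lam ^ 2 * m * n - lam * D) < 1) :
    ∃ T ⊆ s, ∀ q ∈ Qs, |(((N q).filter fun w => A q w ⊆ T).card : ℝ) -
      ∑ w ∈ N q, γ ^ (A q w).card| ≤ D := by
  set Z : Q → Finset C → ℝ := fun q T => (((N q).filter fun w => A q w ⊆ T).card : ℝ) -
      ∑ w ∈ N q, γ ^ (A q w).card with hZ
  have hcount : ∀ q T, (((N q).filter fun w => A q w ⊆ T).card : ℝ) =
      ∑ w ∈ N q, if A q w ⊆ T then (1 : ℝ) else 0 := by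
    intro q T; simp
  have hE : ∀ q ∈ Qs, subsetExp γ s (Z q) = 0 := by
    intro q hq
    have : Z q = fun T => (∑ w ∈ N q, ((if A q w ⊆ T then (1 : ℝ) else 0) +
        - γ ^ (A q w).card)) := by
      ext T; simp only [hZ, hcount, Finset.sum_add_distrib, Finset.sum_neg_distrib]; ring
    rw [this, subsetExp_sum]
    refine Finset.sum_eq_zero fun w hw => ?_
    have e1 := subsetExp_ite_subset γ (hA q hq w hw).1
    have e2 := subsetExp_const γ s (- γ ^ (A q w).card)
    unfold subsetExp at e1 e2 ⊢
    simp only [mul_add, Finset.sum_add_distrib]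
    rw [e1, e2]; ring
  set c : Q → C → ℝ := fun q a => lam * (((N q).filter fun w => a ∈ A q w).card : ℝ) with hc
  have hdiff : ∀ q ∈ Qs, ∀ a ∈ s, ∀ T, |Z q (insert a T) - Z q T| ≤
      (((N q).filter fun w => a ∈ A q w).card : ℝ) := by
    intro q hq a ha T
    have : Z q (insert a T) - Z q T = ∑ w ∈ N q, ((if A q w ⊆ insert a T then (1 : ℝ) else 0) -
        if A q w ⊆ T then (1 : ℝ) else 0) := by
      simp only [hZ, hcount, Finset.sum_sub_distrib]; ring
    rw [this]
    refine (Finset.abs_sum_le_sum_abs _ _).trans ?_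
    rw [Finset.card_filter]
    push_cast
    refine Finset.sum_le_sum fun w hw => ?_
    by_cases haw : a ∈ A q w
    · split_ifs <;> norm_num
    · have : A q w ⊆ insert a T ↔ A q w ⊆ T := by
        rw [Finset.subset_insert_iff, Finset.erase_eq_of_notMem haw]
      simp [haw, this]
  have hc1 : ∀ q ∈ Qs, ∀ a ∈ s, c q a ≤ 1 := fun q hq a _ =>
    (mul_le_mul_of_nonneg_left (hm q hq a) hlam).trans hlm
  have hcsum : ∀ q ∈ Qs, ∑ a ∈ s, c q a ^ 2 ≤ 2 * lam ^ 2 * m * n := by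
    intro q hq
    have e1 : ∑ a ∈ s, (((N q).filter fun w => a ∈ A q w).card : ℝ) ≤ 2 * n := by
      calc _ = ∑ w ∈ N q, ∑ a ∈ s, (if a ∈ A q w then (1 : ℝ) else 0) := by
            rw [Finset.sum_comm]; simp
        _ ≤ ∑ w ∈ N q, (2 : ℝ) := by
            refine Finset.sum_le_sum fun w hw => ?_
            rw [← Finset.sum_filter, Finset.sum_const, nsmul_eq_mul, mul_one]
            have : (s.filter fun a => a ∈ A q w).card ≤ 2 :=
              (Finset.card_le_card fun a ha => (Finset.mem_filter.1 ha).2).trans (hA q hq w hw).2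
            exact_mod_cast this
        _ = 2 * ((N q).card : ℝ) := by rw [Finset.sum_const, nsmul_eq_mul]; ring
        _ ≤ 2 * n := by linarith [hN q hq]
    calc ∑ a ∈ s, c q a ^ 2 ≤
          ∑ a ∈ s, lam ^ 2 * m * (((N q).filter fun w => a ∈ A q w).card : ℝ) := by
          refine Finset.sum_le_sum fun a _ => ?_
          simp only [hc]
          have := mul_le_mul_of_nonneg_right (hm q hq a)
            (Nat.cast_nonneg (α := ℝ) ((N q).filter fun w => a ∈ A q w).card)
          have := mul_le_mul_of_nonneg_left this (sq_nonneg lam)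
          linarith
      _ = lam ^ 2 * m * ∑ a ∈ s, (((N q).filter fun w => a ∈ A q w).card : ℝ) := by
          rw [Finset.mul_sum]
      _ ≤ lam ^ 2 * m * (2 * n) := by gcongr
      _ = _ := by ring
  have hmgf : ∀ q ∈ Qs, ∀ σ : ℝ, |σ| = 1 →
      subsetExp γ s (fun T => Real.exp (lam * (σ * Z q T - D))) ≤
        Real.exp (2 * lam ^ 2 * m * n - lam * D) := by
    intro q hq σ hσ
    have e1 := subsetExp_exp_le h0 h1 (c q) (hc1 q hq) (fun T => Z q T * (lam * σ))
      (fun a ha T => by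
        rw [← sub_mul, abs_mul, abs_mul, hσ, mul_one, abs_of_nonneg hlam, mul_comm]
        exact mul_le_mul_of_nonneg_left (hdiff q hq a ha T) hlam)
    rw [subsetExp_mul_const, hE q hq, zero_mul, zero_add] at e1
    have e2 : subsetExp γ s (fun T => Real.exp (lam * (σ * Z q T - D))) =
        subsetExp γ s (fun T => Real.exp (Z q T * (lam * σ))) * Real.exp (- (lam * D)) := by
      rw [← subsetExp_mul_const]
      congr 1; ext T; rw [← Real.exp_add]; congr 1; ring
    rw [e2]
    calc _ ≤ Real.exp (2 * lam ^ 2 * m * n) * Real.exp (- (lam * D)) := by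
          gcongr
          exact e1.trans (Real.exp_le_exp.2 (hcsum q hq))
      _ = _ := by rw [← Real.exp_add]; rfl
  by_contra hcon
  push Not at hcon
  have hbig : (1 : ℝ) ≤ subsetExp γ s (fun T => ∑ q ∈ Qs, (Real.exp (lam * (1 * Z q T - D)) +
      Real.exp (lam * (-1 * Z q T - D)))) := by
    refine (subsetExp_const γ s 1).symm.le.trans ?_
    refine subsetExp_mono h0 h1 fun T hT => ?_
    obtain ⟨q, hq, hlt⟩ := hcon T hT
    refine le_trans ?_ (Finset.single_le_sum (f := fun q => Real.exp (lam * (1 * Z q T - D)) +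
      Real.exp (lam * (-1 * Z q T - D))) (fun _ _ => by positivity) hq)
    rcases lt_abs.1 hlt with h | h
    · have : 1 ≤ Real.exp (lam * (1 * Z q T - D)) :=
        Real.one_le_exp (mul_nonneg hlam (by simp only [hZ]; linarith))
      linarith [Real.exp_pos (lam * (-1 * Z q T - D))]
    · have : 1 ≤ Real.exp (lam * (-1 * Z q T - D)) :=
        Real.one_le_exp (mul_nonneg hlam (by simp only [hZ]; linarith))
      linarith [Real.exp_pos (lam * (1 * Z q T - D))]
  rw [subsetExp_sum] at hbig
  have hsmall : ∑ q ∈ Qs, subsetExp γ s (fun T => Real.exp (lam * (1 * Z q T - D)) +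
      Real.exp (lam * (-1 * Z q T - D))) ≤
      Qs.card * (2 * Real.exp (2 * lam ^ 2 * m * n - lam * D)) := by
    rw [← nsmul_eq_mul]
    refine Finset.sum_le_card_nsmul _ _ _ fun q hq => ?_
    have e1 := hmgf q hq 1 (by norm_num)
    have e2 := hmgf q hq (-1) (by norm_num)
    have e3 : subsetExp γ s (fun T => Real.exp (lam * (1 * Z q T - D)) +
      Real.exp (lam * (-1 * Z q T - D))) = subsetExp γ s (fun T => Real.exp (lam * (1 * Z q T - D)))
      + subsetExp γ s (fun T => Real.exp (lam * (-1 * Z q T - D))) := by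
      simp only [subsetExp, mul_add, Finset.sum_add_distrib]
    linarith
  linarith

end RandomSubset

section Discrepancy
variable {V : Type*} [Fintype V]

/-- Degrees at least `(p - ζ) n` and typical codegrees at most `(p ^ 2 + ζ) n` force every pair of
vertex sets to span at least roughly the expected number of edges. -/
theorem discrepancy_of_codegree {R : V → V → Prop} [DecidableRel R]
    {p ζ β n : ℝ} (hn : n = Fintype.card V) (hp0 : 0 ≤ p) (hp1 : p ≤ 1) (hζ : 0 ≤ ζ) (hβ : 0 < β)
    (hζβ : 4 * ζ ≤ β ^ 2) (hn0 : 0 < n)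
    (hdeg : ∀ v, (p - ζ) * n ≤ (Finset.univ.filter fun w => R v w).card)
    (hbad : ((Finset.univ.filter fun q : V × V => ¬
      ((Finset.univ.filter fun w => R q.1 w ∧ R q.2 w).card : ℝ) ≤ (p ^ 2 + ζ) * n).card : ℝ) ≤
        ζ * n ^ 2) (X Y : Finset V) :
    p * X.card * Y.card - β * n ^ 2 ≤ ((X ×ˢ Y).filter fun q => R q.1 q.2).card := by
  set f : V → ℝ := fun w => (X.filter fun x => R x w).card with hf
  have hf' : ∀ w, f w = ∑ x ∈ X, if R x w then (1 : ℝ) else 0 := fun w => by simp [hf]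
  have hXn : (X.card : ℝ) ≤ n := by rw [hn]; exact_mod_cast Finset.card_le_univ X
  have hYn : (Y.card : ℝ) ≤ n := by rw [hn]; exact_mod_cast Finset.card_le_univ Y
  have hX0 : (0 : ℝ) ≤ X.card := Nat.cast_nonneg _
  have h1 : X.card * ((p - ζ) * n) ≤ ∑ w, f w := by
    simp only [hf']
    rw [Finset.sum_comm, ← nsmul_eq_mul]
    refine Finset.card_nsmul_le_sum _ _ _ fun x _ => ?_
    simpa using hdeg x
  have h2 : ∑ w, f w ^ 2 ≤ X.card ^ 2 * ((p ^ 2 + ζ) * n) + ζ * n ^ 2 * n := by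
    have e1 : ∑ w, f w ^ 2 = ∑ q ∈ X ×ˢ X,
        ((Finset.univ.filter fun w => R q.1 w ∧ R q.2 w).card : ℝ) := by
      calc ∑ w, f w ^ 2 = ∑ w, ∑ q ∈ X ×ˢ X, if R q.1 w ∧ R q.2 w then (1 : ℝ) else 0 := by
            refine Finset.sum_congr rfl fun w _ => ?_
            rw [sq, hf', Finset.sum_mul_sum, Finset.sum_product]
            refine Finset.sum_congr rfl fun x _ => Finset.sum_congr rfl fun y _ => ?_
            by_cases h : R x w <;> by_cases h' : R y w <;> simp [h, h']
        _ = _ := by rw [Finset.sum_comm]; simp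
    have hsq : 0 ≤ (p ^ 2 + ζ) * n := by positivity
    rw [e1]
    calc _ ≤ ∑ q ∈ X ×ˢ X, ((p ^ 2 + ζ) * n + if ¬
          ((Finset.univ.filter fun w => R q.1 w ∧ R q.2 w).card : ℝ) ≤ (p ^ 2 + ζ) * n
          then n else 0) := by
          refine Finset.sum_le_sum fun q _ => ?_
          split_ifs with h
          · linarith
          · have : ((Finset.univ.filter fun w => R q.1 w ∧ R q.2 w).card : ℝ) ≤ n := by
              rw [hn]; exact_mod_cast Finset.card_le_univ _
            linarith
      _ ≤ _ := by
          rw [Finset.sum_add_distrib, Finset.sum_const, Finset.card_product, nsmul_eq_mul,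
            ← Finset.sum_filter, Finset.sum_const, nsmul_eq_mul]
          have e2 : (((X ×ˢ X).filter fun q => ¬
              ((Finset.univ.filter fun w => R q.1 w ∧ R q.2 w).card : ℝ) ≤
                (p ^ 2 + ζ) * n).card : ℝ) ≤ ζ * n ^ 2 := by
            refine le_trans ?_ hbad
            exact_mod_cast Finset.card_le_card (Finset.filter_subset_filter _ (Finset.subset_univ _))
          have e3 := mul_le_mul_of_nonneg_right e2 hn0.le
          push_cast
          linarith
  have h3 : ∑ w, (f w - p * X.card) ^ 2 ≤ 4 * ζ * n ^ 3 := by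
    have e1 : ∑ w, (f w - p * X.card) ^ 2 = ∑ w, f w ^ 2 - 2 * p * X.card * ∑ w, f w +
        n * (p * X.card) ^ 2 := by
      rw [hn, Finset.mul_sum, ← Finset.sum_sub_distrib, ← Finset.card_univ, ← nsmul_eq_mul,
        ← Finset.sum_const, ← Finset.sum_add_distrib]
      exact Finset.sum_congr rfl fun w _ => by ring
    have e2 := mul_le_mul_of_nonneg_left h1 (show 0 ≤ 2 * p * (X.card : ℝ) by positivity)
    have e3 : (X.card : ℝ) ^ 2 ≤ n ^ 2 := pow_le_pow_left₀ hX0 hXn 2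
    have e4 : (X.card : ℝ) ^ 2 * (ζ * n * (1 + 2 * p)) ≤ n ^ 2 * (ζ * n * 3) := by
      refine mul_le_mul e3 ?_ (by positivity) (by positivity)
      exact mul_le_mul_of_nonneg_left (by linarith) (by positivity)
    rw [e1]
    nlinarith [e2, e4, h2]
  have h4 : (((X ×ˢ Y).filter fun q => R q.1 q.2).card : ℝ) = ∑ y ∈ Y, f y := by
    simp only [hf']
    rw [Finset.sum_comm, ← Finset.sum_product', Finset.sum_boole]
  rw [h4]
  have h5 : ∑ y ∈ Y, (p * X.card - f y) ≤ ∑ y ∈ Y, ((f y - p * X.card) ^ 2 / (2 * β * n) +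
      β * n / 2) := by
    refine Finset.sum_le_sum fun y _ => ?_
    have hbn : 0 < β * n := by positivity
    have : (f y - p * X.card) ^ 2 / (2 * β * n) + β * n / 2 - (p * X.card - f y) =
        (f y - p * X.card + β * n) ^ 2 / (2 * β * n) := by field_simp; ring
    have h : 0 ≤ (f y - p * X.card + β * n) ^ 2 / (2 * β * n) := by positivity
    linarith
  have h6 : ∑ y ∈ Y, (f y - p * X.card) ^ 2 ≤ β ^ 2 * n ^ 3 := by
    refine (Finset.sum_le_sum_of_subset_of_nonneg (Finset.subset_univ Y)
      fun _ _ _ => sq_nonneg _).trans (h3.trans ?_)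
    gcongr
  rw [Finset.sum_add_distrib, ← Finset.sum_div, Finset.sum_sub_distrib, Finset.sum_const,
    Finset.sum_const, nsmul_eq_mul, nsmul_eq_mul] at h5
  have h7 : (∑ y ∈ Y, (f y - p * X.card) ^ 2) / (2 * β * n) ≤ β * n ^ 2 / 2 := by
    rw [div_le_iff₀ (by positivity)]
    calc _ ≤ _ := h6
      _ = _ := by ring
  have h8 : (Y.card : ℝ) * (β * n / 2) ≤ n * (β * n / 2) := by gcongr
  linarith

end Discrepancy

section Reserve
variable {V : Type*} [Fintype V] [DecidableEq V]

/-- A random set of colours yields a quasirandom graph of edges with colours in that set. -/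
theorem exists_reserve_colours (G : SimpleGraph V) [DecidableRel G.Adj] (φ : Sym2 V → ℕ)
    {γ d η ξ β ℓ lam n : ℝ} (hn : n = Fintype.card V) (h0 : 0 ≤ γ) (h1 : γ ≤ 1) (hd0 : 0 ≤ d)
    (hd1 : γ * d ≤ 1) (hη : 0 ≤ η) (hξ : 0 < ξ) (hξ1 : ξ ≤ 1) (hβ : 0 < β)
    (hβ2 : 8 * (η + ξ) ≤ β ^ 2) (hnξ : 1 ≤ ξ * n)
    (hdeg : ∀ v, |((Finset.univ.filter fun u => G.Adj v u).card : ℝ) - d * n| ≤ η * n)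
    (hcodeg : ((Finset.univ.filter fun q : V × V => q.1 ≠ q.2 ∧ ¬
      |((Finset.univ.filter fun w => G.Adj q.1 w ∧ G.Adj q.2 w).card : ℝ) - d ^ 2 * n| ≤
        η * n).card : ℝ) ≤ 2 * η * n ^ 2)
    (hℓ : ∀ v c, ((Finset.univ.filter fun u => G.Adj v u ∧ φ s(v, u) = c).card : ℝ) ≤ ℓ)
    (hℓ0 : 0 ≤ ℓ) (hℓn : ℓ ≤ ξ ^ 2 * n) (hlam : 0 ≤ lam) (hlamℓ : 8 * lam * ℓ ≤ ξ)
    (hexp : 2 * n ^ 2 * Real.exp (- (lam * ξ * n / 2)) < 1) :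
    ∃ T : Finset ℕ,
      (∀ v, |((Finset.univ.filter fun u => G.Adj v u ∧ φ s(v, u) ∈ T).card : ℝ) - γ * d * n| ≤
        (η + ξ) * n) ∧
      ∀ X Y : Finset V, γ * d * X.card * Y.card - β * n ^ 2 ≤
        ((X ×ˢ Y).filter fun q => G.Adj q.1 q.2 ∧ φ s(q.1, q.2) ∈ T).card := by
  have hnpos : 0 < n := by
    by_contra h
    have := mul_nonpos_of_nonneg_of_nonpos hξ.le (not_lt.1 h)
    linarith
  set N : V × V → Finset V := fun q => Finset.univ.filter fun w => G.Adj q.1 w ∧ G.Adj q.2 w with hN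
  set A : V × V → V → Finset ℕ := fun q w => {φ s(q.1, w), φ s(q.2, w)} with hA
  obtain ⟨T, -, hT⟩ := exists_subset_concentrated (lam := lam) (m := 2 * ℓ) (n := n) (D := ξ * n)
    h0 h1 (Finset.univ.image φ) (Finset.univ : Finset (V × V)) N A
    (fun q _ w _ => ⟨by
      intro c hc
      simp only [hA, Finset.mem_insert, Finset.mem_singleton] at hc
      rcases hc with rfl | rfl <;> exact Finset.mem_image_of_mem _ (Finset.mem_univ _),
      Finset.card_le_two⟩)
    (fun q _ => by rw [hn]; exact_mod_cast Finset.card_le_univ _)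
    (fun q _ c => by
      have hsub : ((N q).filter fun w => c ∈ A q w) ⊆
          (Finset.univ.filter fun u => G.Adj q.1 u ∧ φ s(q.1, u) = c) ∪
          (Finset.univ.filter fun u => G.Adj q.2 u ∧ φ s(q.2, u) = c) := by
        intro w hw
        simp only [hN, hA, Finset.mem_filter, Finset.mem_univ, true_and, Finset.mem_insert,
          Finset.mem_singleton, Finset.mem_union] at hw ⊢
        rcases hw with ⟨⟨a, b⟩, h | h⟩
        · exact Or.inl ⟨a, h.symm⟩
        · exact Or.inr ⟨b, h.symm⟩
      have h := (Finset.card_le_card hsub).trans (Finset.card_union_le _ _)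
      have h' : (((N q).filter fun w => c ∈ A q w).card : ℝ) ≤ _ := Nat.cast_le.2 h
      push_cast at h'
      linarith [hℓ q.1 c, hℓ q.2 c])
    (by linarith) hlam (by nlinarith) (by
      rw [Finset.card_univ, Fintype.card_prod]
      push_cast
      rw [← hn, ← sq]
      refine lt_of_le_of_lt ?_ hexp
      have : lam * (8 * lam * ℓ) * n ≤ lam * ξ * n := by gcongr
      have := Real.exp_le_exp.2 (show 2 * lam ^ 2 * (2 * ℓ) * n - lam * (ξ * n) ≤
        - (lam * ξ * n / 2) by nlinarith)
      gcongr)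
  have hdegR : ∀ v, |((Finset.univ.filter fun u => G.Adj v u ∧ φ s(v, u) ∈ T).card : ℝ) -
      γ * d * n| ≤ (η + ξ) * n := by
    intro v
    have e := hT (v, v) (Finset.mem_univ _)
    simp only [hN, hA, and_self, Finset.pair_eq_singleton, Finset.singleton_subset_iff,
      Finset.card_singleton, pow_one, Finset.sum_const, nsmul_eq_mul, Finset.filter_filter] at e
    have e2 := hdeg v
    rw [abs_le] at e e2 ⊢
    have f1 := mul_le_mul_of_nonneg_left e2.1 h0
    have f2 := mul_le_mul_of_nonneg_left e2.2 h0
    have f3 : γ * (η * n) ≤ 1 * (η * n) := by gcongr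
    constructor <;> linarith
  refine ⟨T, hdegR, ?_⟩
  set M : V × V → Finset V := fun q =>
    (N q).filter fun w => φ s(q.1, w) = φ s(q.2, w) with hM
  have hMsum : ∑ q, ((M q).card : ℝ) ≤ n ^ 2 * ℓ := by
    calc ∑ q, ((M q).card : ℝ) = ∑ q : V × V, ∑ w, if G.Adj q.1 w ∧ G.Adj q.2 w ∧
          φ s(q.1, w) = φ s(q.2, w) then (1 : ℝ) else 0 := by
          simp [hM, hN, Finset.filter_filter, and_assoc]
      _ = ∑ x, ∑ w, ∑ y, if G.Adj x w ∧ G.Adj y w ∧ φ s(x, w) = φ s(y, w) then (1 : ℝ) else 0 := by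
          rw [Fintype.sum_prod_type]
          exact Finset.sum_congr rfl fun x _ => Finset.sum_comm
      _ ≤ ∑ _x : V, ∑ _w : V, ℓ := by
          refine Finset.sum_le_sum fun x _ => Finset.sum_le_sum fun w _ => ?_
          refine le_trans ?_ (hℓ w (φ s(x, w)))
          rw [Finset.sum_boole]
          refine Nat.cast_le.2 (Finset.card_le_card fun y hy => ?_)
          simp only [Finset.mem_filter, Finset.mem_univ, true_and] at hy ⊢
          exact ⟨hy.2.1.symm, by rw [Sym2.eq_swap, hy.2.2]⟩
      _ = n ^ 2 * ℓ := by
          simp only [Finset.sum_const, Finset.card_univ, nsmul_eq_mul, ← hn]; ring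
  have hMbad : ((Finset.univ.filter fun q => ¬ ((M q).card : ℝ) ≤ ξ * n).card : ℝ) ≤ ξ * n ^ 2 := by
    have e1 : ((Finset.univ.filter fun q => ¬ ((M q).card : ℝ) ≤ ξ * n).card : ℝ) * (ξ * n) ≤
        n ^ 2 * ℓ := by
      refine le_trans ?_ hMsum
      rw [← nsmul_eq_mul]
      refine (Finset.card_nsmul_le_sum _ (fun q => ((M q).card : ℝ)) _ fun q hq => ?_).trans
        (Finset.sum_le_sum_of_subset_of_nonneg (Finset.filter_subset _ _) fun _ _ _ => by positivity)
      exact (not_le.1 (Finset.mem_filter.1 hq).2).le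
    have e2 : n ^ 2 * ℓ ≤ (ξ * n ^ 2) * (ξ * n) := by
      have := mul_le_mul_of_nonneg_left hℓn (sq_nonneg n)
      linarith
    exact le_of_mul_le_mul_right (e1.trans e2) (by positivity)
  refine discrepancy_of_codegree (R := fun u v => G.Adj u v ∧ φ s(u, v) ∈ T)
    (ζ := 2 * (η + ξ))
    hn (by positivity) hd1
    (by positivity) hβ (by linarith) hnpos ?_ ?_
  · intro v
    have := (abs_le.1 (hdegR v)).1
    have : 0 ≤ (η + ξ) * n := by positivity
    linarith
  · have hsub : (Finset.univ.filter fun q : V × V => ¬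
        ((Finset.univ.filter fun w => (G.Adj q.1 w ∧ φ s(q.1, w) ∈ T) ∧
          G.Adj q.2 w ∧ φ s(q.2, w) ∈ T).card : ℝ) ≤ ((γ * d) ^ 2 + 2 * (η + ξ)) * n) ⊆
        (Finset.univ.image fun v : V => (v, v)) ∪ ((Finset.univ.filter fun q : V × V =>
          q.1 ≠ q.2 ∧ ¬ |((Finset.univ.filter fun w => G.Adj q.1 w ∧ G.Adj q.2 w).card : ℝ) -
            d ^ 2 * n| ≤ η * n) ∪ Finset.univ.filter fun q => ¬ ((M q).card : ℝ) ≤ ξ * n) := by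
      intro q hq
      by_contra hcon
      simp only [Finset.mem_union, Finset.mem_image, Finset.mem_univ, true_and, Finset.mem_filter,
        not_or, not_and, not_not, not_exists] at hcon hq
      obtain ⟨c1, c2, c3⟩ := hcon
      have hne : q.1 ≠ q.2 := fun h => c1 q.1 (by ext <;> simp [h])
      have c4 := (abs_le.1 (c2 hne)).2
      refine hq ?_
      have e := (abs_le.1 (hT q (Finset.mem_univ _))).2
      have e1 : ((N q).filter fun w => A q w ⊆ T) = Finset.univ.filter fun w =>
          (G.Adj q.1 w ∧ φ s(q.1, w) ∈ T) ∧ G.Adj q.2 w ∧ φ s(q.2, w) ∈ T := by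
        ext w
        simp only [hN, hA, Finset.mem_filter, Finset.mem_univ, true_and, Finset.insert_subset_iff,
          Finset.singleton_subset_iff]
        tauto
      have e2 : ∑ w ∈ N q, γ ^ (A q w).card ≤ γ ^ 2 * (N q).card + (M q).card := by
        have e3 : ((M q).card : ℝ) = ∑ w ∈ N q,
            if φ s(q.1, w) = φ s(q.2, w) then (1 : ℝ) else 0 := by simp [hM]
        rw [e3, mul_comm, ← nsmul_eq_mul, ← Finset.sum_const, ← Finset.sum_add_distrib]
        refine Finset.sum_le_sum fun w _ => ?_
        by_cases h : φ s(q.1, w) = φ s(q.2, w)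
        · have : γ ^ (A q w).card ≤ 1 := pow_le_one₀ h0 h1
          have := sq_nonneg γ
          rw [if_pos h]; linarith
        · rw [if_neg h, add_zero]
          simp only [hA]
          rw [Finset.card_pair h]
      rw [e1] at e
      have e4 : γ ^ 2 * ((N q).card : ℝ) ≤ γ ^ 2 * (d ^ 2 * n) + η * n := by
        have g1 : γ ^ 2 * ((N q).card : ℝ) ≤ γ ^ 2 * (d ^ 2 * n + η * n) :=
          mul_le_mul_of_nonneg_left (by linarith) (sq_nonneg γ)
        have g2 : γ ^ 2 * (η * n) ≤ 1 * (η * n) :=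
          mul_le_mul_of_nonneg_right (pow_le_one₀ h0 h1) (by positivity)
        linarith
      have : 0 ≤ η * n := by positivity
      nlinarith
    have h := (Finset.card_le_card hsub).trans ((Finset.card_union_le _ _).trans
      (add_le_add_right (Finset.card_union_le _ _) _))
    have h' := (Nat.cast_le (α := ℝ)).2 h
    push_cast at h'
    have hdiag : ((Finset.univ.image fun v : V => (v, v)).card : ℝ) ≤ ξ * n ^ 2 := by
      have e1 : ((Finset.univ.image fun v : V => (v, v)).card : ℝ) ≤ n := by
        rw [hn]; exact_mod_cast Finset.card_image_le
      have e2 := mul_le_mul_of_nonneg_right hnξ hnpos.le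
      linarith
    linarith

end Reserve

theorem sum_mul_exp_le_one {Ω : Type*} (s : Finset Ω) (pr y : Ω → ℝ) (L κ ξ B : ℝ)
    (hpr : ∀ ω ∈ s, 0 ≤ pr ω) (hsum : ∑ ω ∈ s, pr ω = 1) (hL : 0 ≤ L) (hκ : 0 ≤ κ) (hξ : 0 ≤ ξ)
    (hLy : ∀ ω ∈ s, L * |y ω| ≤ 1 / 2) (hLκ : L * (60 * κ * ξ) ≤ 1 / 2)
    (hE : ∑ ω ∈ s, pr ω * y ω ≤ 30 * κ * ξ)
    (hE2 : ∑ ω ∈ s, pr ω * (y ω) ^ 2 ≤ B * κ)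
    (hB : 2 * L * (B + 3600 * κ * ξ ^ 2) ≤ 30 * ξ) :
    ∑ ω ∈ s, pr ω * Real.exp (L * (y ω - 60 * κ * ξ)) ≤ 1 := by
  have key : ∀ ω ∈ s, pr ω * Real.exp (L * (y ω - 60 * κ * ξ)) ≤
      pr ω + L * (pr ω * y ω) - L * 60 * κ * ξ * pr ω + 2 * L ^ 2 * (pr ω * (y ω) ^ 2)
        + 2 * L ^ 2 * (3600 * κ ^ 2 * ξ ^ 2) * pr ω := by
    intro ω hω
    set x := L * (y ω - 60 * κ * ξ) with hx
    have h0 : 0 ≤ L * (60 * κ * ξ) := by positivity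
    have hx1 : |x| ≤ 1 := by
      have h1 := hLy ω hω
      have : L * |y ω| = |L * y ω| := by rw [abs_mul, abs_of_nonneg hL]
      rw [this] at h1
      rw [abs_le] at h1 ⊢
      constructor <;> rw [hx] <;> linarith
    have h2 := Real.abs_exp_sub_one_sub_id_le hx1
    rw [abs_le] at h2
    have h3 : Real.exp x ≤ 1 + x + x ^ 2 := by linarith
    have h4 : x ^ 2 ≤ 2 * L ^ 2 * (y ω) ^ 2 + 2 * L ^ 2 * (3600 * κ ^ 2 * ξ ^ 2) := by
      rw [hx]
      nlinarith [sq_nonneg (L * (y ω + 60 * κ * ξ))]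
    have h5 : Real.exp x ≤ 1 + x + (2 * L ^ 2 * (y ω) ^ 2 + 2 * L ^ 2 * (3600 * κ ^ 2 * ξ ^ 2)) := by
      linarith
    have h6 := mul_le_mul_of_nonneg_left h5 (hpr ω hω)
    refine h6.trans (le_of_eq ?_)
    rw [hx]; ring
  refine (Finset.sum_le_sum key).trans ?_
  simp only [Finset.sum_add_distrib, Finset.sum_sub_distrib, ← Finset.mul_sum, hsum]
  have a1 := mul_le_mul_of_nonneg_left hE hL
  have a2 := mul_le_mul_of_nonneg_left hE2 (show 0 ≤ 2 * L ^ 2 by positivity)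
  have a3 := mul_le_mul_of_nonneg_left hB (show 0 ≤ L * κ by positivity)
  nlinarith [a1, a2, a3]

section Stat
variable {X I Ω : Type*} [DecidableEq X]

/-- Weighted number of sets in a family contained in `A`. -/
noncomputable def famWeight (fam : Finset I) (S : I → Finset X) (v : I → ℝ) (A : Finset X) : ℝ :=
  ∑ k ∈ fam, if S k ⊆ A then v k else 0

theorem famWeight_nonneg {fam : Finset I} {S : I → Finset X} {v : I → ℝ} (A : Finset X)
    (hv : ∀ k ∈ fam, 0 ≤ v k) : 0 ≤ famWeight fam S v A := by
  refine Finset.sum_nonneg fun k hk => ?_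
  split_ifs
  · exact hv k hk
  · exact le_rfl

/-- The loss of weight when `K` is removed from `A`. -/
theorem famWeight_sub {fam : Finset I} {S : I → Finset X} {v : I → ℝ} (A K : Finset X) :
    famWeight fam S v A - famWeight fam S v (A \ K) =
      ∑ k ∈ fam, if S k ⊆ A then (if Disjoint (S k) K then 0 else v k) else 0 := by
  unfold famWeight
  rw [← Finset.sum_sub_distrib]
  refine Finset.sum_congr rfl fun k _ => ?_
  simp only [Finset.subset_sdiff]
  by_cases h1 : S k ⊆ A <;> by_cases h2 : Disjoint (S k) K <;> simp [h1, h2]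

theorem famWeight_sub_nonneg {fam : Finset I} {S : I → Finset X} {v : I → ℝ} (A K : Finset X)
    (hv : ∀ k ∈ fam, 0 ≤ v k) : 0 ≤ famWeight fam S v A - famWeight fam S v (A \ K) := by
  rw [famWeight_sub]
  refine Finset.sum_nonneg fun k hk => ?_
  split_ifs
  · exact le_rfl
  · exact hv k hk
  · exact le_rfl

theorem famWeight_sub_le {fam : Finset I} {S : I → Finset X} {v : I → ℝ} (A K : Finset X)
    (hv : ∀ k ∈ fam, 0 ≤ v k) {θ : ℝ}
    (hinf : ∀ y, ∑ k ∈ fam with y ∈ S k, v k ≤ θ) :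
    famWeight fam S v A - famWeight fam S v (A \ K) ≤ K.card * θ := by
  rw [famWeight_sub]
  calc _ ≤ ∑ k ∈ fam, ∑ y ∈ K, if y ∈ S k then v k else 0 := by
        refine Finset.sum_le_sum fun k hk => ?_
        have h0 : ∀ y ∈ K, (0 : ℝ) ≤ if y ∈ S k then v k else 0 := by
          intro y _
          split_ifs
          · exact hv k hk
          · exact le_rfl
        split_ifs with h1 h2
        · exact Finset.sum_nonneg h0
        · obtain ⟨y, hy, hyK⟩ := Finset.not_disjoint_iff.1 h2
          calc v k = if y ∈ S k then v k else 0 := by simp [hy]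
            _ ≤ _ := Finset.single_le_sum h0 hyK
        · exact Finset.sum_nonneg h0
    _ = ∑ y ∈ K, ∑ k ∈ fam with y ∈ S k, v k := by
        rw [Finset.sum_comm]
        simp only [Finset.sum_filter]
    _ ≤ ∑ y ∈ K, θ := Finset.sum_le_sum fun y _ => hinf y
    _ = K.card * θ := by simp

theorem sum_mul_famWeight_sub_le {fam : Finset I} {S : I → Finset X} {v : I → ℝ} (A : Finset X)
    (hv : ∀ k ∈ fam, 0 ≤ v k) (s : Finset Ω) (pr : Ω → ℝ) (K : Ω → Finset X) {κ : ℝ} {r : ℕ}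
    (hr : ∀ k ∈ fam, (S k).card = r)
    (hpr : ∀ ω ∈ s, 0 ≤ pr ω) (hκ : ∀ y ∈ A, ∑ ω ∈ s, (if y ∈ K ω then pr ω else 0) ≤ κ) :
    ∑ ω ∈ s, pr ω * (famWeight fam S v A - famWeight fam S v (A \ K ω)) ≤
      r * κ * famWeight fam S v A := by
  simp only [famWeight_sub, Finset.mul_sum]
  rw [Finset.sum_comm, famWeight, Finset.mul_sum]
  refine Finset.sum_le_sum fun k hk => ?_
  by_cases hA : S k ⊆ A
  · simp only [hA, if_true]
    calc _ ≤ ∑ ω ∈ s, ∑ y ∈ S k, (if y ∈ K ω then pr ω else 0) * v k := by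
          refine Finset.sum_le_sum fun ω hω => ?_
          have h0 : ∀ y ∈ S k, (0 : ℝ) ≤ (if y ∈ K ω then pr ω else 0) * v k := by
            intro y _
            refine mul_nonneg ?_ (hv k hk)
            split_ifs
            · exact hpr ω hω
            · exact le_rfl
          split_ifs with h2
          · simpa using Finset.sum_nonneg h0
          · obtain ⟨y, hy, hyK⟩ := Finset.not_disjoint_iff.1 h2
            calc pr ω * v k = (if y ∈ K ω then pr ω else 0) * v k := by simp [hyK]
              _ ≤ _ := Finset.single_le_sum h0 hy
      _ = ∑ y ∈ S k, (∑ ω ∈ s, (if y ∈ K ω then pr ω else 0)) * v k := by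
          rw [Finset.sum_comm]
          simp only [Finset.sum_mul]
      _ ≤ ∑ y ∈ S k, κ * v k := Finset.sum_le_sum fun y hy =>
          mul_le_mul_of_nonneg_right (hκ y (hA hy)) (hv k hk)
      _ = r * κ * v k := by rw [Finset.sum_const, hr k hk, nsmul_eq_mul]; ring
  · simp [hA]

theorem sum_sub_sum_le_ite (S K : Finset X) :
    (∑ y ∈ S, (if y ∈ K then (1 : ℝ) else 0)) -
      ∑ y ∈ S, ∑ z ∈ S.erase y, (if y ∈ K ∧ z ∈ K then (1 : ℝ) else 0) ≤
      if Disjoint S K then 0 else 1 := by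
  set m := (S.filter (· ∈ K)).card with hm
  have h1 : ∑ y ∈ S, (if y ∈ K then (1 : ℝ) else 0) = m := by
    rw [Finset.sum_ite]; simp [hm]
  have h2 : ∑ y ∈ S, ∑ z ∈ S.erase y, (if y ∈ K ∧ z ∈ K then (1 : ℝ) else 0) = m * (m - 1 : ℝ) := by
    have : ∀ y ∈ S, ∑ z ∈ S.erase y, (if y ∈ K ∧ z ∈ K then (1 : ℝ) else 0) =
        (if y ∈ K then (1 : ℝ) else 0) * (m - 1 : ℝ) := by
      intro y hy
      by_cases hyK : y ∈ K
      · have := Finset.sum_erase_eq_sub (f := fun z => if z ∈ K then (1 : ℝ) else 0) hy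
        simp only [hyK, true_and, if_true, one_mul]
        rw [this, h1]; simp [hyK]
      · simp [hyK]
    rw [Finset.sum_congr rfl this, ← Finset.sum_mul, h1]
  rw [h1, h2]
  by_cases hd : Disjoint S K
  · have : m = 0 := by
      rw [hm, Finset.card_eq_zero, Finset.filter_eq_empty_iff]
      exact fun y hy hyK => Finset.disjoint_left.1 hd hy hyK
    simp [hd, this]
  · simp only [hd, if_false]
    nlinarith [sq_nonneg ((m : ℝ) - 1)]

theorem le_sum_mul_famWeight_sub {fam : Finset I} {S : I → Finset X} {v : I → ℝ} (A : Finset X)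
    (hv : ∀ k ∈ fam, 0 ≤ v k) (s : Finset Ω) (pr : Ω → ℝ) (K : Ω → Finset X) {q b : ℝ} {r : ℕ}
    (hr : ∀ k ∈ fam, (S k).card = r)
    (hpr : ∀ ω ∈ s, 0 ≤ pr ω) (hq : ∀ y ∈ A, q ≤ ∑ ω ∈ s, (if y ∈ K ω then pr ω else 0))
    (hb : ∀ y ∈ A, ∀ z ∈ A, y ≠ z → ∑ ω ∈ s, (if y ∈ K ω ∧ z ∈ K ω then pr ω else 0) ≤ b) :
    r * (q - (r - 1) * b) * famWeight fam S v A ≤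
    ∑ ω ∈ s, pr ω * (famWeight fam S v A - famWeight fam S v (A \ K ω)) := by
  simp only [famWeight_sub, Finset.mul_sum]
  rw [Finset.sum_comm, famWeight, Finset.mul_sum]
  refine Finset.sum_le_sum fun k hk => ?_
  by_cases hA : S k ⊆ A
  · simp only [hA, if_true]
    have h1 : ∀ ω ∈ s, ((∑ y ∈ S k, (if y ∈ K ω then pr ω else 0)) -
        ∑ y ∈ S k, ∑ z ∈ (S k).erase y, (if y ∈ K ω ∧ z ∈ K ω then pr ω else 0)) * v k ≤
        pr ω * if Disjoint (S k) (K ω) then 0 else v k := by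
      intro ω hω
      have := mul_le_mul_of_nonneg_right (sum_sub_sum_le_ite (S k) (K ω))
        (mul_nonneg (hpr ω hω) (hv k hk))
      refine (le_of_eq ?_).trans (this.trans (le_of_eq ?_))
      · rw [sub_mul, sub_mul]
        simp only [Finset.sum_mul, ite_mul, one_mul, zero_mul]
      · split_ifs <;> ring
    refine le_trans ?_ (Finset.sum_le_sum h1)
    rw [← Finset.sum_mul]
    refine mul_le_mul_of_nonneg_right ?_ (hv k hk)
    rw [Finset.sum_sub_distrib, Finset.sum_comm]
    have h2 : (r : ℝ) * q ≤ ∑ y ∈ S k, ∑ ω ∈ s, (if y ∈ K ω then pr ω else 0) := by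
      calc (r : ℝ) * q = ∑ y ∈ S k, q := by rw [Finset.sum_const, hr k hk, nsmul_eq_mul]
        _ ≤ _ := Finset.sum_le_sum fun y hy => hq y (hA hy)
    have h3 : ∑ ω ∈ s, ∑ y ∈ S k, ∑ z ∈ (S k).erase y,
        (if y ∈ K ω ∧ z ∈ K ω then pr ω else 0) ≤ r * ((r - 1) * b) := by
      rw [Finset.sum_comm]
      calc _ ≤ ∑ y ∈ S k, ((r : ℝ) - 1) * b := by
            refine Finset.sum_le_sum fun y hy => ?_
            rw [Finset.sum_comm]
            calc _ ≤ ∑ z ∈ (S k).erase y, b := by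
                  refine Finset.sum_le_sum fun z hz => ?_
                  exact hb y (hA hy) z (hA (Finset.mem_of_mem_erase hz)) (Finset.ne_of_mem_erase hz).symm
              _ = ((r : ℝ) - 1) * b := by
                  rw [Finset.sum_const, Finset.card_erase_of_mem hy, hr k hk, nsmul_eq_mul]
                  have : 1 ≤ r := by rw [← hr k hk]; exact Finset.card_pos.2 ⟨y, hy⟩
                  push_cast [this]; ring
        _ = _ := by rw [Finset.sum_const, hr k hk, nsmul_eq_mul]
    linarith
  · simp [hA]

end Stat

section Step
variable {X I Ω : Type*} [DecidableEq X]

set_option maxHeartbeats 1000000 in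
theorem famWeight_exp_step {fam : Finset I} {S : I → Finset X} {v : I → ℝ} (A : Finset X)
    (hv : ∀ k ∈ fam, 0 ≤ v k) (s : Finset Ω) (pr : Ω → ℝ) (K : Ω → Finset X) {r : ℕ}
    {κ ξ θ g g' g₀ L : ℝ} (hr : ∀ k ∈ fam, (S k).card = r) (hr1 : 1 ≤ r) (hr3 : r ≤ 3)
    (hinf : ∀ y, ∑ k ∈ fam with y ∈ S k, v k ≤ θ)
    (hpr : ∀ ω ∈ s, 0 ≤ pr ω) (hsum : ∑ ω ∈ s, pr ω = 1) (hK : ∀ ω ∈ s, (K ω).card ≤ 4)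
    (hκ0 : 0 ≤ κ) (hκ6 : κ ≤ 1 / 6) (hL : 0 ≤ L) (hξ0 : 0 < ξ) (hξ1 : ξ ≤ 1 / 4) (hg₀ : 0 < g₀)
    (hg' : g' = g * (1 - r * κ)) (hgg' : g₀ ≤ g') (hF : famWeight fam S v A ≤ 2 * g)
    (hθ : 0 ≤ θ) (hκθ : κ ≤ θ / g₀) (hθξ : 6 * θ ≤ ξ * g₀) (hLθ : 100 * L * θ ≤ ξ * g₀)
    (hq : ∀ y ∈ A, ∑ ω ∈ s, (if y ∈ K ω then pr ω else 0) ≤ κ)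
    (hq' : ∀ y ∈ A, κ * (1 - 2 * ξ - θ / g₀) ≤ ∑ ω ∈ s, (if y ∈ K ω then pr ω else 0))
    (hb : ∀ y ∈ A, ∀ z ∈ A, y ≠ z →
      ∑ ω ∈ s, (if y ∈ K ω ∧ z ∈ K ω then pr ω else 0) ≤ κ * (θ / g₀)) :
    (∑ ω ∈ s, pr ω * Real.exp (L * (famWeight fam S v (A \ K ω) / g' - 1 - ξ * (1 + 60 * κ))) ≤
      Real.exp (L * (famWeight fam S v A / g - 1 - ξ))) ∧
    (∑ ω ∈ s, pr ω * Real.exp (L * (1 - ξ * (1 + 60 * κ) - famWeight fam S v (A \ K ω) / g')) ≤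
      Real.exp (L * (1 - ξ - famWeight fam S v A / g))) := by
  set F := famWeight fam S v A with hFdef
  set Δ : Ω → ℝ := fun ω => F - famWeight fam S v (A \ K ω) with hΔ
  have hF0 : 0 ≤ F := famWeight_nonneg A hv
  have hr1' : (1 : ℝ) ≤ r := by exact_mod_cast hr1
  have hr3' : (r : ℝ) ≤ 3 := by exact_mod_cast hr3
  have hΔ0 : ∀ ω, 0 ≤ Δ ω := fun ω => famWeight_sub_nonneg A (K ω) hv
  have hΔ4 : ∀ ω ∈ s, Δ ω ≤ 4 * θ := fun ω hω =>
    (famWeight_sub_le A (K ω) hv hinf).trans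
      (mul_le_mul_of_nonneg_right (by exact_mod_cast hK ω hω) hθ)
  have hEu : ∑ ω ∈ s, pr ω * Δ ω ≤ r * κ * F := sum_mul_famWeight_sub_le A hv s pr K hr hpr hq
  have hEl : r * (κ * (1 - 2 * ξ - θ / g₀) - (r - 1) * (κ * (θ / g₀))) * F ≤
      ∑ ω ∈ s, pr ω * Δ ω := le_sum_mul_famWeight_sub A hv s pr K hr hpr hq' hb
  have hg'0 : 0 < g' := hg₀.trans_le hgg'
  have hrκ : (r : ℝ) * κ ≤ 1 / 2 := by
    have := mul_le_mul hr3' hκ6 hκ0 (by norm_num)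
    linarith
  have hg0 : 0 < g := by
    rw [hg'] at hg'0
    exact (pos_iff_pos_of_mul_pos hg'0).2 (by linarith)
  have hgle : g ≤ 2 * g' := by
    have := mul_le_mul_of_nonneg_left hrκ hg0.le
    rw [hg']; linarith
  set f := F / g' with hf
  have hf0 : 0 ≤ f := by positivity
  have hf4 : f ≤ 4 := by rw [hf, div_le_iff₀ hg'0]; linarith
  set t := θ / g₀ with ht
  have ht0 : 0 ≤ t := by positivity
  have htξ : 6 * t ≤ ξ := by
    rw [ht, mul_div_assoc', div_le_iff₀ hg₀]; exact hθξ
  have htL : 100 * L * t ≤ ξ := by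
    rw [ht, mul_div_assoc', div_le_iff₀ hg₀]; exact hLθ
  set D : Ω → ℝ := fun ω => Δ ω / g' with hD
  have hD0 : ∀ ω, 0 ≤ D ω := fun ω => div_nonneg (hΔ0 ω) hg'0.le
  have hD4 : ∀ ω ∈ s, D ω ≤ 4 * t := by
    intro ω hω
    rw [hD, ht]
    calc Δ ω / g' ≤ (4 * θ) / g₀ := by
          apply div_le_div₀ (by positivity) (hΔ4 ω hω) hg₀ hgg'
      _ = _ := by ring
  have hEDu : ∑ ω ∈ s, pr ω * D ω ≤ r * κ * f := by
    simp only [hD, hf, mul_div_assoc', ← Finset.sum_div]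
    gcongr
  have hEDl : r * (κ * (1 - 2 * ξ - t) - (r - 1) * (κ * t)) * f ≤ ∑ ω ∈ s, pr ω * D ω := by
    simp only [hD, hf, mul_div_assoc', ← Finset.sum_div]
    gcongr
  set y : Ω → ℝ := fun ω => r * κ * f - D ω with hy
  have hrκf : r * κ * f ≤ 12 * κ := by
    have : (r : ℝ) * f ≤ 3 * 4 := mul_le_mul hr3' hf4 hf0 (by norm_num)
    have := mul_le_mul_of_nonneg_left this hκ0
    linarith
  have hrκf0 : 0 ≤ r * κ * f := by positivity
  have hyb : ∀ ω ∈ s, |y ω| ≤ 12 * t := by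
    intro ω hω
    rw [abs_le, hy]
    constructor <;> linarith [hD0 ω, hD4 ω hω]
  have hyE : ∑ ω ∈ s, pr ω * y ω = r * κ * f - ∑ ω ∈ s, pr ω * D ω := by
    simp only [hy, mul_sub, Finset.sum_sub_distrib]
    rw [← Finset.sum_mul, hsum, one_mul]
  have hyE1 : ∑ ω ∈ s, pr ω * y ω ≤ 30 * κ * ξ := by
    rw [hyE]
    have h1 : r * κ * f - r * (κ * (1 - 2 * ξ - t) - (r - 1) * (κ * t)) * f =
        (r * κ * f) * (2 * ξ + r * t) := by ring
    have h2 : (r * κ * f) * (2 * ξ + r * t) ≤ (12 * κ) * (2 * ξ + 3 * t) := by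
      apply mul_le_mul hrκf _ (by positivity) (by positivity)
      have := mul_le_mul_of_nonneg_right hr3' ht0
      linarith
    have h3 := mul_le_mul_of_nonneg_left htξ hκ0
    linarith
  have hyE2 : ∑ ω ∈ s, pr ω * (- y ω) ≤ 30 * κ * ξ := by
    have : ∑ ω ∈ s, pr ω * (- y ω) = - ∑ ω ∈ s, pr ω * y ω := by
      simp [Finset.sum_neg_distrib]
    rw [this, hyE]
    have : 0 ≤ 30 * κ * ξ := by positivity
    linarith
  have hysq : ∑ ω ∈ s, pr ω * (y ω) ^ 2 ≤ (192 * t) * κ := by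
    have h1 : ∀ ω ∈ s, pr ω * (y ω) ^ 2 ≤ pr ω * (r * κ * f) ^ 2 + 4 * t * (pr ω * D ω) := by
      intro ω hω
      have : (y ω) ^ 2 ≤ (r * κ * f) ^ 2 + 4 * t * D ω := by
        have a1 := mul_nonneg hrκf0 (hD0 ω)
        have a2 := mul_le_mul_of_nonneg_left (hD4 ω hω) (hD0 ω)
        have a3 : (y ω) ^ 2 = (r * κ * f) ^ 2 - 2 * (r * κ * f * D ω) + D ω * D ω := by
          simp only [hy]; ring
        linarith
      refine (mul_le_mul_of_nonneg_left this (hpr ω hω)).trans (le_of_eq ?_)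
      ring
    refine (Finset.sum_le_sum h1).trans ?_
    rw [Finset.sum_add_distrib, ← Finset.sum_mul, hsum, ← Finset.mul_sum]
    have h2 : (r * κ * f) ^ 2 ≤ 12 * κ * (12 * t) := by
      rw [pow_two]
      apply mul_le_mul hrκf _ hrκf0 (by positivity)
      linarith
    have h3 : 4 * t * ∑ ω ∈ s, pr ω * D ω ≤ 4 * t * (12 * κ) :=
      mul_le_mul_of_nonneg_left (hEDu.trans hrκf) (by positivity)
    linarith
  have hB : 2 * L * (192 * t + 3600 * κ * ξ ^ 2) ≤ 30 * ξ := by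
    have h1 : L * κ ≤ L * t := mul_le_mul_of_nonneg_left hκθ hL
    have h2 : L * κ * ξ ^ 2 ≤ L * t * (1 / 16) := by
      apply mul_le_mul h1 _ (by positivity) (by positivity)
      have := pow_le_pow_left₀ hξ0.le hξ1 2
      linarith
    linarith
  have hLκ : L * (60 * κ * ξ) ≤ 1 / 2 := by
    have h1 : L * κ ≤ L * t := mul_le_mul_of_nonneg_left hκθ hL
    have h2 : L * κ * ξ ≤ L * t * 1 := by
      apply mul_le_mul h1 _ (by positivity) (by positivity)
      linarith
    linarith
  have hLy : ∀ ω ∈ s, L * |y ω| ≤ 1 / 2 := by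
    intro ω hω
    have := mul_le_mul_of_nonneg_left (hyb ω hω) hL
    linarith
  have hfr : F / g = f * (1 - r * κ) := by
    rw [hf, hg']
    have : 1 - r * κ ≠ 0 := by linarith
    field_simp
  have hfs : ∀ ω, famWeight fam S v (A \ K ω) / g' = f - D ω := by
    intro ω
    simp only [hf, hD, hΔ]
    rw [← sub_div]; congr 1; ring
  have e1 : ∀ ω, famWeight fam S v (A \ K ω) / g' - 1 - ξ * (1 + 60 * κ) =
      (F / g - 1 - ξ) + (y ω - 60 * κ * ξ) := by
    intro ω; rw [hfs, hfr]; simp only [hy]; ring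
  have e2 : ∀ ω, 1 - ξ * (1 + 60 * κ) - famWeight fam S v (A \ K ω) / g' =
      (1 - ξ - F / g) + (- y ω - 60 * κ * ξ) := by
    intro ω; rw [hfs, hfr]; simp only [hy]; ring
  constructor
  · have := sum_mul_exp_le_one s pr y L κ ξ _ hpr hsum hL hκ0 hξ0.le hLy hLκ hyE1 hysq hB
    calc _ = Real.exp (L * (F / g - 1 - ξ)) *
          ∑ ω ∈ s, pr ω * Real.exp (L * (y ω - 60 * κ * ξ)) := by
          rw [Finset.mul_sum]
          refine Finset.sum_congr rfl fun ω _ => ?_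
          rw [e1, mul_add, Real.exp_add]; ring
      _ ≤ Real.exp (L * (F / g - 1 - ξ)) * 1 := by gcongr
      _ = _ := mul_one _
  · have := sum_mul_exp_le_one s pr (fun ω => - y ω) L κ ξ _ hpr hsum hL hκ0 hξ0.le
      (by simpa using hLy) hLκ hyE2 (by simpa using hysq) hB
    calc _ = Real.exp (L * (1 - ξ - F / g)) *
          ∑ ω ∈ s, pr ω * Real.exp (L * (- y ω - 60 * κ * ξ)) := by
          rw [Finset.mul_sum]
          refine Finset.sum_congr rfl fun ω _ => ?_
          rw [e2, mul_add, Real.exp_add]; ring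
      _ ≤ Real.exp (L * (1 - ξ - F / g)) * 1 := by gcongr
      _ = _ := mul_one _

end Step

section Distribution
variable {X H : Type*} [DecidableEq X] [DecidableEq H]

/-- A state of the random greedy matching process: `M` is the current matching, `A` is the set of
vertices still alive. -/
structure NibState (𝓗 : Finset H) (ends : H → Finset X) (soft : Finset X)
    (Inv : Finset H → Prop) (M : Finset H) (A : Finset X) : Prop where
  sub : M ⊆ 𝓗
  inv : Inv M
  disj : ∀ h ∈ M, ∀ h' ∈ M, h ≠ h' → Disjoint (ends h) (ends h')
  alive : ∀ h ∈ M, Disjoint (ends h) A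
  dead : ∀ x ∈ soft, x ∉ A → ∃ h ∈ M, x ∈ ends h

theorem nibble_distribution {𝓗 : Finset H} {ends : H → Finset X} {soft P : Finset X}
    {Inv : Finset H → Prop} {pv : H → X} {M : Finset H} {A : Finset X}
    (hst : NibState 𝓗 ends soft Inv M A)
    (hcard : ∀ h ∈ 𝓗, (ends h).card = 4) (hpv : ∀ h ∈ 𝓗, ends h ∩ P = {pv h})
    (hsP : Disjoint soft P) {κ Dh a b : ℝ} (hκ : κ * (A ∩ P).card = 1) (hDh : 0 < Dh)
    (hup : ∀ y ∈ A, ((𝓗.filter fun h => y ∈ ends h ∧ ends h ⊆ A).card : ℝ) ≤ Dh)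
    (hlo : ∀ y ∈ A, y ∉ P → Dh * a + 1 ≤ ((𝓗.filter fun h => y ∈ ends h ∧ ends h ⊆ A).card : ℝ))
    (ha : a ≤ 1)
    (hco : ∀ y z, y ≠ z → ((𝓗.filter fun h => y ∈ ends h ∧ z ∈ ends h).card : ℝ) ≤ Dh * b)
    (hInv : ∀ x ∈ soft, x ∈ A → ∀ h₁ ∈ 𝓗, ∀ h₂ ∈ 𝓗, x ∈ ends h₁ → x ∈ ends h₂ →
      ends h₁ ⊆ A → ends h₂ ⊆ A → ¬ Inv (insert h₁ M) → ¬ Inv (insert h₂ M) → h₁ = h₂) :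
    ∃ (s : Finset (X ⊕ H)) (pr : X ⊕ H → ℝ) (K : X ⊕ H → Finset X),
      (∀ ω ∈ s, 0 ≤ pr ω) ∧ (∑ ω ∈ s, pr ω = 1) ∧ (∀ ω ∈ s, (K ω).card ≤ 4) ∧
      (∀ y ∈ A, ∑ ω ∈ s, (if y ∈ K ω then pr ω else 0) ≤ κ) ∧
      (∀ y ∈ A, κ * a ≤ ∑ ω ∈ s, (if y ∈ K ω then pr ω else 0)) ∧
      (∀ y ∈ A, ∀ z ∈ A, y ≠ z →
        ∑ ω ∈ s, (if y ∈ K ω ∧ z ∈ K ω then pr ω else 0) ≤ κ * b) ∧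
      (∀ ω ∈ s, (((A \ K ω) ∩ P).card + 1 = (A ∩ P).card) ∧
        ∃ M', NibState 𝓗 ends soft Inv M' (A \ K ω)) := by
  classical
  have hκ0 : 0 < κ := by
    by_contra h
    nlinarith [Nat.cast_nonneg (α := ℝ) (A ∩ P).card]
  set avail := 𝓗.filter fun h => ends h ⊆ A with hav
  set d : X → ℝ := fun y => ((𝓗.filter fun h => y ∈ ends h ∧ ends h ⊆ A).card : ℝ) with hd
  set Kh : H → Finset X := fun h => if Inv (insert h M) then ends h else ends h \ soft with hKh
  have hKsub : ∀ h, Kh h ⊆ ends h := by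
    intro h; simp only [hKh]; split_ifs
    · exact subset_rfl
    · exact Finset.sdiff_subset
  have hdav : ∀ y, ∑ h ∈ avail, (if y ∈ ends h then (1 : ℝ) else 0) = d y := by
    intro y
    rw [← Finset.sum_filter, Finset.sum_const, nsmul_eq_mul, mul_one, hd, hav, Finset.filter_filter]
    simp only [and_comm]
  have hpvmem : ∀ h ∈ 𝓗, pv h ∈ ends h ∧ pv h ∈ P := by
    intro h hh
    have : pv h ∈ ends h ∩ P := by rw [hpv h hh]; simp
    simpa using this
  have hpvuniq : ∀ h ∈ 𝓗, ∀ y ∈ P, y ∈ ends h ↔ y = pv h := by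
    intro h hh y hy
    have : y ∈ ends h ∩ P ↔ y = pv h := by rw [hpv h hh]; simp
    simpa [hy] using this
  have hKP : ∀ h ∈ 𝓗, ∀ y ∈ P, (y ∈ Kh h ↔ y ∈ ends h) := by
    intro h hh y hy
    refine ⟨fun h' => hKsub h h', fun h' => ?_⟩
    simp only [hKh]; split_ifs
    · exact h'
    · exact Finset.mem_sdiff.2 ⟨h', fun hs => Finset.disjoint_left.1 hsP hs hy⟩
  have hsumd : ∑ p ∈ A ∩ P, d p = avail.card := by
    simp only [← hdav]
    rw [Finset.sum_comm, Finset.card_eq_sum_ones, Nat.cast_sum]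
    refine Finset.sum_congr rfl fun h hh => ?_
    have hh' := Finset.mem_filter.1 hh
    have hm := hpvmem h hh'.1
    rw [Finset.sum_eq_single (pv h)]
    · simp [hm.1]
    · intro y hy hne
      rw [if_neg]
      rw [hpvuniq h hh'.1 y (Finset.mem_inter.1 hy).2]; exact hne
    · intro hn
      exact absurd (Finset.mem_inter.2 ⟨hh'.2 hm.1, hm.2⟩) hn
  have hq : ∀ (Q : X ⊕ H → Prop) [DecidablePred Q], ∑ ω ∈ (A ∩ P).disjSum avail, (if Q ω then
      Sum.elim (fun p => κ * (1 - d p / Dh)) (fun _ => κ / Dh) ω else 0) =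
      (∑ p ∈ A ∩ P, if Q (Sum.inl p) then κ * (1 - d p / Dh) else 0) +
      κ / Dh * ∑ h ∈ avail, if Q (Sum.inr h) then 1 else 0 := by
    intro Q _
    rw [Finset.sum_disjSum, Finset.mul_sum]
    simp
  refine ⟨(A ∩ P).disjSum avail, Sum.elim (fun p => κ * (1 - d p / Dh)) (fun _ => κ / Dh),
    Sum.elim (fun p => {p}) Kh, ?_, ?_, ?_, ?_, ?_, ?_, ?_⟩
  · rintro (p | h) hω
    · have hp := Finset.mem_inter.1 (Finset.inl_mem_disjSum.1 hω)
      have : d p / Dh ≤ 1 := (div_le_one hDh).2 (hup p hp.1)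
      simp only [Sum.elim_inl]
      exact mul_nonneg hκ0.le (by linarith)
    · simp only [Sum.elim_inr]; positivity
  · have := hq (fun _ => True)
    simp only [if_true] at this
    rw [this]
    simp only [mul_sub, Finset.sum_sub_distrib, Finset.sum_const, nsmul_eq_mul, mul_one,
      ← Finset.mul_sum, ← Finset.sum_div]
    rw [hsumd]
    have : ((A ∩ P).card : ℝ) * κ = 1 := by linarith
    rw [this]; ring
  · rintro (p | h) hω
    · simp
    · have hh := Finset.mem_filter.1 (Finset.inr_mem_disjSum.1 hω)
      simp only [Sum.elim_inr]
      exact (Finset.card_le_card (hKsub h)).trans (hcard h hh.1).le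
  · intro y hy
    rw [hq (fun ω => y ∈ Sum.elim (fun p => {p}) Kh ω)]
    simp only [Sum.elim_inl, Sum.elim_inr, Finset.mem_singleton]
    have h1 : ∑ h ∈ avail, (if y ∈ Kh h then (1 : ℝ) else 0) ≤ d y := by
      rw [← hdav]
      refine Finset.sum_le_sum fun h _ => ?_
      by_cases h1 : y ∈ Kh h
      · simp [h1, hKsub h h1]
      · simp only [h1, if_false]; positivity
    have h2 : κ / Dh * ∑ h ∈ avail, (if y ∈ Kh h then (1 : ℝ) else 0) ≤ κ / Dh * d y := by gcongr
    by_cases hyP : y ∈ P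
    · rw [Finset.sum_ite_eq (A ∩ P) y, if_pos (Finset.mem_inter.2 ⟨hy, hyP⟩)]
      refine (add_le_add_right h2 _).trans (le_of_eq ?_)
      ring
    · rw [Finset.sum_ite_eq (A ∩ P) y, if_neg (by simp [hyP])]
      have : κ / Dh * d y ≤ κ := by
        rw [div_mul_eq_mul_div, div_le_iff₀ hDh]
        exact mul_le_mul_of_nonneg_left (hup y hy) hκ0.le
      refine (add_le_add_right h2 _).trans ?_
      linarith
  · intro y hy
    rw [hq (fun ω => y ∈ Sum.elim (fun p => {p}) Kh ω)]
    simp only [Sum.elim_inl, Sum.elim_inr, Finset.mem_singleton]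
    by_cases hyP : y ∈ P
    · rw [Finset.sum_ite_eq (A ∩ P) y, if_pos (Finset.mem_inter.2 ⟨hy, hyP⟩)]
      have h1 : ∑ h ∈ avail, (if y ∈ Kh h then (1 : ℝ) else 0) = d y := by
        rw [← hdav]
        refine Finset.sum_congr rfl fun h hh => ?_
        simp only [hKP h (Finset.mem_filter.1 hh).1 y hyP]
      refine le_trans ?_ (le_of_eq (congrArg (fun t => κ * (1 - d y / Dh) + κ / Dh * t) h1.symm))
      have : κ * (1 - d y / Dh) = κ - κ / Dh * d y := by ring
      have := mul_le_mul_of_nonneg_left ha hκ0.le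
      linarith
    · rw [Finset.sum_ite_eq (A ∩ P) y, if_neg (by simp [hyP])]
      have h1 : d y - 1 ≤ ∑ h ∈ avail, (if y ∈ Kh h then (1 : ℝ) else 0) := by
        have h3 : ∑ h ∈ avail, ((if y ∈ ends h then (1 : ℝ) else 0) -
            (if y ∈ Kh h then (1 : ℝ) else 0)) ≤ 1 := by
          have : ∀ h, ((if y ∈ ends h then (1 : ℝ) else 0) - (if y ∈ Kh h then (1 : ℝ) else 0)) =
              if (y ∈ ends h ∧ y ∉ Kh h) then 1 else 0 := by
            intro h
            by_cases h1 : y ∈ Kh h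
            · simp [h1, hKsub h h1]
            · simp [h1]
          simp only [this]
          rw [← Finset.sum_filter, Finset.sum_const, nsmul_eq_mul, mul_one]
          have : (avail.filter fun h => y ∈ ends h ∧ y ∉ Kh h).card ≤ 1 := by
            have hch : ∀ h, y ∈ ends h → y ∉ Kh h → y ∈ soft ∧ ¬ Inv (insert h M) := by
              intro h hm hn
              simp only [hKh] at hn
              split_ifs at hn with hi
              · exact absurd hm hn
              · refine ⟨?_, hi⟩
                by_contra hs
                exact hn (Finset.mem_sdiff.2 ⟨hm, hs⟩)
            rw [Finset.card_le_one]
            intro h₁ hh₁ h₂ hh₂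
            simp only [hav, Finset.mem_filter] at hh₁ hh₂
            obtain ⟨⟨a1, a2⟩, a3, a4⟩ := hh₁
            obtain ⟨⟨b1, b2⟩, b3, b4⟩ := hh₂
            obtain ⟨c1, c2⟩ := hch _ a3 a4
            obtain ⟨-, e2⟩ := hch _ b3 b4
            exact hInv y c1 hy _ a1 _ b1 a3 b3 a2 b2 c2 e2
          exact_mod_cast this
        rw [Finset.sum_sub_distrib, hdav] at h3
        linarith
      have h2 := hlo y hy hyP
      have h3 : Dh * a ≤ ∑ h ∈ avail, (if y ∈ Kh h then (1 : ℝ) else 0) := by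
        have : Dh * a + 1 ≤ d y := h2
        linarith
      rw [zero_add]
      calc κ * a = κ / Dh * (Dh * a) := by field_simp
        _ ≤ _ := mul_le_mul_of_nonneg_left h3 (by positivity)
  · intro y hy z hz hyz
    rw [hq (fun ω => y ∈ Sum.elim (fun p => {p}) Kh ω ∧ z ∈ Sum.elim (fun p => {p}) Kh ω)]
    simp only [Sum.elim_inl, Sum.elim_inr, Finset.mem_singleton]
    rw [Finset.sum_eq_zero]
    · have h1 : ∑ h ∈ avail, (if y ∈ Kh h ∧ z ∈ Kh h then (1 : ℝ) else 0) ≤ Dh * b := by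
        refine le_trans ?_ (hco y z hyz)
        rw [← Finset.sum_filter, Finset.sum_const, nsmul_eq_mul, mul_one]
        norm_cast
        refine Finset.card_le_card fun h hh => ?_
        simp only [hav, Finset.mem_filter] at hh ⊢
        exact ⟨hh.1.1, hKsub _ hh.2.1, hKsub _ hh.2.2⟩
      calc _ ≤ 0 + κ / Dh * (Dh * b) :=
            add_le_add_right (mul_le_mul_of_nonneg_left h1 (by positivity)) _
        _ = κ * b := by field_simp; ring
    · intro p _
      rw [if_neg]
      rintro ⟨rfl, rfl⟩
      exact hyz rfl
  · rintro (p | h) hω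
    · have hp := Finset.inl_mem_disjSum.1 hω
      simp only [Sum.elim_inl]
      refine ⟨?_, M, hst.sub, hst.inv, hst.disj, fun h hh =>
        (hst.alive h hh).mono_right Finset.sdiff_subset, fun x hx hxA => ?_⟩
      · rw [← Finset.erase_eq, Finset.erase_inter, Finset.card_erase_add_one hp]
      · by_cases hA : x ∈ A
        · have : x = p := by simpa [hA] using hxA
          subst this
          exact absurd (Finset.mem_inter.1 hp).2 (Finset.disjoint_left.1 hsP hx)
        · exact hst.dead x hx hA
    · have hh := Finset.mem_filter.1 (Finset.inr_mem_disjSum.1 hω)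
      obtain ⟨hh1, hh2⟩ := hh
      have hm := hpvmem h hh1
      simp only [Sum.elim_inr]
      refine ⟨?_, ?_⟩
      · have : (A \ Kh h) ∩ P = (A ∩ P).erase (pv h) := by
          ext y
          simp only [Finset.mem_inter, Finset.mem_sdiff, Finset.mem_erase]
          constructor
          · rintro ⟨⟨a1, a2⟩, a3⟩
            refine ⟨?_, a1, a3⟩
            rintro rfl
            exact a2 ((hKP h hh1 _ a3).2 hm.1)
          · rintro ⟨a1, a2, a3⟩
            refine ⟨⟨a2, fun hk => a1 ?_⟩, a3⟩
            exact (hpvuniq h hh1 y a3).1 (hKsub h hk)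
        rw [this, Finset.card_erase_add_one (Finset.mem_inter.2 ⟨hh2 hm.1, hm.2⟩)]
      · by_cases hi : Inv (insert h M)
        · have hK : Kh h = ends h := by simp [hKh, hi]
          rw [hK]
          refine ⟨insert h M, ?_, hi, ?_, ?_, ?_⟩
          · exact Finset.insert_subset hh1 hst.sub
          · have hdis : ∀ h' ∈ M, Disjoint (ends h') (ends h) := fun h' hh' =>
              (hst.alive h' hh').mono_right hh2
            intro h₁ m₁ h₂ m₂ hne
            rcases Finset.mem_insert.1 m₁ with e₁ | m₁ <;>
            rcases Finset.mem_insert.1 m₂ with e₂ | m₂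
            · exact absurd (e₁.trans e₂.symm) hne
            · rw [e₁]; exact (hdis _ m₂).symm
            · rw [e₂]; exact hdis _ m₁
            · exact hst.disj _ m₁ _ m₂ hne
          · intro h' m
            rcases Finset.mem_insert.1 m with rfl | m
            · exact Finset.disjoint_sdiff
            · exact (hst.alive _ m).mono_right Finset.sdiff_subset
          · intro x hx hxA
            by_cases hA : x ∈ A
            · refine ⟨h, Finset.mem_insert_self _ _, ?_⟩
              simpa [hA] using hxA
            · obtain ⟨h', a1, a2⟩ := hst.dead x hx hA
              exact ⟨h', Finset.mem_insert_of_mem a1, a2⟩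
        · have hK : Kh h = ends h \ soft := by simp [hKh, hi]
          rw [hK]
          refine ⟨M, hst.sub, hst.inv, hst.disj, fun h hh =>
            (hst.alive h hh).mono_right Finset.sdiff_subset, fun x hx hxA => ?_⟩
          refine hst.dead x hx fun hA => hxA ?_
          simp [hA, hx]

end Distribution

section Numerics

theorem prod_one_sub_inv (N s : ℕ) (hs : s < N) :
    ∏ k ∈ Finset.range s, (1 - 1 / ((N : ℝ) - k)) = ((N : ℝ) - s) / N := by
  induction s with
  | zero =>
    have : (N : ℝ) ≠ 0 := by exact_mod_cast hs.ne'
    simp [this]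
  | succ s ih =>
    rw [Finset.prod_range_succ, ih (by omega)]
    have h0 : ((s : ℝ) + 1) < N := by exact_mod_cast hs
    have h1 : (N : ℝ) - s ≠ 0 := by linarith
    have h2 : (N : ℝ) ≠ 0 := by
      have : (0 : ℝ) ≤ s := by positivity
      linarith
    push_cast
    field_simp
    ring

theorem pow_four_prod_le (κ : ℕ → ℝ) (s r : ℕ) (hr : r ≤ 3)
    (hκ : ∀ k < s, 0 ≤ κ k ∧ κ k ≤ 1 / 6) :
    (∏ k ∈ Finset.range s, (1 - κ k)) ^ 4 ≤ ∏ k ∈ Finset.range s, (1 - r * κ k) := by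
  rw [← Finset.prod_pow]
  refine Finset.prod_le_prod (fun k _ => by positivity) fun k hk => ?_
  obtain ⟨h0, h1⟩ := hκ k (Finset.mem_range.1 hk)
  have hr' : (r : ℝ) ≤ 3 := by exact_mod_cast hr
  have h2 : (r : ℝ) * κ k ≤ 3 * κ k := by gcongr
  have h3 : (1 - κ k) ^ 4 ≤ 1 - 3 * κ k := by
    have : (1 - 3 * κ k) - (1 - κ k) ^ 4 = κ k * ((1 - 6 * κ k) + κ k ^ 2 * (4 - κ k)) := by ring
    have : 0 ≤ κ k * ((1 - 6 * κ k) + κ k ^ 2 * (4 - κ k)) := by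
      apply mul_nonneg h0
      have : 0 ≤ κ k ^ 2 * (4 - κ k) := mul_nonneg (sq_nonneg _) (by linarith)
      linarith
    linarith
  linarith

theorem prod_mul_pow_le_one (κ : ℕ → ℝ) (s : ℕ) (hκ : ∀ k < s, 0 ≤ κ k ∧ κ k ≤ 1 / 6) :
    (∏ k ∈ Finset.range s, (1 + 60 * κ k)) * (∏ k ∈ Finset.range s, (1 - κ k)) ^ 60 ≤ 1 := by
  rw [← Finset.prod_pow, ← Finset.prod_mul_distrib]
  refine Finset.prod_le_one (fun k hk => ?_) fun k hk => ?_
  · obtain ⟨h0, h1⟩ := hκ k (Finset.mem_range.1 hk)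
    have : 0 ≤ 1 - κ k := by linarith
    positivity
  · obtain ⟨h0, h1⟩ := hκ k (Finset.mem_range.1 hk)
    have a1 : 1 + 60 * κ k ≤ Real.exp (60 * κ k) := by linarith [Real.add_one_le_exp (60 * κ k)]
    have a2 : (1 - κ k) ^ 60 ≤ Real.exp (- (60 * κ k)) := by
      calc (1 - κ k) ^ 60 ≤ Real.exp (- κ k) ^ 60 :=
            pow_le_pow_left₀ (by linarith) (Real.one_sub_le_exp_neg _) 60
        _ = _ := by rw [← Real.exp_nat_mul]; congr 1; push_cast; ring
    calc (1 + 60 * κ k) * (1 - κ k) ^ 60 ≤ Real.exp (60 * κ k) * Real.exp (- (60 * κ k)) := by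
          apply mul_le_mul a1 a2 _ (Real.exp_pos _).le
          have : 0 ≤ 1 - κ k := by linarith
          positivity
      _ = 1 := by rw [← Real.exp_add]; simp

end Numerics

section Nibble
variable {X H J : Type*} [DecidableEq X]

/-- Normalised number of edges at `x` whose other vertices are all in `A`. -/
noncomputable def aliveDeg (𝓗 : Finset H) (ends : H → Finset X) (D : ℝ) (x : X) (A : Finset X) : ℝ :=
  famWeight (𝓗.filter fun h => x ∈ ends h) (fun h => (ends h).erase x) (fun _ => 1 / D) A

theorem aliveDeg_eq (𝓗 : Finset H) (ends : H → Finset X) (D : ℝ) (x : X) (A : Finset X) :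
    aliveDeg 𝓗 ends D x A =
      ((𝓗.filter fun h => x ∈ ends h ∧ (ends h).erase x ⊆ A).card : ℝ) / D := by
  unfold aliveDeg famWeight
  rw [← Finset.sum_filter, Finset.filter_filter, Finset.sum_const, nsmul_eq_mul, mul_one_div]

theorem aliveDeg_eq_of_mem (𝓗 : Finset H) (ends : H → Finset X) (D : ℝ) {x : X} {A : Finset X}
    (hx : x ∈ A) :
    aliveDeg 𝓗 ends D x A =
      ((𝓗.filter fun h => x ∈ ends h ∧ ends h ⊆ A).card : ℝ) / D := by
  rw [aliveDeg_eq]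
  congr 2
  refine congrArg Finset.card (Finset.filter_congr fun h _ => and_congr_right fun hxh => ?_)
  rw [← Finset.subset_insert_iff, Finset.insert_eq_of_mem hx]

/-- The total potential. -/
noncomputable def nibPotential (𝓗 : Finset H) (ends : H → Finset X) (𝒳 P soft : Finset X)
    (Js : Finset J) (w : J → X → ℝ) (D L g₃ g₁ ξ : ℝ) (A : Finset X) : ℝ :=
  (∑ x ∈ 𝒳, Real.exp (L * (aliveDeg 𝓗 ends D x A / g₃ - 1 - ξ))) +
  (∑ x ∈ 𝒳 \ P, Real.exp (L * (1 - ξ - aliveDeg 𝓗 ends D x A / g₃))) +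
  ∑ j ∈ Js, Real.exp (L * (famWeight soft (fun x => {x}) (w j) A / g₁ - 1 - ξ))

theorem lt_of_sum_exp_lt_one {ι : Type*} {s : Finset ι} {f : ι → ℝ} {L : ℝ} (hL : 0 < L)
    (h : ∑ i ∈ s, Real.exp (L * f i) < 1) {i : ι} (hi : i ∈ s) : f i < 0 := by
  have h1 : Real.exp (L * f i) ≤ ∑ i ∈ s, Real.exp (L * f i) :=
    Finset.single_le_sum (f := fun i => Real.exp (L * f i)) (fun _ _ => (Real.exp_pos _).le) hi
  have h2 := Real.exp_lt_one_iff.1 (h1.trans_lt h)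
  by_contra hc
  push Not at hc
  nlinarith [mul_nonneg hL.le hc]

variable [DecidableEq H]

theorem nibble_step {𝓗 : Finset H} {ends : H → Finset X} {𝒳 soft P : Finset X}
    {Inv : Finset H → Prop} {pv : H → X} {M : Finset H} {A : Finset X}
    {Js : Finset J} {w : J → X → ℝ} {D θ L g₀ g₃ g₁ ξ κ : ℝ}
    (hst : NibState 𝓗 ends soft Inv M A) (hA : A ⊆ 𝒳)
    (hcard : ∀ h ∈ 𝓗, (ends h).card = 4) (hpv : ∀ h ∈ 𝓗, ends h ∩ P = {pv h})
    (hsP : Disjoint soft P) (hκ : κ * (A ∩ P).card = 1)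
    (hD : 0 < D) (hθD : 1 ≤ θ * D) (hθ : 0 < θ)
    (hco : ∀ y z, y ≠ z → ((𝓗.filter fun h => y ∈ ends h ∧ z ∈ ends h).card : ℝ) ≤ θ * D)
    (hInv : ∀ x ∈ soft, x ∈ A → ∀ h₁ ∈ 𝓗, ∀ h₂ ∈ 𝓗, x ∈ ends h₁ → x ∈ ends h₂ →
      ends h₁ ⊆ A → ends h₂ ⊆ A → ¬ Inv (insert h₁ M) → ¬ Inv (insert h₂ M) → h₁ = h₂)
    (hw : ∀ j ∈ Js, ∀ x, 0 ≤ w j x ∧ w j x ≤ θ)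
    (hκ6 : κ ≤ 1 / 6) (hL : 0 < L) (hξ0 : 0 < ξ) (hξ1 : ξ ≤ 1 / 4) (hg₀ : 0 < g₀)
    (hg₃ : g₀ ≤ g₃ * (1 - 3 * κ)) (hg₁ : g₀ ≤ g₁ * (1 - κ))
    (hκθ : κ ≤ θ / g₀) (hθξ : 6 * θ ≤ ξ * g₀) (hLθ : 100 * L * θ ≤ ξ * g₀)
    (hΦ : nibPotential 𝓗 ends 𝒳 P soft Js w D L g₃ g₁ ξ A < 1) :
    ∃ M' A', NibState 𝓗 ends soft Inv M' A' ∧ A' ⊆ A ∧ (A' ∩ P).card + 1 = (A ∩ P).card ∧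
      nibPotential 𝓗 ends 𝒳 P soft Js w D L (g₃ * (1 - 3 * κ)) (g₁ * (1 - κ))
        (ξ * (1 + 60 * κ)) A' < 1 := by
  classical
  have hκ0 : 0 < κ := by
    by_contra h
    nlinarith [Nat.cast_nonneg (α := ℝ) (A ∩ P).card]
  have hg₃0 : 0 < g₃ := by
    by_contra h
    nlinarith
  have hg₁0 : 0 < g₁ := by
    by_contra h
    nlinarith
  have hg₃' : g₀ ≤ g₃ := by nlinarith
  unfold nibPotential at hΦ
  have p1 : 0 ≤ ∑ x ∈ 𝒳, Real.exp (L * (aliveDeg 𝓗 ends D x A / g₃ - 1 - ξ)) :=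
    Finset.sum_nonneg fun _ _ => (Real.exp_pos _).le
  have p2 : 0 ≤ ∑ x ∈ 𝒳 \ P, Real.exp (L * (1 - ξ - aliveDeg 𝓗 ends D x A / g₃)) :=
    Finset.sum_nonneg fun _ _ => (Real.exp_pos _).le
  have p3 : 0 ≤ ∑ j ∈ Js, Real.exp (L * (famWeight soft (fun x => {x}) (w j) A / g₁ - 1 - ξ)) :=
    Finset.sum_nonneg fun _ _ => (Real.exp_pos _).le
  have u1 : ∀ x ∈ 𝒳, aliveDeg 𝓗 ends D x A ≤ g₃ * (1 + ξ) := fun x hx => by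
    have := lt_of_sum_exp_lt_one hL (by linarith) hx
    have : aliveDeg 𝓗 ends D x A / g₃ ≤ 1 + ξ := by linarith
    rw [div_le_iff₀ hg₃0] at this; linarith
  have u2 : ∀ x ∈ 𝒳 \ P, g₃ * (1 - ξ) ≤ aliveDeg 𝓗 ends D x A := fun x hx => by
    have := lt_of_sum_exp_lt_one hL (by linarith) hx
    have : 1 - ξ ≤ aliveDeg 𝓗 ends D x A / g₃ := by linarith
    rw [le_div_iff₀ hg₃0] at this; linarith
  have u3 : ∀ j ∈ Js, famWeight soft (fun x => {x}) (w j) A ≤ 2 * g₁ := fun j hj => by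
    have := lt_of_sum_exp_lt_one hL (by linarith) hj
    have : famWeight soft (fun x => {x}) (w j) A / g₁ ≤ 2 := by linarith
    rwa [div_le_iff₀ hg₁0] at this
  have hcoD : θ * D ≤ D * g₃ * (1 + ξ) * (θ / g₀) := by
    rw [mul_div_assoc', le_div_iff₀ hg₀]
    have : g₀ ≤ g₃ * (1 + ξ) := by nlinarith
    calc θ * D * g₀ ≤ θ * D * (g₃ * (1 + ξ)) := by gcongr
      _ = _ := by ring
  obtain ⟨s, pr, K, d1, d2, d3, d4, d5, d6, d7⟩ := nibble_distribution (κ := κ)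
    (Dh := D * g₃ * (1 + ξ)) (a := 1 - 2 * ξ - θ / g₀) (b := θ / g₀) hst hcard hpv hsP hκ
    (by positivity)
    (fun y hy => by
      have := u1 y (hA hy)
      rw [aliveDeg_eq_of_mem _ _ _ hy, div_le_iff₀ hD] at this
      linarith)
    (fun y hy hyP => by
      have := u2 y (Finset.mem_sdiff.2 ⟨hA hy, hyP⟩)
      rw [aliveDeg_eq_of_mem _ _ _ hy, le_div_iff₀ hD] at this
      refine le_trans ?_ this
      have e1 : D * g₃ * (1 + ξ) * (1 - 2 * ξ - θ / g₀) =
        g₃ * (1 - ξ) * D - 2 * ξ ^ 2 * (D * g₃) - D * g₃ * (1 + ξ) * (θ / g₀) := by ring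
      have e2 : 0 ≤ 2 * ξ ^ 2 * (D * g₃) := by positivity
      linarith)
    (by
      have : 0 ≤ θ / g₀ := by positivity
      linarith)
    (fun y z hyz => (hco y z hyz).trans hcoD) hInv
  have influence : ∀ x, ∀ y, ∑ k ∈ 𝓗.filter (fun h => x ∈ ends h) with y ∈ (ends k).erase x,
      (fun _ => 1 / D) k ≤ θ := by
    intro x y
    rw [Finset.filter_filter, Finset.sum_const, nsmul_eq_mul, mul_one_div, div_le_iff₀ hD]
    by_cases hxy : x = y
    · subst hxy
      simp only [Finset.mem_erase, ne_eq, not_true_eq_false, false_and, and_false,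
        Finset.filter_false, Finset.card_empty, Nat.cast_zero]
      positivity
    · refine le_trans ?_ (hco x y hxy)
      norm_cast
      refine Finset.card_le_card fun h hh => ?_
      simp only [Finset.mem_filter, Finset.mem_erase] at hh ⊢
      exact ⟨hh.1, hh.2.1, hh.2.2.2⟩
  have deg := fun (x : X) (hx : x ∈ 𝒳) => famWeight_exp_step (g₀ := g₀) (g := g₃)
    (g' := g₃ * (1 - 3 * κ)) (θ := θ) (L := L) (ξ := ξ) (r := 3)
    (fam := 𝓗.filter fun h => x ∈ ends h) (S := fun h => (ends h).erase x) (v := fun _ => 1 / D)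
    A (fun _ _ => by positivity) s pr K
    (fun h hh => by
      have := Finset.mem_filter.1 hh
      rw [Finset.card_erase_of_mem this.2, hcard h this.1])
    (by norm_num) (by norm_num) (influence x) d1 d2 d3 hκ0.le hκ6 hL.le hξ0 hξ1 hg₀
    (by push_cast; ring) hg₃ (by
      have := u1 x hx
      unfold aliveDeg at this
      refine this.trans ?_
      nlinarith) hθ.le hκθ hθξ hLθ d4 d5 d6
  have wt := fun (j : J) (hj : j ∈ Js) => famWeight_exp_step (g₀ := g₀) (g := g₁)
    (g' := g₁ * (1 - κ)) (θ := θ) (L := L) (ξ := ξ) (r := 1)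
    (fam := soft) (S := fun x => {x}) (v := w j)
    A (fun x _ => (hw j hj x).1) s pr K (fun _ _ => by simp)
    (by norm_num) (by norm_num) (fun y => by
      by_cases hy : y ∈ soft
      · have : (soft.filter fun k => y ∈ ({k} : Finset X)) = {y} := by
          ext z; simp only [Finset.mem_filter, Finset.mem_singleton]
          constructor
          · rintro ⟨_, rfl⟩; rfl
          · rintro rfl; exact ⟨hy, rfl⟩
        rw [this, Finset.sum_singleton]
        exact (hw j hj y).2
      · rw [Finset.sum_eq_zero]
        · exact hθ.le
        · intro z hz
          simp only [Finset.mem_filter, Finset.mem_singleton] at hz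
          obtain ⟨h1, rfl⟩ := hz
          exact absurd h1 hy) d1 d2 d3 hκ0.le hκ6 hL.le hξ0 hξ1 hg₀
    (by push_cast; ring) hg₁ (u3 j hj) hθ.le hκθ hθξ hLθ d4 d5 d6
  have total : ∑ ω ∈ s, pr ω * nibPotential 𝓗 ends 𝒳 P soft Js w D L (g₃ * (1 - 3 * κ))
      (g₁ * (1 - κ)) (ξ * (1 + 60 * κ)) (A \ K ω) < 1 := by
    refine lt_of_le_of_lt ?_ hΦ
    unfold nibPotential
    simp only [mul_add (pr _), Finset.sum_add_distrib, Finset.mul_sum]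
    refine add_le_add (add_le_add ?_ ?_) ?_
    · rw [Finset.sum_comm]
      exact Finset.sum_le_sum fun x hx => (deg x hx).1
    · rw [Finset.sum_comm]
      exact Finset.sum_le_sum fun x hx => 
        (deg x (Finset.mem_sdiff.1 hx).1).2
    · rw [Finset.sum_comm]
      exact Finset.sum_le_sum fun j hj => (wt j hj).1
  obtain ⟨ω, hω, hlt⟩ : ∃ ω ∈ s, nibPotential 𝓗 ends 𝒳 P soft Js w D L (g₃ * (1 - 3 * κ))
      (g₁ * (1 - κ)) (ξ * (1 + 60 * κ)) (A \ K ω) < 1 := by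
    by_contra hc
    push Not at hc
    have : ∑ ω ∈ s, pr ω ≤ ∑ ω ∈ s, pr ω * nibPotential 𝓗 ends 𝒳 P soft Js w D L (g₃ * (1 - 3 * κ))
      (g₁ * (1 - κ)) (ξ * (1 + 60 * κ)) (A \ K ω) :=
      Finset.sum_le_sum fun ω hω => le_mul_of_one_le_right (d1 ω hω) (hc ω hω)
    linarith
  obtain ⟨c1, M', c2⟩ := d7 ω hω
  exact ⟨M', A \ K ω, c2, Finset.sdiff_subset, c1, hlt⟩

end Nibble

section NibbleMain
variable {X H J : Type*} [DecidableEq X] [DecidableEq H]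

theorem exists_nibble {𝓗 : Finset H} {ends : H → Finset X} {𝒳 soft P : Finset X}
    {Inv : Finset H → Prop} {pv : H → X} {Js : Finset J} {w : J → X → ℝ} {D θ L ξ₀ δ : ℝ}
    (hends : ∀ h ∈ 𝓗, ends h ⊆ 𝒳) (hcard : ∀ h ∈ 𝓗, (ends h).card = 4)
    (hpv : ∀ h ∈ 𝓗, ends h ∩ P = {pv h}) (hP : P ⊆ 𝒳) (hsoft : soft ⊆ 𝒳) (hsP : Disjoint soft P)
    (hD : 0 < D) (hθD : 1 ≤ θ * D) (hθ : 0 < θ) (hθN : 1 ≤ θ * P.card)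
    (hup : ∀ x ∈ 𝒳, ((𝓗.filter fun h => x ∈ ends h).card : ℝ) ≤ (1 + ξ₀ / 2) * D)
    (hlo : ∀ x ∈ 𝒳, x ∉ P → (1 - ξ₀ / 2) * D ≤ ((𝓗.filter fun h => x ∈ ends h).card : ℝ))
    (hco : ∀ y z, y ≠ z → ((𝓗.filter fun h => y ∈ ends h ∧ z ∈ ends h).card : ℝ) ≤ θ * D)
    (hInv0 : Inv ∅)
    (hInv : ∀ M ⊆ 𝓗, Inv M → (∀ h ∈ M, ∀ h' ∈ M, h ≠ h' → Disjoint (ends h) (ends h')) →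
      ∀ x ∈ soft, ∀ h₁ ∈ 𝓗, ∀ h₂ ∈ 𝓗, x ∈ ends h₁ → x ∈ ends h₂ →
      (∀ h ∈ M, Disjoint (ends h) (ends h₁)) → (∀ h ∈ M, Disjoint (ends h) (ends h₂)) →
      ¬ Inv (insert h₁ M) → ¬ Inv (insert h₂ M) → h₁ = h₂)
    (hw : ∀ j ∈ Js, ∀ x, 0 ≤ w j x ∧ w j x ≤ θ) (hwsum : ∀ j ∈ Js, ∑ x ∈ soft, w j x ≤ 1)
    (hδ0 : 0 < δ) (hδ1 : δ ≤ 1 / 2) (hξ0 : 0 < ξ₀) (hξδ : 4 * ξ₀ ≤ δ ^ 60)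
    (hθξ : 6 * θ ≤ ξ₀ * δ ^ 4) (hL : 0 < L) (hLθ : 100 * L * θ ≤ ξ₀ * δ ^ 4)
    (hexp : (2 * 𝒳.card + Js.card) * Real.exp (- (L * (ξ₀ / 2))) < 1) :
    ∃ M ⊆ 𝓗, Inv M ∧ (∀ h ∈ M, ∀ h' ∈ M, h ≠ h' → Disjoint (ends h) (ends h')) ∧
      ∀ j ∈ Js, ∑ x ∈ soft with ∀ h ∈ M, x ∉ ends h, w j x ≤ 4 * δ := by
  classical
  set N := P.card with hN
  set κ : ℕ → ℝ := fun k => 1 / ((N : ℝ) - k) with hκ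
  set g : ℕ → ℕ → ℝ := fun r s => ∏ k ∈ Finset.range s, (1 - r * κ k) with hg
  set xi : ℕ → ℝ := fun s => ξ₀ * ∏ k ∈ Finset.range s, (1 + 60 * κ k) with hxi
  have hξ1 : ξ₀ ≤ 1 / 4 := by
    have : δ ^ 60 ≤ 1 := pow_le_one₀ hδ0.le (by linarith)
    linarith
  have hδ4 : δ ^ 4 ≤ 1 / 2 * δ := by
    have : δ ^ 3 ≤ 1 * (1 / 2) := by
      calc δ ^ 3 = δ ^ 2 * δ := by ring
        _ ≤ 1 * (1 / 2) := mul_le_mul (pow_le_one₀ hδ0.le (by linarith)) hδ1 hδ0.le (by norm_num)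
    calc δ ^ 4 = δ ^ 3 * δ := by ring
      _ ≤ _ := by gcongr; linarith
  have hθδ : θ ≤ δ / 40 := by
    have : ξ₀ * δ ^ 4 ≤ 1 / 4 * (1 / 2 * δ) := by gcongr
    linarith
  have hδN : 1 ≤ δ * N := by
    refine hθN.trans ?_
    gcongr
    linarith
  have hN0 : (0 : ℝ) < N := by
    by_contra h
    nlinarith
  have hκb : ∀ k : ℕ, δ * N ≤ (N : ℝ) - k → 0 < κ k ∧ κ k ≤ 1 / 6 ∧ κ k ≤ θ / δ ^ 4 := by
    intro k hk
    have h1 : 0 < (N : ℝ) - k := by linarith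
    have h2 : κ k ≤ θ / δ := by
      rw [hκ, div_le_div_iff₀ h1 hδ0]
      have : θ * (δ * N) ≤ θ * ((N : ℝ) - k) := by gcongr
      nlinarith
    refine ⟨by positivity, h2.trans ?_, h2.trans ?_⟩
    · rw [div_le_iff₀ hδ0]; linarith
    · gcongr
      linarith
  have hmono : ∀ s : ℕ, δ * N ≤ (N : ℝ) - s → ∀ k < s, δ * N ≤ (N : ℝ) - k := by
    intro s hs k hk
    have : (k : ℝ) ≤ s := by exact_mod_cast hk.le
    linarith
  have hκ' : ∀ s : ℕ, δ * N ≤ (N : ℝ) - s → ∀ k < s, 0 ≤ κ k ∧ κ k ≤ 1 / 6 := fun s hs k hk =>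
    have := hκb k (hmono s hs k hk)
    ⟨this.1.le, this.2.1⟩
  have hτ : ∀ s : ℕ, δ * N ≤ (N : ℝ) - s →
      ∏ k ∈ Finset.range s, (1 - κ k) = ((N : ℝ) - s) / N := by
    intro s hs
    refine prod_one_sub_inv N s ?_
    have : (s : ℝ) < N := by linarith
    exact_mod_cast this
  have hτδ : ∀ s : ℕ, δ * N ≤ (N : ℝ) - s → δ ≤ ((N : ℝ) - s) / N := by
    intro s hs
    rwa [le_div_iff₀ hN0]
  have hgδ : ∀ r ≤ 3, ∀ s : ℕ, δ * N ≤ (N : ℝ) - s → δ ^ 4 ≤ g r s := by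
    intro r hr s hs
    refine le_trans ?_ (pow_four_prod_le κ s r hr (hκ' s hs))
    rw [hτ s hs]
    exact pow_le_pow_left₀ hδ0.le (hτδ s hs) 4
  have hxi0 : ∀ s : ℕ, δ * N ≤ (N : ℝ) - s → ξ₀ ≤ xi s := by
    intro s hs
    refine le_mul_of_one_le_right hξ0.le ?_
    have : ∏ k ∈ Finset.range s, (1 : ℝ) ≤ ∏ k ∈ Finset.range s, (1 + 60 * κ k) := by
      refine Finset.prod_le_prod (fun _ _ => zero_le_one) fun k hk => ?_
      have := (hκ' s hs k (Finset.mem_range.1 hk)).1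
      linarith
    simpa using this
  have hxi1 : ∀ s : ℕ, δ * N ≤ (N : ℝ) - s → xi s ≤ 1 / 4 := by
    intro s hs
    have h1 := prod_mul_pow_le_one κ s (hκ' s hs)
    rw [hτ s hs] at h1
    have h2 : δ ^ 60 ≤ (((N : ℝ) - s) / N) ^ 60 := pow_le_pow_left₀ hδ0.le (hτδ s hs) 60
    set p := ∏ k ∈ Finset.range s, (1 + 60 * κ k) with hp
    have hp0 : 0 ≤ p := Finset.prod_nonneg fun k hk => by
      have := (hκ' s hs k (Finset.mem_range.1 hk)).1
      positivity
    have h3 : p * δ ^ 60 ≤ 1 := (mul_le_mul_of_nonneg_left h2 hp0).trans h1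
    have h4 : xi s = ξ₀ * p := rfl
    have h5 : p * (4 * ξ₀) ≤ p * δ ^ 60 := by gcongr
    rw [h4]; linarith
  have main : ∀ s : ℕ, δ * N ≤ (N : ℝ) - s → ∃ M A, NibState 𝓗 ends soft Inv M A ∧ A ⊆ 𝒳 ∧
      (A ∩ P).card + s = N ∧
      nibPotential 𝓗 ends 𝒳 P soft Js w D L (g 3 s) (g 1 s) (xi s) A < 1 := by
    intro s
    induction s with
    | zero =>
      intro _
      refine ⟨∅, 𝒳, ⟨by simp, hInv0, by simp, by simp, fun x hx hxA =>
        absurd (hsoft hx) hxA⟩, subset_rfl, by simp [Finset.inter_eq_right.2 hP, hN], ?_⟩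
      have e3 : g 3 0 = 1 := by simp [hg]
      have e1 : g 1 0 = 1 := by simp [hg]
      have ex : xi 0 = ξ₀ := by simp [hxi]
      have hdeg : ∀ x, aliveDeg 𝓗 ends D x 𝒳 = ((𝓗.filter fun h => x ∈ ends h).card : ℝ) / D := by
        intro x
        rw [aliveDeg_eq]
        congr 2
        refine congrArg Finset.card (Finset.filter_congr fun h hh => ?_)
        exact and_iff_left ((Finset.erase_subset _ _).trans (hends h hh))
      set E := Real.exp (- (L * (ξ₀ / 2))) with hE
      have hexple : ∀ a : ℝ, a ≤ - (ξ₀ / 2) → Real.exp (L * a) ≤ E := by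
        intro a ha
        rw [hE, Real.exp_le_exp, ← mul_neg]
        gcongr
      unfold nibPotential
      rw [e3, e1, ex]
      have s1 : ∑ x ∈ 𝒳, Real.exp (L * (aliveDeg 𝓗 ends D x 𝒳 / 1 - 1 - ξ₀)) ≤ 𝒳.card * E := by
        rw [← nsmul_eq_mul]
        refine Finset.sum_le_card_nsmul _ _ _ fun x hx => hexple _ ?_
        have : aliveDeg 𝓗 ends D x 𝒳 ≤ 1 + ξ₀ / 2 := by
          rw [hdeg, div_le_iff₀ hD]; exact hup x hx
        rw [div_one]; linarith
      have s2 : ∑ x ∈ 𝒳 \ P, Real.exp (L * (1 - ξ₀ - aliveDeg 𝓗 ends D x 𝒳 / 1)) ≤ 𝒳.card * E := by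
        calc _ ≤ ((𝒳 \ P).card : ℝ) * E := by
              rw [← nsmul_eq_mul]
              refine Finset.sum_le_card_nsmul _ _ _ fun x hx => hexple _ ?_
              have : 1 - ξ₀ / 2 ≤ aliveDeg 𝓗 ends D x 𝒳 := by
                rw [hdeg, le_div_iff₀ hD]
                exact hlo x (Finset.mem_sdiff.1 hx).1 (Finset.mem_sdiff.1 hx).2
              rw [div_one]; linarith
          _ ≤ _ := by
              have := Finset.card_le_card (Finset.sdiff_subset : 𝒳 \ P ⊆ 𝒳)
              gcongr
      have s3 : ∑ j ∈ Js, Real.exp (L * (famWeight soft (fun x => {x}) (w j) 𝒳 / 1 - 1 - ξ₀)) ≤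
          Js.card * E := by
        rw [← nsmul_eq_mul]
        refine Finset.sum_le_card_nsmul _ _ _ fun j hj => hexple _ ?_
        have : famWeight soft (fun x => {x}) (w j) 𝒳 ≤ 1 := by
          refine le_trans (le_of_eq ?_) (hwsum j hj)
          refine Finset.sum_congr rfl fun x hx => ?_
          rw [if_pos]
          simpa using hsoft hx
        rw [div_one]; linarith
      linarith
    | succ s ih =>
      intro hs
      have hs' : δ * N ≤ (N : ℝ) - s := hmono (s + 1) hs s (by omega)
      obtain ⟨M, A, hst, hA, hAP, hΦ⟩ := ih hs'
      obtain ⟨k0, k1, k2⟩ := hκb s hs'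
      have g3 : g 3 (s + 1) = g 3 s * (1 - 3 * κ s) := by
        simp [hg, Finset.prod_range_succ]
      have g1 : g 1 (s + 1) = g 1 s * (1 - κ s) := by
        simp [hg, Finset.prod_range_succ]
      have x1 : xi (s + 1) = xi s * (1 + 60 * κ s) := by
        simp [hxi, Finset.prod_range_succ, mul_assoc]
      have hc : κ s * (A ∩ P).card = 1 := by
        have : ((A ∩ P).card : ℝ) = N - s := by
          rw [← hAP]; push_cast; ring
        rw [this, hκ]
        have : (N : ℝ) - s ≠ 0 := by linarith
        field_simp
      have hle : ξ₀ * δ ^ 4 ≤ xi s * δ ^ 4 := by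
        have := hxi0 s hs'
        gcongr
      obtain ⟨M', A', c1, c2, c3, c4⟩ := nibble_step (κ := κ s) (g₀ := δ ^ 4) hst hA hcard hpv hsP hc
        hD hθD hθ hco
        (fun x hx hxA h₁ m₁ h₂ m₂ x₁ x₂ s₁ s₂ i₁ i₂ =>
          hInv M hst.sub hst.inv hst.disj x hx h₁ m₁ h₂ m₂ x₁ x₂
            (fun h hh => (hst.alive h hh).mono_right s₁)
            (fun h hh => (hst.alive h hh).mono_right s₂) i₁ i₂)
        hw k1 hL (hξ0.trans_le (hxi0 s hs')) (hxi1 s hs') (by positivity)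
        (by rw [← g3]; exact hgδ 3 le_rfl (s + 1) hs)
        (by rw [← g1]; exact hgδ 1 (by norm_num) (s + 1) hs)
        k2 (hθξ.trans hle) (hLθ.trans hle) hΦ
      refine ⟨M', A', c1, c2.trans hA, by omega, ?_⟩
      rw [g3, g1, x1]; exact c4
  have hceil : ⌈δ * N⌉₊ ≤ N := by
    rw [Nat.ceil_le]
    nlinarith
  have hcast : ((N - ⌈δ * N⌉₊ : ℕ) : ℝ) = N - (⌈δ * N⌉₊ : ℝ) := Nat.cast_sub hceil
  have hs : δ * N ≤ (N : ℝ) - ((N - ⌈δ * N⌉₊ : ℕ) : ℝ) := by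
    rw [hcast]
    linarith [Nat.le_ceil (δ * N)]
  obtain ⟨M, A, hst, -, -, hΦ⟩ := main _ hs
  refine ⟨M, hst.sub, hst.inv, hst.disj, fun j hj => ?_⟩
  unfold nibPotential at hΦ
  have p1 : 0 ≤ ∑ x ∈ 𝒳, Real.exp (L * (aliveDeg 𝓗 ends D x A / g 3 (N - ⌈δ * N⌉₊) - 1 -
      xi (N - ⌈δ * N⌉₊))) := Finset.sum_nonneg fun _ _ => (Real.exp_pos _).le
  have p2 : 0 ≤ ∑ x ∈ 𝒳 \ P, Real.exp (L * (1 - xi (N - ⌈δ * N⌉₊) - aliveDeg 𝓗 ends D x A /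
      g 3 (N - ⌈δ * N⌉₊))) := Finset.sum_nonneg fun _ _ => (Real.exp_pos _).le
  have h1 := lt_of_sum_exp_lt_one hL (by linarith) hj
  have h2 : g 1 (N - ⌈δ * N⌉₊) ≤ 2 * δ := by
    have : g 1 (N - ⌈δ * N⌉₊) = ((N : ℝ) - ((N - ⌈δ * N⌉₊ : ℕ) : ℝ)) / N := by
      rw [← hτ _ hs]; simp [hg]
    rw [this, hcast, div_le_iff₀ hN0]
    linarith [Nat.ceil_lt_add_one (show 0 ≤ δ * N by positivity)]
  have h0 : 0 < g 1 (N - ⌈δ * N⌉₊) := lt_of_lt_of_le (by positivity) (hgδ 1 (by norm_num) _ hs)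
  have h3 : famWeight soft (fun x => {x}) (w j) A ≤ 4 * δ := by
    have : famWeight soft (fun x => {x}) (w j) A / g 1 (N - ⌈δ * N⌉₊) ≤ 2 := by
      linarith [hxi1 _ hs]
    rw [div_le_iff₀ h0] at this
    linarith
  refine le_trans ?_ h3
  unfold famWeight
  rw [Finset.sum_filter]
  refine Finset.sum_le_sum fun x hx => ?_
  have hwx := (hw j hj x).1
  simp only [Finset.singleton_subset_iff]
  by_cases hxA : x ∈ A
  · simp only [hxA, if_true]
    split_ifs
    · exact le_rfl
    · exact hwx
  · obtain ⟨h, hh, hxh⟩ := hst.dead x hx hxA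
    rw [if_neg, if_neg hxA]
    exact fun hc => hc h hh hxh

end NibbleMain

section Closing
variable {α : Type*}

theorem transGen_or_of_insert {r r' : α → α → Prop} {u v : α}
    (h : ∀ x y, r' x y → r x y ∨ (x = u ∧ y = v)) {x y : α} (hxy : Relation.TransGen r' x y) :
    Relation.TransGen r x y ∨ (Relation.ReflTransGen r x u ∧ Relation.ReflTransGen r v y) := by
  induction hxy with
  | single hb =>
    rcases h _ _ hb with h1 | ⟨rfl, rfl⟩
    · exact Or.inl (.single h1)
    · exact Or.inr ⟨.refl, .refl⟩
  | tail _ hbc ih =>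
    rcases h _ _ hbc with h1 | ⟨rfl, rfl⟩
    · rcases ih with ih | ⟨i1, i2⟩
      · exact Or.inl (ih.tail h1)
      · exact Or.inr ⟨i1, i2.tail h1⟩
    · rcases ih with ih | ⟨i1, _⟩
      · exact Or.inr ⟨ih.to_reflTransGen, .refl⟩
      · exact Or.inr ⟨i1, .refl⟩

/-- In an acyclic relation, adding the pair `(u, v)` closes a cycle only if `v` leads to `u`. -/
theorem reflTransGen_of_closing {r r' : α → α → Prop} {u v : α}
    (h : ∀ x y, r' x y → r x y ∨ (x = u ∧ y = v)) (hr : ∀ x, ¬ Relation.TransGen r x x) {x : α}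
    (hx : Relation.TransGen r' x x) : Relation.ReflTransGen r v u := by
  rcases transGen_or_of_insert h hx with h1 | ⟨h1, h2⟩
  · exact absurd h1 (hr x)
  · exact h2.trans h1

theorem eq_of_reflTransGen_of_no_succ {r : α → α → Prop} (hr : Relator.RightUnique r) {v a b : α}
    (ha : Relation.ReflTransGen r v a) (hb : Relation.ReflTransGen r v b) (ha' : ∀ y, ¬ r a y)
    (hb' : ∀ y, ¬ r b y) : a = b := by
  rcases Relation.ReflTransGen.total_of_right_unique hr ha hb with h | h
  · rcases Relation.ReflTransGen.cases_head h with h | ⟨c, h, -⟩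
    · exact h
    · exact absurd h (ha' c)
  · rcases Relation.ReflTransGen.cases_head h with h | ⟨c, h, -⟩
    · exact h.symm
    · exact absurd h (hb' c)

end Closing

/-- The resources consumed by an arc of one of `t` directed linear forests on `V`: a colour of the
forest, an endpoint of the forest with a direction, and an edge. -/
inductive Slot (t : ℕ) (V : Type*)
  | col (i : Fin t) (c : ℕ)
  | arc (b : Bool) (i : Fin t) (u : V)
  | edge (e : Sym2 V)

namespace Slot
variable {t : ℕ} {V : Type*}

noncomputable instance : DecidableEq (Slot t V) := Classical.decEq _

/-- The resources consumed by the arc `(u, v)` in the forest with index `i`. -/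
noncomputable def ends (φ : Sym2 V → ℕ) (h : Fin t × V × V) : Finset (Slot t V) :=
  {col h.1 (φ s(h.2.1, h.2.2)), arc true h.1 h.2.1, arc false h.1 h.2.2, edge s(h.2.1, h.2.2)}

variable {φ : Sym2 V → ℕ}

theorem mem_ends {x : Slot t V} {h : Fin t × V × V} : x ∈ ends φ h ↔
    x = col h.1 (φ s(h.2.1, h.2.2)) ∨ x = arc true h.1 h.2.1 ∨ x = arc false h.1 h.2.2 ∨
      x = edge s(h.2.1, h.2.2) := by
  simp [ends]

theorem col_mem_ends {i : Fin t} {c : ℕ} {h : Fin t × V × V} :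
    col i c ∈ ends φ h ↔ i = h.1 ∧ c = φ s(h.2.1, h.2.2) := by
  simp [ends]

theorem arc_true_mem_ends {i : Fin t} {u : V} {h : Fin t × V × V} :
    arc true i u ∈ ends φ h ↔ i = h.1 ∧ u = h.2.1 := by
  simp [ends]

theorem arc_false_mem_ends {i : Fin t} {u : V} {h : Fin t × V × V} :
    arc false i u ∈ ends φ h ↔ i = h.1 ∧ u = h.2.2 := by
  simp [ends]

theorem edge_mem_ends {e : Sym2 V} {h : Fin t × V × V} :
    edge e ∈ ends φ h ↔ e = s(h.2.1, h.2.2) := by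
  simp [ends]

theorem card_ends (h : Fin t × V × V) : (ends φ h).card = 4 := by
  simp [ends]

theorem eq_of_disjoint {h h' : Fin t × V × V} {x : Slot t V} (hd : Disjoint (ends φ h) (ends φ h'))
    (hx : x ∈ ends φ h) : x ∉ ends φ h' := Finset.disjoint_left.1 hd hx

/-- At most one way of extending a forest at a given endpoint closes a cycle. -/
theorem closing_unique {M : Finset (Fin t × V × V)} [DecidableEq V]
    (hM : ∀ h ∈ M, ∀ h' ∈ M, h ≠ h' → Disjoint (ends φ h) (ends φ h'))
    (hInv : ∀ i x, ¬ Relation.TransGen (fun u v => (i, u, v) ∈ M) x x) {b : Bool} {i : Fin t} {u : V}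
    {h₁ h₂ : Fin t × V × V} (hx₁ : arc b i u ∈ ends φ h₁) (hx₂ : arc b i u ∈ ends φ h₂)
    (hd₁ : ∀ h ∈ M, Disjoint (ends φ h) (ends φ h₁))
    (hd₂ : ∀ h ∈ M, Disjoint (ends φ h) (ends φ h₂))
    (hc₁ : ¬ ∀ i x, ¬ Relation.TransGen (fun u v => (i, u, v) ∈ insert h₁ M) x x)
    (hc₂ : ¬ ∀ i x, ¬ Relation.TransGen (fun u v => (i, u, v) ∈ insert h₂ M) x x) : h₁ = h₂ := by
  have key : ∀ h : Fin t × V × V, (¬ ∀ i x, ¬ Relation.TransGen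
      (fun u v => (i, u, v) ∈ insert h M) x x) →
      Relation.ReflTransGen (fun u v => (h.1, u, v) ∈ M) h.2.2 h.2.1 := by
    intro h hc
    push Not at hc
    obtain ⟨j, x, hx⟩ := hc
    have hstep : ∀ u v, (j, u, v) ∈ insert h M → (j, u, v) ∈ M ∨ (u = h.2.1 ∧ v = h.2.2) := by
      intro u v huv
      rcases Finset.mem_insert.1 huv with e | e
      · right; rw [← e]; exact ⟨rfl, rfl⟩
      · exact Or.inl e
    by_cases hj : h.1 = j
    · subst hj
      exact reflTransGen_of_closing hstep (hInv _) hx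
    · exfalso
      refine hInv j x (Relation.TransGen.mono (fun u v huv => ?_) x x hx)
      rcases Finset.mem_insert.1 huv with e | e
      · exact absurd (by rw [← e]) hj
      · exact e
  have k₁ := key h₁ hc₁
  have k₂ := key h₂ hc₂
  obtain ⟨i₁, u₁, v₁⟩ := h₁
  obtain ⟨i₂, u₂, v₂⟩ := h₂
  have hout : ∀ i u v u' v', (i, u, v) ∈ M → (i, u', v') ∈ M → u = u' → v = v' := by
    rintro i u v u' v' h h' rfl
    by_contra hne
    exact eq_of_disjoint (hM _ h _ h' (by simp [hne])) (arc_true_mem_ends.2 ⟨rfl, rfl⟩)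
      (arc_true_mem_ends.2 ⟨rfl, rfl⟩)
  have hin : ∀ i u v u' v', (i, u, v) ∈ M → (i, u', v') ∈ M → v = v' → u = u' := by
    rintro i u v u' v' h h' rfl
    by_contra hne
    exact eq_of_disjoint (hM _ h _ h' (by simp [hne])) (arc_false_mem_ends.2 ⟨rfl, rfl⟩)
      (arc_false_mem_ends.2 ⟨rfl, rfl⟩)
  cases b with
  | true =>
    obtain ⟨rfl, rfl⟩ := arc_true_mem_ends.1 hx₁
    obtain ⟨e1, e2⟩ := arc_true_mem_ends.1 hx₂
    dsimp only at e1 e2 k₁ k₂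
    subst e1 e2
    have := eq_of_reflTransGen_of_no_succ (r := Function.swap fun u v => (i, u, v) ∈ M)
      (fun a b c h h' => hin _ _ _ _ _ h h' rfl) (Relation.reflTransGen_swap.2 k₁)
      (Relation.reflTransGen_swap.2 k₂)
      (fun y hy => eq_of_disjoint (hd₁ _ hy) (arc_false_mem_ends.2 ⟨rfl, rfl⟩)
        (arc_false_mem_ends.2 ⟨rfl, rfl⟩))
      (fun y hy => eq_of_disjoint (hd₂ _ hy) (arc_false_mem_ends.2 ⟨rfl, rfl⟩)
        (arc_false_mem_ends.2 ⟨rfl, rfl⟩))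
    rw [this]
  | false =>
    obtain ⟨rfl, rfl⟩ := arc_false_mem_ends.1 hx₁
    obtain ⟨e1, e2⟩ := arc_false_mem_ends.1 hx₂
    dsimp only at e1 e2 k₁ k₂
    subst e1 e2
    have := eq_of_reflTransGen_of_no_succ (r := fun u v => (i, u, v) ∈ M)
      (fun a b c h h' => hout _ _ _ _ _ h h' rfl) k₁ k₂
      (fun y hy => eq_of_disjoint (hd₁ _ hy) (arc_true_mem_ends.2 ⟨rfl, rfl⟩)
        (arc_true_mem_ends.2 ⟨rfl, rfl⟩))
      (fun y hy => eq_of_disjoint (hd₂ _ hy) (arc_true_mem_ends.2 ⟨rfl, rfl⟩)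
        (arc_true_mem_ends.2 ⟨rfl, rfl⟩))
    rw [this]

end Slot

namespace Slot
variable {t : ℕ} {V : Type*} [DecidableEq V] {φ : Sym2 V → ℕ}

theorem card_filter_col_le {𝓗 : Finset (Fin t × V × V)} {i : Fin t} {c : ℕ} :
    (𝓗.filter fun h => col i c ∈ ends φ h).card ≤
      ((𝓗.image Prod.snd).filter fun q => φ s(q.1, q.2) = c).card := by
  refine Finset.card_le_card_of_injOn Prod.snd (fun h hh => ?_) fun h hh h' hh' e => ?_
  · have hh := Finset.mem_coe.1 hh
    rw [Finset.mem_filter, col_mem_ends] at hh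
    simp only [Finset.coe_filter, Finset.mem_image, Set.mem_ofPred_eq]
    exact ⟨⟨h, hh.1, rfl⟩, hh.2.2.symm⟩
  · have hh := Finset.mem_coe.1 hh
    have hh' := Finset.mem_coe.1 hh'
    rw [Finset.mem_filter, col_mem_ends] at hh hh'
    exact Prod.ext (hh.2.1.symm.trans hh'.2.1) e

variable [Fintype V] {R : V → V → Prop} [DecidableRel R]

/-- All potential arcs of all forests. -/
abbrev allArcs (t : ℕ) (R : V → V → Prop) [DecidableRel R] : Finset (Fin t × V × V) :=
  Finset.univ.filter fun h => R h.2.1 h.2.2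

theorem card_filter_arc (hR : ∀ u v, R u v → R v u) (b : Bool) (i : Fin t) (u : V) :
    ((allArcs t R).filter fun h => arc b i u ∈ ends φ h).card =
      (Finset.univ.filter fun v => R u v).card := by
  symm
  cases b with
  | true =>
    refine Finset.card_bij (fun v _ => (i, u, v)) ?_ ?_ ?_
    · intro v hv
      simpa [arc_true_mem_ends] using hv
    · intro v _ v' _ h; simpa using h
    · rintro ⟨j, x, v⟩ h
      simp only [Finset.mem_filter, Finset.mem_univ, true_and, arc_true_mem_ends] at h
      obtain ⟨h, rfl, rfl⟩ := h
      exact ⟨v, by simpa using h, rfl⟩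
  | false =>
    refine Finset.card_bij (fun v _ => (i, v, u)) ?_ ?_ ?_
    · intro v hv
      simpa [arc_false_mem_ends] using hR _ _ (Finset.mem_filter.1 hv).2
    · intro v _ v' _ h; simpa using h
    · rintro ⟨j, v, x⟩ h
      simp only [Finset.mem_filter, Finset.mem_univ, true_and, arc_false_mem_ends] at h
      obtain ⟨h, rfl, rfl⟩ := h
      exact ⟨v, by simpa using hR _ _ h, rfl⟩

theorem card_filter_edge (hR : ∀ u v, R u v → R v u) (hRi : ∀ u, ¬ R u u) {a b : V} (hab : R a b) :
    ((allArcs t R).filter fun h => edge s(a, b) ∈ ends φ h).card = 2 * t := by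
  have hne : a ≠ b := fun h => hRi b (h ▸ hab)
  have : ((allArcs t R).filter fun h => edge s(a, b) ∈ ends φ h) =
      (Finset.univ.image fun i : Fin t => (i, a, b)) ∪
        (Finset.univ.image fun i : Fin t => (i, b, a)) := by
    ext ⟨i, x, y⟩
    simp only [Finset.mem_filter, Finset.mem_univ, true_and, edge_mem_ends, Finset.mem_union,
      Finset.mem_image, Prod.mk.injEq, Sym2.eq_iff]
    constructor
    · rintro ⟨-, ⟨rfl, rfl⟩ | ⟨rfl, rfl⟩⟩
      · exact Or.inl ⟨i, rfl, rfl, rfl⟩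
      · exact Or.inr ⟨i, rfl, rfl, rfl⟩
    · rintro (⟨j, rfl, rfl, rfl⟩ | ⟨j, rfl, rfl, rfl⟩)
      · exact ⟨hab, Or.inl ⟨rfl, rfl⟩⟩
      · exact ⟨hR _ _ hab, Or.inr ⟨rfl, rfl⟩⟩
  rw [this, Finset.card_union_of_disjoint, Finset.card_image_of_injective, 
    Finset.card_image_of_injective, Finset.card_univ, Fintype.card_fin, two_mul]
  · intro i j h; simpa using h
  · intro i j h; simpa using h
  · rw [Finset.disjoint_left]
    intro x hx hx'
    simp only [Finset.mem_image, Finset.mem_univ, true_and] at hx hx'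
    obtain ⟨i, rfl⟩ := hx
    obtain ⟨j, hj⟩ := hx'
    simp only [Prod.mk.injEq] at hj
    exact hne hj.2.1.symm

theorem card_filter_pair_le (hR : ∀ u v, R u v → R v u) {K : ℝ} (hK : 2 ≤ K)
    (hloc : ∀ u c, ((Finset.univ.filter fun v => R u v ∧ φ s(u, v) = c).card : ℝ) ≤ K)
    {y z : Slot t V} (hyz : y ≠ z) :
    (((allArcs t R).filter fun h => y ∈ ends φ h ∧ z ∈ ends φ h).card : ℝ) ≤ K := by
  have one : ∀ s : Finset (Fin t × V × V), (∀ a ∈ s, ∀ b ∈ s, a = b) → (s.card : ℝ) ≤ K := by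
    intro s hs
    have : (s.card : ℝ) ≤ 1 := by exact_mod_cast Finset.card_le_one.2 hs
    linarith
  have hsymm : ∀ {y z : Slot t V},
      (((allArcs t R).filter fun h => y ∈ ends φ h ∧ z ∈ ends φ h).card : ℝ) ≤ K →
      (((allArcs t R).filter fun h => z ∈ ends φ h ∧ y ∈ ends φ h).card : ℝ) ≤ K := by
    intro y z h
    rw [Finset.filter_congr fun _ _ => and_comm]
    exact h
  have hca : ∀ (b : Bool) (i j : Fin t) (c : ℕ) (u : V), (((allArcs t R).filter fun h =>
      col i c ∈ ends φ h ∧ arc b j u ∈ ends φ h).card : ℝ) ≤ K := by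
    intro b i j c u
    refine le_trans ?_ (hloc u c)
    refine Nat.cast_le.2 ?_
    cases b with
    | true =>
      refine Finset.card_le_card_of_injOn (fun h => h.2.2) ?_ ?_
      · rintro ⟨k, x, y⟩ h
        have h := Finset.mem_coe.1 h
        simp only [Finset.mem_filter, Finset.mem_univ, true_and, col_mem_ends,
          arc_true_mem_ends] at h
        obtain ⟨hr, ⟨rfl, rfl⟩, -, rfl⟩ := h
        simpa using hr
      · rintro ⟨k, x, y⟩ h ⟨k', x', y'⟩ h' e
        have h := Finset.mem_coe.1 h
        have h' := Finset.mem_coe.1 h'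
        simp only [Finset.mem_filter, Finset.mem_univ, true_and, col_mem_ends,
          arc_true_mem_ends] at h h' e
        simp only [Prod.mk.injEq]
        exact ⟨h.2.1.1.symm.trans h'.2.1.1, h.2.2.2.symm.trans h'.2.2.2, e⟩
    | false =>
      refine Finset.card_le_card_of_injOn (fun h => h.2.1) ?_ ?_
      · rintro ⟨k, x, y⟩ h
        have h := Finset.mem_coe.1 h
        simp only [Finset.mem_filter, Finset.mem_univ, true_and, col_mem_ends,
          arc_false_mem_ends] at h
        obtain ⟨hr, ⟨rfl, rfl⟩, -, rfl⟩ := h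
        simpa [Sym2.eq_swap] using hR _ _ hr
      · rintro ⟨k, x, y⟩ h ⟨k', x', y'⟩ h' e
        have h := Finset.mem_coe.1 h
        have h' := Finset.mem_coe.1 h'
        simp only [Finset.mem_filter, Finset.mem_univ, true_and, col_mem_ends,
          arc_false_mem_ends] at h h' e
        simp only [Prod.mk.injEq]
        exact ⟨h.2.1.1.symm.trans h'.2.1.1, e, h.2.2.2.symm.trans h'.2.2.2⟩
  have hce : ∀ (i : Fin t) (c : ℕ) (e : Sym2 V), (((allArcs t R).filter fun h =>
      col i c ∈ ends φ h ∧ edge e ∈ ends φ h).card : ℝ) ≤ K := by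
    intro i c e
    induction e using Sym2.ind with
    | _ a b =>
    have hsub : ((allArcs t R).filter fun h => col i c ∈ ends φ h ∧ edge s(a, b) ∈ ends φ h) ⊆
        {(i, a, b), (i, b, a)} := by
      rintro ⟨k, x, y⟩ h
      simp only [Finset.mem_filter, Finset.mem_univ, true_and, col_mem_ends, edge_mem_ends,
        Sym2.eq_iff] at h
      obtain ⟨-, ⟨rfl, -⟩, ⟨rfl, rfl⟩ | ⟨rfl, rfl⟩⟩ := h <;> simp
    have : (((allArcs t R).filter fun h =>
      col i c ∈ ends φ h ∧ edge s(a, b) ∈ ends φ h).card : ℝ) ≤ 2 := by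
      exact_mod_cast (Finset.card_le_card hsub).trans Finset.card_le_two
    linarith
  have hae : ∀ (b : Bool) (i : Fin t) (u : V) (e : Sym2 V), (((allArcs t R).filter fun h =>
      arc b i u ∈ ends φ h ∧ edge e ∈ ends φ h).card : ℝ) ≤ K := by
    intro b i u e
    refine one _ ?_
    rintro ⟨k, x, y⟩ h ⟨k', x', y'⟩ h'
    cases b with
    | true =>
      simp only [Finset.mem_filter, Finset.mem_univ, true_and, arc_true_mem_ends,
        edge_mem_ends] at h h'
      obtain ⟨-, ⟨rfl, rfl⟩, rfl⟩ := h
      obtain ⟨-, ⟨rfl, rfl⟩, e⟩ := h'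
      rw [Sym2.congr_right.1 e]
    | false =>
      simp only [Finset.mem_filter, Finset.mem_univ, true_and, arc_false_mem_ends,
        edge_mem_ends] at h h'
      obtain ⟨-, ⟨rfl, rfl⟩, rfl⟩ := h
      obtain ⟨-, ⟨rfl, rfl⟩, e⟩ := h'
      rw [Sym2.congr_left.1 e]
  rcases y with ⟨i, c⟩ | ⟨b, i, u⟩ | e <;> rcases z with ⟨j, c'⟩ | ⟨b', j, u'⟩ | e'
  · refine one _ fun h hh h' _ => absurd ?_ hyz
    simp only [Finset.mem_filter, col_mem_ends] at hh
    rw [hh.2.1.1, hh.2.1.2, hh.2.2.1, hh.2.2.2]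
  · exact hca _ _ _ _ _
  · exact hce _ _ _
  · exact hsymm (hca _ _ _ _ _)
  · refine one _ ?_
    rintro ⟨k, x, y⟩ h ⟨k', x', y'⟩ h'
    cases b <;> cases b' <;>
    simp only [Finset.mem_filter, Finset.mem_univ, true_and, arc_true_mem_ends,
        arc_false_mem_ends] at h h'
    · obtain ⟨-, ⟨rfl, rfl⟩, rfl, rfl⟩ := h; exact absurd rfl hyz
    · obtain ⟨-, ⟨rfl, rfl⟩, rfl, rfl⟩ := h
      obtain ⟨-, ⟨rfl, rfl⟩, e, rfl⟩ := h'; rfl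
    · obtain ⟨-, ⟨rfl, rfl⟩, rfl, rfl⟩ := h
      obtain ⟨-, ⟨rfl, rfl⟩, e, rfl⟩ := h'; rfl
    · obtain ⟨-, ⟨rfl, rfl⟩, rfl, rfl⟩ := h; exact absurd rfl hyz
  · exact hae _ _ _ _
  · exact hsymm (hce _ _ _)
  · exact hsymm (hae _ _ _ _)
  · refine one _ fun h hh h' _ => absurd ?_ hyz
    simp only [Finset.mem_filter, edge_mem_ends] at hh
    rw [hh.2.1, hh.2.2]

end Slot

open Slot in
/-- Almost spanning directed rainbow linear forests, pairwise edge-disjoint, whose missing endpoints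
are equidistributed with respect to prescribed weights. -/
theorem exists_rainbow_forests {t : ℕ} {V Q : Type*} [Fintype V] [DecidableEq V] [DecidableEq Q]
    {R : V → V → Prop} [DecidableRel R] (hR : ∀ u v, R u v → R v u) (hRi : ∀ u, ¬ R u u)
    (hne : ∃ u v, R u v) (φ : Sym2 V → ℕ) (Qs : Finset Q) (W : Q → Fin t → V → ℝ)
    {D θ L ξ₀ δ : ℝ} (hD : 0 < D) (hθ : 0 < θ) (hθD : 2 ≤ θ * D) (hθt : 1 ≤ θ * t)
    (hcol : ∀ c, ((Finset.univ.filter fun q : V × V => R q.1 q.2 ∧ φ s(q.1, q.2) = c).card : ℝ) ≤ D)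
    (hdeg : ∀ u, (1 - ξ₀ / 2) * D ≤ (Finset.univ.filter fun v => R u v).card ∧
      ((Finset.univ.filter fun v => R u v).card : ℝ) ≤ (1 + ξ₀ / 2) * D)
    (ht : (1 - ξ₀ / 2) * D ≤ 2 * t ∧ 2 * t ≤ D)
    (hloc : ∀ u c, ((Finset.univ.filter fun v => R u v ∧ φ s(u, v) = c).card : ℝ) ≤ θ * D)
    (hW : ∀ q ∈ Qs, ∀ i u, 0 ≤ W q i u ∧ W q i u ≤ θ)
    (hWsum : ∀ q ∈ Qs, ∑ p : Fin t × V, W q p.1 p.2 ≤ 1)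
    (hδ0 : 0 < δ) (hδ1 : δ ≤ 1 / 2) (hξ0 : 0 < ξ₀) (hξδ : 4 * ξ₀ ≤ δ ^ 60)
    (hθξ : 6 * θ ≤ ξ₀ * δ ^ 4) (hL : 0 < L) (hLθ : 100 * L * θ ≤ ξ₀ * δ ^ 4)
    (hexp : (8 * t * (Fintype.card V : ℝ) ^ 2 + 2 * Qs.card) * Real.exp (- (L * (ξ₀ / 2))) < 1) :
    ∃ M : Finset (Fin t × V × V), (∀ h ∈ M, R h.2.1 h.2.2) ∧
      (∀ i x, ¬ Relation.TransGen (fun u v => (i, u, v) ∈ M) x x) ∧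
      (∀ h ∈ M, ∀ h' ∈ M, h ≠ h' → Disjoint (ends φ h) (ends φ h')) ∧
      (∀ q ∈ Qs, ∑ p : Fin t × V with ∀ v, (p.1, p.2, v) ∉ M, W q p.1 p.2 ≤ 4 * δ) ∧
      (∀ q ∈ Qs, ∑ p : Fin t × V with ∀ u, (p.1, u, p.2) ∉ M, W q p.1 p.2 ≤ 4 * δ) := by
  classical
  set 𝓗 : Finset (Fin t × V × V) := allArcs t R with h𝓗
  set P : Finset (Slot t V) := 𝓗.image fun h => col h.1 (φ s(h.2.1, h.2.2)) with hPdef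
  set soft : Finset (Slot t V) :=
    Finset.univ.image fun p : Bool × Fin t × V => arc p.1 p.2.1 p.2.2 with hsoft
  set E : Finset (Slot t V) := 𝓗.image fun h => edge s(h.2.1, h.2.2) with hE
  set w : Bool × Q → Slot t V → ℝ := fun j x => match x with
    | col _ _ => 0
    | edge _ => 0
    | arc b i u => if b = j.1 then W j.2 i u else 0 with hw
  have hinj : Function.Injective fun p : Bool × Fin t × V => (arc p.1 p.2.1 p.2.2 : Slot t V) := by
    rintro ⟨b, i, u⟩ ⟨b', i', u'⟩ h
    simpa using h
  have hmemsoft : ∀ b i u, (arc b i u : Slot t V) ∈ soft := fun b i u =>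
    Finset.mem_image.2 ⟨(b, i, u), Finset.mem_univ _, rfl⟩
  have hmem𝓗 : ∀ {h}, h ∈ 𝓗 ↔ R h.2.1 h.2.2 := by intro h; simp [h𝓗]
  have hsum : ∀ (p : Slot t V → Prop) [DecidablePred p] (j : Bool × Q),
      ∑ x ∈ soft with p x, w j x = ∑ y : Fin t × V with p (arc j.1 y.1 y.2), W j.2 y.1 y.2 := by
    intro p _ j
    rw [Finset.sum_filter, hsoft, Finset.sum_image fun a _ b _ h => hinj h, Fintype.sum_prod_type,
      Finset.sum_filter, Finset.sum_eq_single j.1]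
    · exact Finset.sum_congr rfl fun y _ => by simp [hw]
    · intro b _ hb
      exact Finset.sum_eq_zero fun y _ => by simp [hw, hb]
    · intro h; exact absurd (Finset.mem_univ _) h
  have hcardX : (((P ∪ soft ∪ E).card : ℕ) : ℝ) ≤ 4 * t * (Fintype.card V : ℝ) ^ 2 := by
    have e1 : (P ∪ soft ∪ E).card ≤ P.card + soft.card + E.card :=
      (Finset.card_union_le _ _).trans (Nat.add_le_add_right (Finset.card_union_le _ _) _)
    have e2 : 𝓗.card ≤ t * (Fintype.card V * Fintype.card V) := by
      refine (Finset.card_le_univ _).trans (le_of_eq ?_)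
      simp [Fintype.card_prod]
    have e3 : soft.card ≤ 2 * (t * Fintype.card V) := by
      refine Finset.card_image_le.trans (le_of_eq ?_)
      simp [Fintype.card_prod]
    have e4 : Fintype.card V ≤ Fintype.card V * Fintype.card V := Nat.le_mul_self _
    have e5 : P.card ≤ 𝓗.card := Finset.card_image_le
    have e6 : E.card ≤ 𝓗.card := Finset.card_image_le
    have e7 := Nat.mul_le_mul_left (2 * t) e4
    have e8 : (P ∪ soft ∪ E).card ≤ 4 * t * (Fintype.card V) ^ 2 := by nlinarith
    exact_mod_cast e8
  obtain ⟨M, hM𝓗, hMI, hMd, hMw⟩ := exists_nibble (𝓗 := 𝓗) (ends := ends φ) (𝒳 := P ∪ soft ∪ E)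
    (soft := soft) (P := P) (pv := fun h => col h.1 (φ s(h.2.1, h.2.2)))
    (Inv := fun M => ∀ i x, ¬ Relation.TransGen (fun u v => (i, u, v) ∈ M) x x)
    (Js := Finset.univ ×ˢ Qs) (w := w) (D := D) (θ := θ) (L := L) (ξ₀ := ξ₀) (δ := δ)
    (fun h hh x hx => by
      rcases mem_ends.1 hx with rfl | rfl | rfl | rfl
      · exact Finset.mem_union_left _ (Finset.mem_union_left _ (Finset.mem_image_of_mem _ hh))
      · exact Finset.mem_union_left _ (Finset.mem_union_right _ (hmemsoft _ _ _))
      · exact Finset.mem_union_left _ (Finset.mem_union_right _ (hmemsoft _ _ _))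
      · exact Finset.mem_union_right _
          (Finset.mem_image_of_mem (fun h : Fin t × V × V => (edge s(h.2.1, h.2.2) : Slot t V)) hh))
    (fun h _ => card_ends h)
    (fun h hh => by
      ext x
      simp only [Finset.mem_inter, Finset.mem_singleton, mem_ends, hPdef, Finset.mem_image]
      constructor
      · rintro ⟨h1, h', -, rfl⟩
        simpa using h1
      · rintro rfl
        exact ⟨Or.inl rfl, h, hh, rfl⟩)
    (fun x hx => Finset.mem_union_left _ (Finset.mem_union_left _ hx))
    (fun x hx => Finset.mem_union_left _ (Finset.mem_union_right _ hx))
    (by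
      rw [Finset.disjoint_left]
      intro x hx hx'
      simp only [hsoft, hPdef, Finset.mem_image] at hx hx'
      obtain ⟨p, -, rfl⟩ := hx
      obtain ⟨q, -, h⟩ := hx'
      cases h)
    hD (by linarith) hθ
    (by
      obtain ⟨a, b, hab⟩ := hne
      have : t ≤ P.card := by
        calc t = (Finset.univ.image fun i : Fin t => (col i (φ s(a, b)) : Slot t V)).card := by
              rw [Finset.card_image_of_injective, Finset.card_univ, Fintype.card_fin]
              intro i j h; simpa using h
          _ ≤ P.card := by
              refine Finset.card_le_card fun x hx => ?_
              obtain ⟨i, -, rfl⟩ := Finset.mem_image.1 hx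
              exact Finset.mem_image.2 ⟨(i, a, b), hmem𝓗.2 hab, rfl⟩
      have h2 : (t : ℝ) ≤ P.card := Nat.cast_le.2 this
      exact hθt.trans (mul_le_mul_of_nonneg_left h2 hθ.le))
    (fun x hx => by
      rcases x with ⟨i, c⟩ | ⟨b, i, u⟩ | e
      · have e1 : ((𝓗.filter fun h => col i c ∈ ends φ h).card : ℝ) ≤ _ :=
          Nat.cast_le.2 (card_filter_col_le (φ := φ) (𝓗 := 𝓗) (i := i) (c := c))
        have e2 : (((𝓗.image Prod.snd).filter fun q => φ s(q.1, q.2) = c).card : ℝ) ≤ D := by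
          refine le_trans ?_ (hcol c)
          refine Nat.cast_le.2 (Finset.card_le_card fun q hq => ?_)
          simp only [Finset.mem_filter, Finset.mem_image, Finset.mem_univ, true_and] at hq ⊢
          obtain ⟨⟨h, hh, rfl⟩, hq⟩ := hq
          exact ⟨hmem𝓗.1 hh, hq⟩
        have : 0 ≤ ξ₀ / 2 * D := by positivity
        linarith
      · rw [h𝓗, card_filter_arc hR]; exact (hdeg u).2
      · have : edge e ∈ E := by
          simp only [Finset.mem_union, hPdef, hsoft, Finset.mem_image] at hx
          rcases hx with (⟨_, _, h⟩ | ⟨_, _, h⟩) | h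
          · cases h
          · cases h
          · exact h
        obtain ⟨h, hh, he⟩ := Finset.mem_image.1 this
        rw [← he, h𝓗, card_filter_edge hR hRi (hmem𝓗.1 hh)]
        have : 0 ≤ ξ₀ / 2 * D := by positivity
        push_cast
        linarith [ht.2])
    (fun x hx hxP => by
      rcases x with ⟨i, c⟩ | ⟨b, i, u⟩ | e
      · exfalso
        simp only [Finset.mem_union, hxP, false_or, hsoft, hE, Finset.mem_image] at hx
        rcases hx with ⟨_, _, h⟩ | ⟨_, _, h⟩ <;> cases h
      · rw [h𝓗, card_filter_arc hR]; exact (hdeg u).1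
      · have : edge e ∈ E := by
          simp only [Finset.mem_union, hPdef, hsoft, Finset.mem_image] at hx
          rcases hx with (⟨_, _, h⟩ | ⟨_, _, h⟩) | h
          · cases h
          · cases h
          · exact h
        obtain ⟨h, hh, he⟩ := Finset.mem_image.1 this
        rw [← he, h𝓗, card_filter_edge hR hRi (hmem𝓗.1 hh)]
        push_cast
        exact ht.1)
    (fun y z hyz => card_filter_pair_le hR hθD hloc hyz)
    (by
      intro i x hx
      rcases Relation.TransGen.head'_iff.1 hx with ⟨y, hy, -⟩
      simp at hy)
    (by
      intro M _ hInv hM x hx h₁ _ h₂ _ hx₁ hx₂ hd₁ hd₂ hc₁ hc₂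
      obtain ⟨⟨b, i, u⟩, -, rfl⟩ := Finset.mem_image.1 hx
      exact closing_unique hM hInv hx₁ hx₂ hd₁ hd₂ hc₁ hc₂)
    (by
      rintro ⟨b, q⟩ hj x
      have hq := (Finset.mem_product.1 hj).2
      rcases x with ⟨i, c⟩ | ⟨b', i, u⟩ | e
      · simp [hw, hθ.le]
      · simp only [hw]
        split_ifs
        · exact hW q hq i u
        · exact ⟨le_rfl, hθ.le⟩
      · simp [hw, hθ.le])
    (by
      rintro ⟨b, q⟩ hj
      have hq := (Finset.mem_product.1 hj).2
      have := hsum (fun _ => True) (b, q)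
      simp only [Finset.filter_true] at this
      rw [this]
      exact hWsum q hq)
    hδ0 hδ1 hξ0 hξδ hθξ hL hLθ
    (by
      refine lt_of_le_of_lt ?_ hexp
      refine mul_le_mul_of_nonneg_right ?_ (Real.exp_pos _).le
      have : ((Finset.univ ×ˢ Qs : Finset (Bool × Q)).card : ℝ) = 2 * Qs.card := by
        rw [Finset.card_product]; simp
      rw [this]
      linarith)
  refine ⟨M, fun h hh => hmem𝓗.1 (hM𝓗 hh), hMI, hMd, fun q hq => ?_, fun q hq => ?_⟩
  · have h := hMw (true, q) (Finset.mem_product.2 ⟨Finset.mem_univ _, hq⟩)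
    rw [hsum] at h
    refine le_trans (le_of_eq (Finset.sum_congr ?_ fun _ _ => rfl)) h
    ext p
    simp only [Finset.mem_filter, Finset.mem_univ, true_and, arc_true_mem_ends]
    constructor
    · rintro h1 ⟨i, u, v⟩ hM ⟨h2, h3⟩
      dsimp only at h2 h3
      exact h1 v (by rw [h2, h3]; exact hM)
    · exact fun h1 v hv => h1 _ hv ⟨rfl, rfl⟩
  · have h := hMw (false, q) (Finset.mem_product.2 ⟨Finset.mem_univ _, hq⟩)
    rw [hsum] at h
    refine le_trans (le_of_eq (Finset.sum_congr ?_ fun _ _ => rfl)) h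
    ext p
    simp only [Finset.mem_filter, Finset.mem_univ, true_and, arc_false_mem_ends]
    constructor
    · rintro h1 ⟨i, u, v⟩ hM ⟨h2, h3⟩
      dsimp only at h2 h3
      exact h1 u (by rw [h2, h3]; exact hM)
    · exact fun h1 v hv => h1 _ hv ⟨rfl, rfl⟩

section Blocks
variable {α : Type*}

theorem cycle_chain_iff_formPerm [DecidableEq α] {R : α → α → Prop} {l : List α} (hl : l.Nodup) :
    Cycle.Chain R (l : Cycle α) ↔ ∀ x ∈ l, R x (l.formPerm x) := by
  cases l with
  | nil => simp [Cycle.Chain.nil]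
  | cons a m =>
    have hlast : (a :: m)[m.length] = (a :: m).getLast (List.cons_ne_nil _ _) := by
      rw [List.getLast_eq_getElem]; rfl
    rw [Cycle.chain_coe_cons, ← List.cons_append, List.isChain_append]
    constructor
    · rintro ⟨h1, -, h2⟩ x hx
      obtain ⟨i, hi, rfl⟩ := List.getElem_of_mem hx
      rw [List.formPerm_apply_getElem _ hl]
      by_cases hi' : i + 1 < (a :: m).length
      · simp only [Nat.mod_eq_of_lt hi']
        exact List.isChain_iff_getElem.1 h1 i hi'
      · have hi2 : i = m.length := by simp at hi hi'; omega
        subst hi2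
        simp only [List.length_cons, Nat.mod_self, List.getElem_cons_zero]
        exact h2 _ (by rw [hlast, List.getLast?_eq_getLast_of_ne_nil (List.cons_ne_nil _ _)]; rfl) a
          (by simp)
    · intro h
      refine ⟨List.isChain_iff_getElem.2 fun i hi => ?_, List.isChain_singleton _, ?_⟩
      · have := h _ (List.getElem_mem (Nat.lt_of_succ_lt hi))
        rwa [List.formPerm_apply_lt_getElem _ hl i hi] at this
      · intro x hx y hy
        obtain rfl : a = y := by simpa using hy
        rw [List.getLast?_eq_getLast_of_ne_nil (List.cons_ne_nil _ _)] at hx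
        obtain rfl : (a :: m).getLast (List.cons_ne_nil _ _) = x := by simpa using hx
        have := h _ (List.getLast_mem (List.cons_ne_nil a m))
        rwa [List.formPerm_apply_getLast] at this

/-- A partition of all elements into nonempty chains. -/
structure IsBlocks (r : α → α → Prop) (L : List (List α)) : Prop where
  ne_nil : ∀ b ∈ L, b ≠ []
  chain : ∀ b ∈ L, b.IsChain r
  nodup : L.flatten.Nodup
  mem : ∀ x, x ∈ L.flatten

theorem IsBlocks.perm {r : α → α → Prop} {L L' : List (List α)} (h : IsBlocks r L)
    (hp : L.Perm L') : IsBlocks r L' :=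
  ⟨fun b hb => h.ne_nil b (hp.mem_iff.2 hb), fun b hb => h.chain b (hp.mem_iff.2 hb),
    hp.flatten.nodup_iff.1 h.nodup, fun x => hp.flatten.mem_iff.1 (h.mem x)⟩

theorem IsBlocks.eq_of_mem {r : α → α → Prop} {L : List (List α)} (h : IsBlocks r L) {b b' : List α}
    (hb : b ∈ L) (hb' : b' ∈ L) {x : α} (hx : x ∈ b) (hx' : x ∈ b') : b = b' := by
  by_contra hne
  have hsymm : Std.Symm (List.Disjoint (α := α)) := ⟨fun _ _ h => List.Disjoint.symm h⟩
  have := (List.nodup_flatten.1 h.nodup).2.forall hb hb' hne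
  exact this hx hx'

theorem exists_isBlocks_singletons [Fintype α] (r : α → α → Prop) : ∃ L, IsBlocks r L := by
  refine ⟨Finset.univ.toList.map fun x => [x], ?_, ?_, ?_, ?_⟩
  · intro b hb; obtain ⟨x, -, rfl⟩ := List.mem_map.1 hb; simp
  · intro b hb; obtain ⟨x, -, rfl⟩ := List.mem_map.1 hb; simp
  · have : (Finset.univ.toList.map fun x : α => [x]).flatten = Finset.univ.toList := by
      induction (Finset.univ : Finset α).toList with
      | nil => rfl
      | cons a l ih => simpa using ih
    rw [this]; exact Finset.nodup_toList _
  · intro x; simp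

variable {r : α → α → Prop}

/-- The successor of the last element of a block is the first element of a different block. -/
theorem IsBlocks.exists_merge {L : List (List α)} (h : IsBlocks r L) (hr : Relator.LeftUnique r)
    (hac : ∀ x, ¬ Relation.TransGen r x x) {s : List α} {x y : α} (hb : s ++ [x] ∈ L)
    (hxy : r x y) : ∃ L', IsBlocks r L' ∧ L'.length < L.length := by
  obtain ⟨b₂, hb₂, hy⟩ := List.mem_flatten.1 (h.mem y)
  obtain ⟨s₂, u, rfl⟩ := List.append_of_mem hy
  have hnd : ∀ b ∈ L, b.Nodup := (List.nodup_flatten.1 h.nodup).1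
  have hs₂ : s₂ = [] := by
    rcases List.eq_nil_or_concat s₂ with h0 | ⟨s', z, rfl⟩
    · exact h0
    exfalso
    have hz : r z y := by
      have := h.chain _ hb₂
      simp only [List.concat_eq_append, List.append_assoc, List.cons_append, List.nil_append] at this
      rw [List.isChain_append_cons_cons] at this
      exact this.2.1
    have hzx : z = x := hr hz hxy
    subst hzx
    have hEq := h.eq_of_mem hb hb₂ (x := z) (by simp) (by simp)
    have hn := hnd _ hb₂
    have h1 : (s ++ [z]).getLast? = some z := by simp
    rw [hEq] at h1
    have h2 : z ∈ y :: u := by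
      rw [List.getLast?_append] at h1
      have h3 : (y :: u).getLast? = some z := by
        cases hc : (y :: u).getLast? with
        | none => simp at hc
        | some w => rw [hc] at h1; simpa using h1
      exact List.mem_of_getLast? h3
    exact (List.nodup_append.1 hn).2.2 z (by simp) z h2 rfl
  subst hs₂
  rw [List.nil_append] at hb₂ hy
  have hne : s ++ [x] ≠ y :: u := by
    intro hEq
    have hch := h.chain _ hb₂
    have : Relation.ReflTransGen r y x :=
      List.relationReflTransGen_of_exists_isChain_cons u hch (by simp [← hEq])
    exact hac x (Relation.TransGen.head' hxy this)
  obtain ⟨p, q, rfl⟩ := List.append_of_mem hb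
  have hp1 : (p ++ (s ++ [x]) :: q).Perm ((s ++ [x]) :: (p ++ q)) := List.perm_middle
  have hb₂' : y :: u ∈ p ++ q := by
    rcases List.mem_cons.1 (hp1.mem_iff.1 hb₂) with h1 | h1
    · exact absurd h1.symm hne
    · exact h1
  obtain ⟨p', q', hpq⟩ := List.append_of_mem hb₂'
  have hp2 : (p ++ (s ++ [x]) :: q).Perm ((s ++ [x]) :: (y :: u) :: (p' ++ q')) :=
    hp1.trans (List.Perm.cons _ (hpq ▸ List.perm_middle))
  have h2 := h.perm hp2
  refine ⟨((s ++ [x]) ++ y :: u) :: (p' ++ q'), ⟨?_, ?_, ?_, ?_⟩, ?_⟩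
  · intro b hb
    rcases List.mem_cons.1 hb with rfl | hb
    · simp
    · exact h2.ne_nil b (List.mem_cons_of_mem _ (List.mem_cons_of_mem _ hb))
  · intro b hb
    rcases List.mem_cons.1 hb with rfl | hb
    · rw [List.append_assoc, List.singleton_append, List.isChain_append_cons_cons]
      exact ⟨h2.chain _ (by simp), hxy, h2.chain _ (by simp)⟩
    · exact h2.chain b (List.mem_cons_of_mem _ (List.mem_cons_of_mem _ hb))
  · have := h2.nodup
    simpa [List.flatten_cons, List.append_assoc] using this
  · intro z
    have := h2.mem z
    simpa [List.flatten_cons, List.append_assoc, or_assoc] using this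
  · rw [hp2.length_eq]; simp

theorem exists_isBlocks_maximal [Fintype α] (hr : Relator.LeftUnique r)
    (hac : ∀ x, ¬ Relation.TransGen r x x) :
    ∃ L, IsBlocks r L ∧ ∀ s x, s ++ [x] ∈ L → ∀ y, ¬ r x y := by
  obtain ⟨L₀, hL₀⟩ := exists_isBlocks_singletons r
  induction hk : L₀.length using Nat.strong_induction_on generalizing L₀ with
  | _ k ih =>
    by_cases hc : ∀ s x, s ++ [x] ∈ L₀ → ∀ y, ¬ r x y
    · exact ⟨L₀, hL₀, hc⟩
    · push Not at hc
      obtain ⟨s, x, hb, y, hxy⟩ := hc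
      obtain ⟨L', h1, h2⟩ := hL₀.exists_merge hr hac hb hxy
      exact ih _ (hk ▸ h2) L' h1 rfl

theorem IsBlocks.head_no_pred {L : List (List α)} (h : IsBlocks r L) (hr : Relator.RightUnique r)
    (hac : ∀ x, ¬ Relation.TransGen r x x) (hL : ∀ s x, s ++ [x] ∈ L → ∀ y, ¬ r x y)
    {y : α} {u : List α} (hb : y :: u ∈ L) (x : α) : ¬ r x y := by
  intro hxy
  obtain ⟨b', hb', hx⟩ := List.mem_flatten.1 (h.mem x)
  obtain ⟨s, v, rfl⟩ := List.append_of_mem hx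
  cases v with
  | nil => exact hL s x hb' y hxy
  | cons z v =>
    have hch := h.chain _ hb'
    rw [List.isChain_append_cons_cons] at hch
    have hzy : z = y := hr hch.2.1 hxy
    subst hzy
    have hEq := h.eq_of_mem hb hb' (x := z) (by simp) (by simp)
    have hn := (List.nodup_flatten.1 h.nodup).1 _ hb'
    cases s with
    | nil =>
      simp only [List.nil_append, List.cons.injEq] at hEq
      exact hac x (.single (hEq.1 ▸ hxy))
    | cons w s =>
      simp only [List.cons_append, List.cons.injEq] at hEq
      rw [← hEq.1] at hn
      simp at hn

/-- An acyclic relation with unique predecessors and successors extends to a cyclic ordering in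
which all other steps lead from a maximal to a minimal element. -/
theorem exists_cyclic_list [Fintype α] [DecidableEq α] [Nonempty α] (hrl : Relator.LeftUnique r)
    (hrr : Relator.RightUnique r) (hac : ∀ x, ¬ Relation.TransGen r x x) :
    ∃ l : List α, l.Nodup ∧ (∀ x, x ∈ l) ∧ ∃ T : Finset (α × α),
      Cycle.Chain (fun x y => r x y ∨ (x, y) ∈ T) (l : Cycle α) ∧
      (∀ q ∈ T, (∀ y, ¬ r q.1 y) ∧ ∀ x, ¬ r x q.2) ∧
      (∀ q ∈ T, ∀ q' ∈ T, q.1 = q'.1 → q = q') ∧ (∀ q ∈ T, ∀ q' ∈ T, q.2 = q'.2 → q = q') := by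
  classical
  obtain ⟨L, hL, hlast⟩ := exists_isBlocks_maximal hrl hac
  set R' : α → α → Prop := fun x y => r x y ∨ ((∀ z, ¬ r x z) ∧ ∀ z, ¬ r z y) with hR'
  have hnil : [] ∉ L := fun h => hL.ne_nil _ h rfl
  have hjoin : ∀ b₁ ∈ L, ∀ b₂ ∈ L, ∀ x ∈ b₁.getLast?, ∀ y ∈ b₂.head?, R' x y := by
    intro b₁ hb₁ b₂ hb₂ x hx y hy
    obtain ⟨s, rfl⟩ : ∃ s, b₁ = s ++ [x] := by
      rw [Option.mem_def, List.getLast?_eq_some_iff] at hx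
      exact hx
    obtain ⟨u, rfl⟩ : ∃ u, b₂ = y :: u := by
      rw [Option.mem_def, List.head?_eq_some_iff] at hy
      exact hy
    exact Or.inr ⟨hlast s x hb₁, hL.head_no_pred hrr hac hlast hb₂⟩
  have hLne : L ≠ [] := by
    rintro rfl
    obtain ⟨x⟩ := ‹Nonempty α›
    simpa using hL.mem x
  have hch : L.flatten.IsChain R' := by
    rw [List.isChain_flatten hnil]
    refine ⟨fun b hb => (hL.chain b hb).imp fun _ _ h => Or.inl h, ?_⟩
    exact (List.pairwise_of_forall_mem_list hjoin).isChain
  have hfne : L.flatten ≠ [] := by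
    obtain ⟨x⟩ := ‹Nonempty α›
    exact List.ne_nil_of_mem (hL.mem x)
  have hcyc : Cycle.Chain R' (L.flatten : Cycle α) := by
    rw [Cycle.chain_ne_nil _ hfne]
    refine List.isChain_cons.2 ⟨fun y hy => ?_, hch⟩
    obtain ⟨b₂, L₂, hL₂⟩ := List.exists_cons_of_ne_nil hLne
    obtain ⟨L₁, b₁, hL₁⟩ := List.eq_nil_or_concat L |>.resolve_left hLne
    have hb₁ : b₁ ∈ L := by rw [hL₁]; simp
    have hb₂ : b₂ ∈ L := by rw [hL₂]; simp
    refine hjoin b₁ hb₁ b₂ hb₂ _ ?_ y ?_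
    · have h1 : L.flatten.getLast? = b₁.getLast? := by
        rw [hL₁, List.concat_eq_append, List.flatten_append, List.flatten_singleton,
          List.getLast?_append_of_ne_nil _ (hL.ne_nil _ hb₁)]
      rw [← h1, List.getLast?_eq_getLast_of_ne_nil hfne]; rfl
    · have h1 : L.flatten.head? = b₂.head? := by
        rw [hL₂, List.flatten_cons, List.head?_append_of_ne_nil _ (hL.ne_nil _ hb₂)]
      rw [← h1]; exact hy
  have hnd := hL.nodup
  rw [cycle_chain_iff_formPerm hnd] at hcyc
  set σ := L.flatten.formPerm with hσ
  set T : Finset (α × α) := (Finset.univ.image fun x => (x, σ x)).filter fun q =>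
    (∀ y, ¬ r q.1 y) ∧ ∀ x, ¬ r x q.2 with hT
  refine ⟨L.flatten, hnd, hL.mem, T, ?_, fun q hq => (Finset.mem_filter.1 hq).2, ?_, ?_⟩
  · rw [cycle_chain_iff_formPerm hnd]
    intro x hx
    rcases hcyc x hx with h | h
    · exact Or.inl h
    · exact Or.inr (Finset.mem_filter.2 ⟨Finset.mem_image_of_mem _ (Finset.mem_univ x), h⟩)
  · intro q hq q' hq' h
    obtain ⟨x, -, rfl⟩ := Finset.mem_image.1 (Finset.mem_filter.1 hq).1
    obtain ⟨x', -, rfl⟩ := Finset.mem_image.1 (Finset.mem_filter.1 hq').1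
    dsimp only at h; rw [h]
  · intro q hq q' hq' h
    obtain ⟨x, -, rfl⟩ := Finset.mem_image.1 (Finset.mem_filter.1 hq).1
    obtain ⟨x', -, rfl⟩ := Finset.mem_image.1 (Finset.mem_filter.1 hq').1
    dsimp only at h; rw [σ.injective h]

end Blocks

section Moves
variable {α : Type*} {S : α → α → Prop}

theorem cycle_chain_append_three {l₁ l₂ l₃ : List α} {a₁ b₁ a₂ b₂ a₃ b₃ : α}
    (h₁ : l₁.head? = some a₁) (h₁' : l₁.getLast? = some b₁) (h₂ : l₂.head? = some a₂)
    (h₂' : l₂.getLast? = some b₂) (h₃ : l₃.head? = some a₃) (h₃' : l₃.getLast? = some b₃)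
    (c₁ : l₁.IsChain S) (c₂ : l₂.IsChain S) (c₃ : l₃.IsChain S) (e₁ : S b₁ a₂) (e₂ : S b₂ a₃)
    (e₃ : S b₃ a₁) : Cycle.Chain S ((l₁ ++ l₂ ++ l₃ : List α) : Cycle α) := by
  have n₃ : l₃ ≠ [] := by rintro rfl; simp at h₃
  have n₂ : l₂ ≠ [] := by rintro rfl; simp at h₂
  have n₁ : l₁ ≠ [] := by rintro rfl; simp at h₁
  have hn : l₁ ++ l₂ ++ l₃ ≠ [] := by simp [n₁]
  rw [Cycle.chain_ne_nil _ hn, List.isChain_cons, List.isChain_append, List.isChain_append]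
  have hl : (l₁ ++ l₂ ++ l₃).getLast hn = b₃ := by
    have : (l₁ ++ l₂ ++ l₃).getLast? = some b₃ := by
      rw [List.getLast?_append_of_ne_nil _ n₃, h₃']
    rw [List.getLast?_eq_getLast_of_ne_nil hn] at this
    simpa using this
  have hh : (l₁ ++ l₂ ++ l₃).head? = some a₁ := by
    rw [List.append_assoc, List.head?_append_of_ne_nil _ n₁, h₁]
  rw [hl, hh, List.getLast?_append_of_ne_nil _ n₂, h₁', h₂, h₂', h₃]
  simp [c₁, c₂, c₃, e₁, e₂, e₃]

/-- Three-edge exchange: a path from `a` to `b` is turned into a cycle by adding one edge at each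
end of the path and one more edge. -/
theorem exists_cycle_of_path (hS : ∀ x y, S x y → S y x) {l : List α} {a b : α} {lo hi : ℕ}
    (hlo : 0 < lo) (hlh : lo ≤ hi) (hhi : hi + 1 < l.length) (hl : l.IsChain S)
    (ha : l.head? = some a) (hb : l.getLast? = some b)
    (e₁ : S (l[lo - 1]'(by omega)) l[hi + 1])
    (e₂ : (S b (l[lo]'(by omega)) ∧ S (l[hi]'(by omega)) a) ∨
      (S a (l[lo]'(by omega)) ∧ S (l[hi]'(by omega)) b)) :
    ∃ l' : List α, l'.Perm l ∧ Cycle.Chain S (l' : Cycle α) := by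
  set l₁ := l.take lo with hl₁
  set l₂ := (l.take (hi + 1)).drop lo with hl₂
  set l₃ := l.drop (hi + 1) with hl₃
  have hsplit : l = l₁ ++ l₂ ++ l₃ := by
    have : l₁ = (l.take (hi + 1)).take lo := by
      rw [hl₁, List.take_take, min_eq_left (by omega)]
    rw [this, hl₂, List.take_append_drop, hl₃, List.take_append_drop]
  have c₁ : l₁.IsChain S := hl.take _
  have c₂ : l₂.IsChain S := (hl.take _).drop _
  have c₃ : l₃.IsChain S := hl.drop _
  have h₁ : l₁.head? = some a := by rw [hl₁, List.head?_take, if_neg (by omega), ha]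
  have h₁' : l₁.getLast? = some (l[lo - 1]'(by omega)) := by
    rw [hl₁, List.getLast?_take, if_neg (by omega), List.getElem?_eq_getElem]; rfl
  have h₂ : l₂.head? = some (l[lo]'(by omega)) := by
    rw [hl₂, List.head?_drop, List.getElem?_take, if_pos (by omega), List.getElem?_eq_getElem]
  have h₂' : l₂.getLast? = some (l[hi]'(by omega)) := by
    rw [hl₂, List.getLast?_drop, if_neg (by simp; omega), List.getLast?_take, if_neg (by omega)]
    simp
  have h₃ : l₃.head? = some l[hi + 1] := by
    rw [hl₃, List.head?_drop, List.getElem?_eq_getElem]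
  have h₃' : l₃.getLast? = some b := by
    rw [hl₃, List.getLast?_drop, if_neg (by omega), hb]
  rcases e₂ with ⟨e₂, e₃⟩ | ⟨e₂, e₃⟩
  · refine ⟨l₁ ++ l₃ ++ l₂, ?_, cycle_chain_append_three h₁ h₁' h₃ h₃' h₂ h₂' c₁ c₃ c₂ e₁ e₂ e₃⟩
    conv_rhs => rw [hsplit]
    rw [List.append_assoc, List.append_assoc]
    exact List.Perm.append_left _ List.perm_append_comm
  · have hrev : ∀ {m : List α}, m.IsChain S → m.reverse.IsChain S := fun {m} hm => by
      rw [List.isChain_reverse]; exact hm.imp fun x y h => hS x y h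
    refine ⟨l₁.reverse ++ l₂ ++ l₃.reverse, ?_, cycle_chain_append_three
      (a₁ := l[lo - 1]'(by omega)) (b₁ := a) (a₃ := b) (b₃ := l[hi + 1]) ?_ ?_ h₂ h₂' ?_ ?_
      (hrev c₁) c₂ (hrev c₃) e₂ e₃ (hS _ _ e₁)⟩
    · conv_rhs => rw [hsplit]
      exact ((List.reverse_perm _).append_right _).append (List.reverse_perm _)
    · rw [List.head?_reverse, h₁']
    · rw [List.getLast?_reverse, h₁]
    · rw [List.head?_reverse, h₃']
    · rw [List.getLast?_reverse, h₃]

theorem exists_path_of_next [DecidableEq α] {l : List α} (hl : l.Nodup)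
    (h3 : 3 ≤ l.length) (hc : Cycle.Chain S (l : Cycle α)) {a b : α} (hbl : b ∈ l)
    (hab : l.formPerm b = a) :
    ∃ l' : List α, l'.Perm l ∧ l'.head? = some a ∧ l'.getLast? = some b ∧
      l'.IsChain fun x y => S x y ∧ s(x, y) ≠ s(b, a) := by
  have hal : a ∈ l := by rw [← hab]; exact List.formPerm_apply_mem_of_mem hbl
  obtain ⟨p, q, rfl⟩ := List.append_of_mem hal
  have hrot : (p ++ a :: q) ~r (a :: (q ++ p)) := by
    have := List.isRotated_append (l := p) (l' := a :: q)
    simpa using this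
  have hperm : (a :: (q ++ p)).Perm (p ++ a :: q) := hrot.perm.symm
  have hl' : (a :: (q ++ p)).Nodup := hperm.nodup_iff.2 hl
  rw [List.formPerm_eq_of_isRotated hl hrot] at hab
  rw [Cycle.coe_eq_coe.2 hrot, Cycle.chain_coe_cons] at hc
  set m := a :: (q ++ p) with hm
  have hmn : m ≠ [] := List.cons_ne_nil _ _
  have hlast : m.getLast hmn = b := by
    have h : m.formPerm (m.getLast hmn) = a := List.formPerm_apply_getLast a (q ++ p)
    exact m.formPerm.injective (h.trans hab.symm)
  have hlen : m.length = (p ++ a :: q).length := hperm.length_eq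
  have hpos : 0 < m.length := List.length_pos_of_ne_nil hmn
  have hb : m[m.length - 1] = b := by rw [← hlast, List.getLast_eq_getElem]
  have ha : m[0] = a := by simp [hm]
  have hc' : m.IsChain S := by
    rw [← List.cons_append, List.isChain_append] at hc
    exact hc.1
  refine ⟨m, hperm, rfl, by rw [List.getLast?_eq_getLast_of_ne_nil hmn, hlast], ?_⟩
  rw [List.isChain_iff_getElem] at hc' ⊢
  intro i hi
  refine ⟨hc' i hi, fun h => ?_⟩
  rw [Sym2.eq_iff] at h
  rcases h with ⟨-, h⟩ | ⟨h, h'⟩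
  · rw [← ha, hl'.getElem_inj_iff] at h
    omega
  · rw [← ha, hl'.getElem_inj_iff] at h
    rw [← hb, hl'.getElem_inj_iff] at h'
    omega

theorem exists_path_of_adjacent [DecidableEq α] (hS : ∀ x y, S x y → S y x) {l : List α}
    (hl : l.Nodup) (h3 : 3 ≤ l.length) (hc : Cycle.Chain S (l : Cycle α)) {a b : α} (hal : a ∈ l)
    (hbl : b ∈ l) (hab : l.formPerm b = a ∨ l.formPerm a = b) :
    ∃ l' : List α, l'.Perm l ∧ l'.head? = some a ∧ l'.getLast? = some b ∧
      l'.IsChain fun x y => S x y ∧ s(x, y) ≠ s(b, a) := by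
  rcases hab with hab | hab
  · exact exists_path_of_next hl h3 hc hbl hab
  · obtain ⟨l', h₁, h₂, h₃, h₄⟩ := exists_path_of_next hl h3 hc hal hab
    refine ⟨l'.reverse, (List.reverse_perm _).trans h₁, by rw [List.head?_reverse, h₃],
      by rw [List.getLast?_reverse, h₂], ?_⟩
    rw [List.isChain_reverse]
    refine h₄.imp fun x y h => ⟨hS _ _ h.1, ?_⟩
    rw [Sym2.eq_swap, Sym2.eq_swap (a := b)]
    exact h.2

end Moves

section Options
open Finset

theorem exists_median_split {I J : Finset ℕ} {m n : ℕ} (hI : I ⊆ range n) (hIm : 2 * m ≤ I.card)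
    (hJm : 2 * m ≤ J.card) :
    ∃ k, (m ≤ (I.filter (· < k)).card ∧ m ≤ (J.filter (k ≤ ·)).card) ∨
      (m ≤ (J.filter (· < k)).card ∧ m ≤ (I.filter (k ≤ ·)).card) := by
  have hex : ∃ k, m ≤ (I.filter (· < k)).card := ⟨n, by
    rw [filter_true_of_mem fun i hi => mem_range.1 (hI hi)]; omega⟩
  classical
  set k := Nat.find hex with hk
  have h₁ : m ≤ (I.filter (· < k)).card := Nat.find_spec hex
  have h₂ : (I.filter (· < k)).card ≤ m := by
    by_cases h0 : k = 0
    · simp [h0]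
    have hmin := Nat.find_min hex (m := k - 1) (by omega)
    have hsub : I.filter (· < k) ⊆ insert (k - 1) (I.filter (· < k - 1)) := by
      intro i hi
      simp only [mem_filter, mem_insert] at hi ⊢
      rcases eq_or_ne i (k - 1) with h | h
      · exact Or.inl h
      · exact Or.inr ⟨hi.1, by omega⟩
    have := (card_le_card hsub).trans (card_insert_le _ _)
    omega
  have hJ := card_filter_add_card_filter_not (s := J) (· < k)
  have hI' := card_filter_add_card_filter_not (s := I) (· < k)
  simp only [not_lt] at hJ hI'
  refine ⟨k, ?_⟩
  by_cases h : m ≤ (J.filter (k ≤ ·)).card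
  · exact Or.inl ⟨h₁, h⟩
  · right; constructor <;> omega

variable {V : Type*} [DecidableEq V]

theorem card_exchange_pairs (H : SimpleGraph V) [DecidableRel H.Adj] {f : ℕ → V} {n m k : ℕ}
    (hf : Set.InjOn f (range n)) {p β : ℝ} (hp : 0 ≤ p)
    (hdisc : ∀ X Y : Finset V, p * X.card * Y.card - β * n ^ 2 ≤
      ((X ×ˢ Y).filter fun q => H.Adj q.1 q.2).card) {A B : Finset V} (hm : 1 ≤ m)
    (hA : m ≤ (((range n).filter fun i => f i ∈ A).filter (· < k)).card)
    (hB : m ≤ (((range n).filter fun i => f i ∈ B).filter (k ≤ ·)).card) :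
    ∃ O : Finset (ℕ × ℕ), (∀ o ∈ O, 0 < o.1 ∧ o.1 ≤ o.2 ∧ o.2 + 1 < n ∧
      H.Adj (f (o.1 - 1)) (f (o.2 + 1)) ∧ f o.1 ∈ A ∧ f o.2 ∈ B) ∧
      p * ((m : ℝ) - 1) ^ 2 - β * n ^ 2 ≤ O.card := by
  set X := ((((range n).filter fun i => f i ∈ A).filter (· < k)).erase 0) with hX
  set Y := ((((range n).filter fun i => f i ∈ B).filter (k ≤ ·)).erase (n - 1)) with hY
  have hXc : (m : ℝ) - 1 ≤ X.card := by
    have h1 : m - 1 ≤ X.card := (Nat.sub_le_sub_right hA 1).trans pred_card_le_card_erase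
    have : (m : ℝ) ≤ X.card + 1 := by exact_mod_cast (by omega : m ≤ X.card + 1)
    linarith
  have hYc : (m : ℝ) - 1 ≤ Y.card := by
    have h1 : m - 1 ≤ Y.card := (Nat.sub_le_sub_right hB 1).trans pred_card_le_card_erase
    have : (m : ℝ) ≤ Y.card + 1 := by exact_mod_cast (by omega : m ≤ Y.card + 1)
    linarith
  have hXm : ∀ i ∈ X, 0 < i ∧ i < k ∧ i < n ∧ f i ∈ A := by
    intro i hi
    simp only [hX, mem_erase, mem_filter, mem_range] at hi
    exact ⟨by omega, hi.2.2, hi.2.1.1, hi.2.1.2⟩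
  have hYm : ∀ i ∈ Y, k ≤ i ∧ i + 1 < n ∧ f i ∈ B := by
    intro i hi
    simp only [hY, mem_erase, mem_filter, mem_range] at hi
    exact ⟨hi.2.2, by omega, hi.2.1.2⟩
  have hXi : Set.InjOn (fun i => f (i - 1)) X := by
    intro i hi j hj h
    have h1 := hXm i hi
    have h2 := hXm j hj
    have := hf (by simp; omega) (by simp; omega) h
    omega
  have hYi : Set.InjOn (fun i => f (i + 1)) Y := by
    intro i hi j hj h
    have h1 := hYm i hi
    have h2 := hYm j hj
    have := hf (by simp; omega) (by simp; omega) h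
    omega
  refine ⟨(X ×ˢ Y).filter fun o => H.Adj (f (o.1 - 1)) (f (o.2 + 1)), ?_, ?_⟩
  · intro o ho
    simp only [mem_filter, mem_product] at ho
    obtain ⟨h1, h2, h3, h4⟩ := hXm _ ho.1.1
    obtain ⟨h5, h6, h7⟩ := hYm _ ho.1.2
    exact ⟨h1, by omega, h6, ho.2, h4, h7⟩
  · have h := hdisc (X.image fun i => f (i - 1)) (Y.image fun i => f (i + 1))
    rw [card_image_of_injOn hXi, card_image_of_injOn hYi] at h
    have hle : (((X.image fun i => f (i - 1)) ×ˢ (Y.image fun i => f (i + 1))).filter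
        fun q => H.Adj q.1 q.2).card ≤
        ((X ×ˢ Y).filter fun o => H.Adj (f (o.1 - 1)) (f (o.2 + 1))).card := by
      refine card_le_card_of_surjOn (fun o => (f (o.1 - 1), f (o.2 + 1))) ?_
      rintro ⟨x, y⟩ hq
      simp only [coe_filter, mem_product, mem_image, Set.mem_ofPred_eq] at hq
      obtain ⟨⟨⟨i, hi, rfl⟩, ⟨j, hj, rfl⟩⟩, hq⟩ := hq
      exact ⟨(i, j), by simp [hi, hj, hq], rfl⟩
    have hm' : (0 : ℝ) ≤ m - 1 := by
      have : (1 : ℝ) ≤ m := by exact_mod_cast hm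
      linarith
    have : p * ((m : ℝ) - 1) ^ 2 ≤ p * X.card * Y.card := by
      rw [sq, mul_assoc]
      gcongr
    have h' : (_ : ℝ) ≤ _ := Nat.cast_le.2 hle
    linarith

theorem exists_exchange_pairs (H : SimpleGraph V) [DecidableRel H.Adj] {f : ℕ → V} {n m : ℕ}
    (hf : Set.InjOn f (range n)) (hs : ∀ v, ∃ i < n, f i = v) {p β : ℝ} (hp : 0 ≤ p)
    (hdisc : ∀ X Y : Finset V, p * X.card * Y.card - β * n ^ 2 ≤
      ((X ×ˢ Y).filter fun q => H.Adj q.1 q.2).card) {A B : Finset V} (hm : 1 ≤ m)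
    (hA : 2 * m ≤ A.card) (hB : 2 * m ≤ B.card) :
    ∃ O : Finset (ℕ × ℕ), ((∀ o ∈ O, 0 < o.1 ∧ o.1 ≤ o.2 ∧ o.2 + 1 < n ∧
      H.Adj (f (o.1 - 1)) (f (o.2 + 1)) ∧ f o.1 ∈ A ∧ f o.2 ∈ B) ∨
      (∀ o ∈ O, 0 < o.1 ∧ o.1 ≤ o.2 ∧ o.2 + 1 < n ∧
      H.Adj (f (o.1 - 1)) (f (o.2 + 1)) ∧ f o.1 ∈ B ∧ f o.2 ∈ A)) ∧
      p * ((m : ℝ) - 1) ^ 2 - β * n ^ 2 ≤ O.card := by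
  have hcard : ∀ S : Finset V, S.card ≤ ((range n).filter fun i => f i ∈ S).card := by
    intro S
    refine card_le_card_of_surjOn f fun v hv => ?_
    obtain ⟨i, hi, rfl⟩ := hs v
    exact ⟨i, by simpa [hi] using hv, rfl⟩
  obtain ⟨k, hk | hk⟩ := exists_median_split (filter_subset _ _) (hA.trans (hcard A))
    (hB.trans (hcard B))
  · obtain ⟨O, h1, h2⟩ := card_exchange_pairs H hf hp hdisc hm hk.1 hk.2
    exact ⟨O, Or.inl h1, h2⟩
  · obtain ⟨O, h1, h2⟩ := card_exchange_pairs H hf hp hdisc hm hk.1 hk.2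
    exact ⟨O, Or.inr h1, h2⟩

/-- One step of the method of conditional expectations for an exponential potential. -/
theorem exists_le_potential {ι α : Type*} [Fintype α] {O : Finset ι} (hO : O.Nonempty)
    {Δ : ι → α → ℝ} {w m : α → ℝ} {lam : ℝ} (hlam : 0 ≤ lam) (hw : ∀ v, 0 ≤ w v)
    (hΔ0 : ∀ o ∈ O, ∀ v, 0 ≤ Δ o v) (hΔ1 : ∀ o ∈ O, ∀ v, lam * Δ o v ≤ 1)
    (hm : ∀ v, ∑ o ∈ O, Δ o v ≤ O.card * m v) :
    ∃ o ∈ O, ∑ v, w v * Real.exp (lam * Δ o v) ≤ ∑ v, w v * Real.exp (2 * lam * m v) := by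
  refine exists_le_of_sum_le hO ?_
  rw [sum_comm, sum_const, nsmul_eq_mul, mul_sum]
  refine sum_le_sum fun v _ => ?_
  rw [← mul_sum, mul_left_comm]
  refine mul_le_mul_of_nonneg_left ?_ (hw v)
  have hexp : ∀ x : ℝ, 0 ≤ x → x ≤ 1 → Real.exp x ≤ 1 + 2 * x := by
    intro x h0 h1
    have h := Real.abs_exp_sub_one_le (x := x) (by rw [abs_of_nonneg h0]; exact h1)
    rw [abs_of_nonneg h0] at h
    linarith [(abs_le.1 h).2]
  calc ∑ o ∈ O, Real.exp (lam * Δ o v) ≤ ∑ o ∈ O, (1 + 2 * (lam * Δ o v)) :=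
        sum_le_sum fun o ho => hexp _ (mul_nonneg hlam (hΔ0 o ho v)) (hΔ1 o ho v)
    _ = O.card + 2 * lam * ∑ o ∈ O, Δ o v := by
        rw [sum_add_distrib, mul_sum]; simp [mul_assoc]
    _ ≤ O.card + 2 * lam * (O.card * m v) := by
        have := hm v
        gcongr
    _ = O.card * (2 * lam * m v + 1) := by ring
    _ ≤ _ := by
        gcongr
        exact Real.add_one_le_exp _

end Options

section GoodOptions
open Finset
variable {V : Type*} [Fintype V] (H : SimpleGraph V) [DecidableRel H.Adj]
  (φ : Sym2 V → ℕ)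

/-- The number of edges of colour `c` at `v`. -/
def colDeg (c : ℕ) (v : V) : ℕ := (univ.filter fun u => H.Adj v u ∧ φ s(v, u) = c).card

/-- The number of pairs of edges of the same colour, one at `u` and one at `v`. -/
def coMono (u v : V) : ℕ := ∑ x with H.Adj u x, colDeg H φ (φ s(u, x)) v

theorem colDeg_eq_sum (c : ℕ) (v : V) :
    colDeg H φ c v = ∑ x with H.Adj v x, if c = φ s(v, x) then 1 else 0 := by
  rw [colDeg, ← filter_filter, card_filter]
  simp only [eq_comm]

theorem coMono_comm (u v : V) : coMono H φ u v = coMono H φ v u := by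
  simp only [coMono, colDeg_eq_sum]
  rw [sum_comm]
  simp only [eq_comm]

theorem sum_coMono_le {A : Finset V} {b : ℕ} {v : V} (hA : ∀ c, ∑ u ∈ A, colDeg H φ c u ≤ b) :
    ∑ u ∈ A, coMono H φ u v ≤ Fintype.card V * b := by
  rw [sum_congr rfl fun u _ => coMono_comm H φ u v]
  unfold coMono
  rw [sum_comm]
  refine (sum_le_card_nsmul _ _ _ fun x _ => hA _).trans ?_
  rw [smul_eq_mul]
  exact Nat.mul_le_mul_right _ (card_le_univ _)

theorem sum_adj_colDeg_le {b : ℕ} (v : V)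
    (hc : ∀ c, (univ.filter fun q : V × V => H.Adj q.1 q.2 ∧ φ s(q.1, q.2) = c).card ≤ b) :
    ∑ q : V × V with H.Adj q.1 q.2, colDeg H φ (φ s(q.1, q.2)) v ≤ Fintype.card V * b := by
  simp only [colDeg_eq_sum]
  rw [sum_comm]
  refine (sum_le_card_nsmul _ _ b fun x _ => ?_).trans ?_
  · rw [← card_filter, filter_filter]
    exact hc _
  · rw [smul_eq_mul]
    exact Nat.mul_le_mul_right _ (card_le_univ _)

theorem card_union_seven_le {ι : Type*} [DecidableEq ι] (S₁ S₂ S₃ S₄ S₅ S₆ S₇ : Finset ι) :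
    (S₁ ∪ S₂ ∪ S₃ ∪ S₄ ∪ S₅ ∪ S₆ ∪ S₇).card ≤
      S₁.card + S₂.card + S₃.card + S₄.card + S₅.card + S₆.card + S₇.card := by
  have h₁ := card_union_le S₁ S₂
  have h₂ := card_union_le (S₁ ∪ S₂) S₃
  have h₃ := card_union_le (S₁ ∪ S₂ ∪ S₃) S₄
  have h₄ := card_union_le (S₁ ∪ S₂ ∪ S₃ ∪ S₄) S₅
  have h₅ := card_union_le (S₁ ∪ S₂ ∪ S₃ ∪ S₄ ∪ S₅) S₆
  have h₆ := card_union_le (S₁ ∪ S₂ ∪ S₃ ∪ S₄ ∪ S₅ ∪ S₆) S₇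
  omega

variable [DecidableEq V] {n : ℕ} {f : ℕ → V}

theorem card_le_of_fst_fibers {S : Finset (ℕ × ℕ)} {b : ℝ} (hS : ∀ o ∈ S, o.1 < n)
    (h : ∀ i < n, ((S.filter fun o => o.1 = i).card : ℝ) ≤ b) : (S.card : ℝ) ≤ b * n := by
  rw [card_eq_sum_card_fiberwise (f := Prod.fst) (t := range n) fun o ho => by simpa using hS o ho]
  push_cast
  refine (sum_le_card_nsmul _ _ b fun i hi => h i (mem_range.1 hi)).trans ?_
  simp [mul_comm]

theorem card_le_of_snd_fibers {S : Finset (ℕ × ℕ)} {b : ℝ} (hS : ∀ o ∈ S, o.2 < n)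
    (h : ∀ i < n, ((S.filter fun o => o.2 = i).card : ℝ) ≤ b) : (S.card : ℝ) ≤ b * n := by
  rw [card_eq_sum_card_fiberwise (f := Prod.snd) (t := range n) fun o ho => by simpa using hS o ho]
  push_cast
  refine (sum_le_card_nsmul _ _ b fun i hi => h i (mem_range.1 hi)).trans ?_
  simp [mul_comm]

/-- An exchange that avoids the used edges `U`, the saturated vertices and the used colours, and
whose three new edges have distinct colours. -/
def GoodExchange (f : ℕ → V) (P Q : V) (U : Finset (Sym2 V)) (Sat : Finset V) (C : Finset ℕ)
    (o : ℕ × ℕ) : Prop :=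
  s(f (o.1 - 1), f (o.2 + 1)) ∉ U ∧ f (o.1 - 1) ∉ Sat ∧ f (o.2 + 1) ∉ Sat ∧
    φ s(f (o.1 - 1), f (o.2 + 1)) ∉ C ∧ φ s(f (o.1 - 1), f (o.2 + 1)) ≠ φ s(P, f o.1) ∧
    φ s(f (o.1 - 1), f (o.2 + 1)) ≠ φ s(Q, f o.2) ∧ φ s(P, f o.1) ≠ φ s(Q, f o.2)

instance (f : ℕ → V) (P Q : V) (U : Finset (Sym2 V)) (Sat : Finset V) (C : Finset ℕ) :
    DecidablePred (GoodExchange φ f P Q U Sat C) := fun o => by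
  unfold GoodExchange
  infer_instance

theorem card_good_exchange (hf : Set.InjOn f (range n)) {P Q : V} {O : Finset (ℕ × ℕ)}
    (hO : ∀ o ∈ O, 0 < o.1 ∧ o.1 ≤ o.2 ∧ o.2 + 1 < n ∧ H.Adj (f (o.1 - 1)) (f (o.2 + 1)) ∧
      H.Adj P (f o.1) ∧ H.Adj Q (f o.2)) {U : Finset (Sym2 V)} {Sat : Finset V} {C : Finset ℕ}
    {b ℓ : ℝ} (hU : ∀ v, ((univ.filter fun w => H.Adj v w ∧ s(v, w) ∈ U).card : ℝ) ≤ b)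
    (hSat : (Sat.card : ℝ) ≤ b)
    (hC : ∀ v, ((univ.filter fun w => H.Adj v w ∧ φ s(v, w) ∈ C).card : ℝ) ≤ b)
    (hℓ : ∀ c v, (colDeg H φ c v : ℝ) ≤ ℓ) :
    (O.card : ℝ) - (4 * b + 3 * ℓ) * n ≤ (O.filter (GoodExchange φ f P Q U Sat C)).card := by
  have fst_fiber : ∀ (p : ℕ × ℕ → Prop) [DecidablePred p] (i : ℕ) (S : Finset V),
      (∀ o ∈ O, p o → o.1 = i → f (o.2 + 1) ∈ S) →
      ((((O.filter p).filter fun o => o.1 = i).card : ℕ) : ℝ) ≤ S.card := by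
    intro p _ i S h
    refine Nat.cast_le.2 (card_le_card_of_injOn (fun o => f (o.2 + 1)) ?_ ?_)
    · intro o ho
      simp only [coe_filter, mem_filter, Set.mem_ofPred_eq] at ho
      exact h o ho.1.1 ho.1.2 ho.2
    · intro o ho o' ho' he
      simp only [coe_filter, mem_filter, Set.mem_ofPred_eq] at ho ho'
      have h1 := hO o ho.1.1
      have h2 := hO o' ho'.1.1
      have := hf (by simp; omega) (by simp; omega) he
      exact Prod.ext (ho.2.trans ho'.2.symm) (by omega)
  have fst_fiber' : ∀ (p : ℕ × ℕ → Prop) [DecidablePred p] (i : ℕ) (S : Finset V),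
      (∀ o ∈ O, p o → o.1 = i → f o.2 ∈ S) →
      ((((O.filter p).filter fun o => o.1 = i).card : ℕ) : ℝ) ≤ S.card := by
    intro p _ i S h
    refine Nat.cast_le.2 (card_le_card_of_injOn (fun o => f o.2) ?_ ?_)
    · intro o ho
      simp only [coe_filter, mem_filter, Set.mem_ofPred_eq] at ho
      exact h o ho.1.1 ho.1.2 ho.2
    · intro o ho o' ho' he
      simp only [coe_filter, mem_filter, Set.mem_ofPred_eq] at ho ho'
      have h1 := hO o ho.1.1
      have h2 := hO o' ho'.1.1
      have := hf (by simp; omega) (by simp; omega) he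
      exact Prod.ext (ho.2.trans ho'.2.symm) (by omega)
  have snd_fiber : ∀ (p : ℕ × ℕ → Prop) [DecidablePred p] (i : ℕ) (S : Finset V),
      (∀ o ∈ O, p o → o.2 = i → f (o.1 - 1) ∈ S) →
      ((((O.filter p).filter fun o => o.2 = i).card : ℕ) : ℝ) ≤ S.card := by
    intro p _ i S h
    refine Nat.cast_le.2 (card_le_card_of_injOn (fun o => f (o.1 - 1)) ?_ ?_)
    · intro o ho
      simp only [coe_filter, mem_filter, Set.mem_ofPred_eq] at ho
      exact h o ho.1.1 ho.1.2 ho.2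
    · intro o ho o' ho' he
      simp only [coe_filter, mem_filter, Set.mem_ofPred_eq] at ho ho'
      have h1 := hO o ho.1.1
      have h2 := hO o' ho'.1.1
      have := hf (by simp; omega) (by simp; omega) he
      exact Prod.ext (by omega) (ho.2.trans ho'.2.symm)
  have fst_lt : ∀ (p : ℕ × ℕ → Prop) [DecidablePred p], ∀ o ∈ O.filter p, o.1 < n := fun p _ o ho => by
    have := hO o (mem_filter.1 ho).1
    omega
  have snd_lt : ∀ (p : ℕ × ℕ → Prop) [DecidablePred p], ∀ o ∈ O.filter p, o.2 < n := fun p _ o ho => by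
    have := hO o (mem_filter.1 ho).1
    omega
  have b₁ : ((O.filter fun o => s(f (o.1 - 1), f (o.2 + 1)) ∈ U).card : ℝ) ≤ b * n :=
    card_le_of_fst_fibers (fst_lt _) fun i _ => (fst_fiber _ i _ fun o ho hp hi => by
      subst hi; simp only [mem_filter, mem_univ, true_and]
      exact ⟨(hO o ho).2.2.2.1, hp⟩).trans (hU (f (i - 1)))
  have b₂ : ((O.filter fun o => f (o.1 - 1) ∈ Sat).card : ℝ) ≤ b * n :=
    card_le_of_snd_fibers (snd_lt _) fun i _ => (snd_fiber _ i Sat fun o ho hp hi => hp).trans hSat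
  have b₃ : ((O.filter fun o => f (o.2 + 1) ∈ Sat).card : ℝ) ≤ b * n :=
    card_le_of_fst_fibers (fst_lt _) fun i _ => (fst_fiber _ i Sat fun o ho hp hi => hp).trans hSat
  have b₄ : ((O.filter fun o => φ s(f (o.1 - 1), f (o.2 + 1)) ∈ C).card : ℝ) ≤ b * n :=
    card_le_of_fst_fibers (fst_lt _) fun i _ => (fst_fiber _ i _ fun o ho hp hi => by
      subst hi; simp only [mem_filter, mem_univ, true_and]
      exact ⟨(hO o ho).2.2.2.1, hp⟩).trans (hC (f (i - 1)))
  have b₅ : ((O.filter fun o => φ s(f (o.1 - 1), f (o.2 + 1)) = φ s(P, f o.1)).card : ℝ) ≤ ℓ * n :=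
    card_le_of_fst_fibers (fst_lt _) fun i _ => (fst_fiber _ i _ fun o ho hp hi => by
      subst hi; simp only [mem_filter, mem_univ, true_and]
      exact ⟨(hO o ho).2.2.2.1, hp⟩).trans (hℓ (φ s(P, f i)) (f (i - 1)))
  have b₆ : ((O.filter fun o => φ s(f (o.1 - 1), f (o.2 + 1)) = φ s(Q, f o.2)).card : ℝ) ≤ ℓ * n :=
    card_le_of_snd_fibers (snd_lt _) fun i _ => (snd_fiber _ i _ fun o ho hp hi => by
      subst hi; simp only [mem_filter, mem_univ, true_and]
      rw [Sym2.eq_swap] at hp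
      exact ⟨(hO o ho).2.2.2.1.symm, hp⟩).trans (hℓ (φ s(Q, f i)) (f (i + 1)))
  have b₇ : ((O.filter fun o => φ s(P, f o.1) = φ s(Q, f o.2)).card : ℝ) ≤ ℓ * n :=
    card_le_of_fst_fibers (fst_lt _) fun i _ => (fst_fiber' _ i _ fun o ho hp hi => by
      subst hi; simp only [mem_filter, mem_univ, true_and]
      exact ⟨(hO o ho).2.2.2.2.2, hp.symm⟩).trans (hℓ (φ s(P, f i)) Q)
  have hsplit := card_filter_add_card_filter_not (s := O) (GoodExchange φ f P Q U Sat C)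
  have hcover : (O.filter fun o => ¬ GoodExchange φ f P Q U Sat C o) ⊆ _ ∪ _ ∪ _ ∪ _ ∪ _ ∪ _ ∪ _ :=
    fun o ho => by
      have h : o ∈ (O.filter fun o => s(f (o.1 - 1), f (o.2 + 1)) ∈ U) ∪
          (O.filter fun o => f (o.1 - 1) ∈ Sat) ∪ (O.filter fun o => f (o.2 + 1) ∈ Sat) ∪
          (O.filter fun o => φ s(f (o.1 - 1), f (o.2 + 1)) ∈ C) ∪
          (O.filter fun o => φ s(f (o.1 - 1), f (o.2 + 1)) = φ s(P, f o.1)) ∪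
          (O.filter fun o => φ s(f (o.1 - 1), f (o.2 + 1)) = φ s(Q, f o.2)) ∪
          (O.filter fun o => φ s(P, f o.1) = φ s(Q, f o.2)) := by
        rw [mem_filter] at ho
        simp only [mem_union, mem_filter, ho.1, true_and]
        have := ho.2
        unfold GoodExchange at this
        tauto
      exact h
  have hc := (Nat.cast_le (α := ℝ)).2 ((card_le_card hcover).trans
    (card_union_seven_le _ _ _ _ _ _ _))
  have hs := congrArg (Nat.cast (R := ℝ)) hsplit
  push_cast at hc hs
  linarith

theorem sum_exchange_colDeg_le (hf : Set.InjOn f (range n)) (hn : n = Fintype.card V)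
    {P Q : V} {O : Finset (ℕ × ℕ)}
    (hO : ∀ o ∈ O, 0 < o.1 ∧ o.1 ≤ o.2 ∧ o.2 + 1 < n ∧ H.Adj (f (o.1 - 1)) (f (o.2 + 1)) ∧
      H.Adj P (f o.1) ∧ H.Adj Q (f o.2))
    (hc : ∀ c, (univ.filter fun q : V × V => H.Adj q.1 q.2 ∧ φ s(q.1, q.2) = c).card ≤ n) (v : V) :
    ∑ o ∈ O, (colDeg H φ (φ s(P, f o.1)) v + colDeg H φ (φ s(Q, f o.2)) v +
      colDeg H φ (φ s(f (o.1 - 1), f (o.2 + 1))) v) ≤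
      n * (coMono H φ P v + coMono H φ Q v + n) := by
  have hOn : O.image (fun o => (f o.1, f o.2)) ⊆
      (univ.filter fun x => H.Adj P x) ×ˢ (univ.filter fun y => H.Adj Q y) := by
    intro q hq
    obtain ⟨o, ho, rfl⟩ := mem_image.1 hq
    simp [hO o ho]
  have hinj : Set.InjOn (fun o : ℕ × ℕ => (f o.1, f o.2)) O := by
    intro o ho o' ho' he
    have h1 := hO o ho
    have h2 := hO o' ho'
    simp only [Prod.mk.injEq] at he
    exact Prod.ext (hf (by simp; omega) (by simp; omega) he.1)
      (hf (by simp; omega) (by simp; omega) he.2)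
  have hinj' : Set.InjOn (fun o : ℕ × ℕ => (f (o.1 - 1), f (o.2 + 1))) O := by
    intro o ho o' ho' he
    have h1 := hO o ho
    have h2 := hO o' ho'
    simp only [Prod.mk.injEq] at he
    have h3 := hf (by simp; omega) (by simp; omega) he.1
    have h4 := hf (by simp; omega) (by simp; omega) he.2
    exact Prod.ext (by omega) (by omega)
  have hle : ∀ S : Finset V, S.card ≤ n := fun S => by rw [hn]; exact card_le_univ _
  have h₁ : ∑ o ∈ O, colDeg H φ (φ s(P, f o.1)) v ≤ n * coMono H φ P v := by
    rw [← sum_image (f := fun q : V × V => colDeg H φ (φ s(P, q.1)) v) hinj]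
    refine (sum_le_sum_of_subset hOn).trans ?_
    rw [sum_product]
    simp only [sum_const, smul_eq_mul]
    rw [← mul_sum]
    exact Nat.mul_le_mul_right _ (hle _)
  have h₂ : ∑ o ∈ O, colDeg H φ (φ s(Q, f o.2)) v ≤ n * coMono H φ Q v := by
    rw [← sum_image (f := fun q : V × V => colDeg H φ (φ s(Q, q.2)) v) hinj]
    refine (sum_le_sum_of_subset hOn).trans ?_
    rw [sum_product_right]
    simp only [sum_const, smul_eq_mul]
    rw [← mul_sum]
    exact Nat.mul_le_mul_right _ (hle _)
  have h₃ : ∑ o ∈ O, colDeg H φ (φ s(f (o.1 - 1), f (o.2 + 1))) v ≤ n * n := by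
    rw [← sum_image (f := fun q : V × V => colDeg H φ (φ s(q.1, q.2)) v) hinj']
    refine (sum_le_sum_of_subset ?_).trans ((sum_adj_colDeg_le H φ v hc).trans_eq (by rw [hn]))
    intro q hq
    obtain ⟨o, ho, rfl⟩ := mem_image.1 hq
    simp [hO o ho]
  rw [sum_add_distrib, sum_add_distrib]
  linarith

end GoodOptions

section Batch
open Finset
variable {V : Type*} [Fintype V] (H : SimpleGraph V) [DecidableRel H.Adj] (φ : Sym2 V → ℕ)

/-- The expected increase of the load at `v` when the missing edge `q` is replaced. -/
noncomputable def expectedLoad (n : ℕ) (N : ℝ) (q : V × V) (v : V) : ℝ :=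
  (n * (coMono H φ q.1 v + coMono H φ q.2 v + n) : ℕ) / N

variable {H φ} in
theorem expectedLoad_nonneg {n : ℕ} {N : ℝ} (hN : 0 < N) (q : V × V) (v : V) :
    0 ≤ expectedLoad H φ n N q v := by
  unfold expectedLoad
  positivity

/-- The number of pairs formed by an edge of `K` and an edge at `v` of the same colour. -/
def load (K : Finset (Sym2 V)) (v : V) : ℕ := ∑ e ∈ K, colDeg H φ (φ e) v

/-- The invariants of the set `K` of new edges while the missing edges `T` are left. -/
structure NewEdges (n : ℕ) (b lam N : ℝ) (U : Finset (Sym2 V)) (Sat : Finset V) (Ends : Set V)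
    (N₀ : ℕ) (T : Finset (V × V)) (K : Finset (Sym2 V)) : Prop where
  mem_edgeSet : ∀ e ∈ K, e ∈ H.edgeSet
  notMem : ∀ e ∈ K, e ∉ U
  injOn : Set.InjOn φ K
  mem_ends : ∀ e ∈ K, ∀ x ∈ e, x ∈ Sat → x ∈ Ends
  card_le : K.card + 3 * T.card ≤ N₀
  potential : ∑ v, Real.exp (lam * (load H φ K v + 2 * ∑ q ∈ T, expectedLoad H φ n N q v)) ≤
    Real.exp (lam * b)

variable {H φ} {n m : ℕ} {p β b ℓ lam N : ℝ} {U : Finset (Sym2 V)} {Sat : Finset V}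
  {Ends : Set V} {N₀ : ℕ} {T : Finset (V × V)} {K : Finset (Sym2 V)}

theorem NewEdges.load_le (h : NewEdges H φ n b lam N U Sat Ends N₀ T K) (hN : 0 < N)
    (hlam : 0 < lam) (v : V) : (load H φ K v : ℝ) ≤ b := by
  have h1 := (single_le_sum (fun v _ => (Real.exp_pos _).le) (mem_univ v)).trans h.potential
  rw [Real.exp_le_exp] at h1
  have h2 := le_of_mul_le_mul_left h1 hlam
  have h3 : 0 ≤ ∑ q ∈ T, expectedLoad H φ n N q v :=
    sum_nonneg fun q _ => expectedLoad_nonneg hN q v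
  linarith

theorem NewEdges.mono (h : NewEdges H φ n b lam N U Sat Ends N₀ T K) (hN : 0 < N)
    (hlam : 0 < lam) {T' : Finset (V × V)} (hT : T' ⊆ T) :
    NewEdges H φ n b lam N U Sat Ends N₀ T' K where
  mem_edgeSet := h.mem_edgeSet
  notMem := h.notMem
  injOn := h.injOn
  mem_ends := h.mem_ends
  card_le := le_trans (by have := card_le_card hT; omega) h.card_le
  potential := by
    refine le_trans (sum_le_sum fun v _ => ?_) h.potential
    have := sum_le_sum_of_subset_of_nonneg hT fun q _ _ =>
      expectedLoad_nonneg (H := H) (φ := φ) (n := n) hN q v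
    gcongr

variable [DecidableEq V]

variable (H φ) in
/-- The neighbours that may be used by an edge replacing a missing edge at `v`. -/
def freeNbrs (U K : Finset (Sym2 V)) (Sat : Finset V) (v : V) : Finset V :=
  univ.filter fun w => H.Adj v w ∧ s(v, w) ∉ U ∧ φ s(v, w) ∉ K.image φ ∧ w ∉ Sat

variable (H φ) in
/-- Standing assumptions for replacing the missing edges of one cyclic order by edges of `H`. -/
structure BatchSetup (n m : ℕ) (p β b ℓ lam N : ℝ) (U : Finset (Sym2 V)) (Sat : Finset V) :
    Prop where
  card_eq : n = Fintype.card V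
  three_le : 3 ≤ n
  p_nonneg : 0 ≤ p
  disc : ∀ X Y : Finset V, p * X.card * Y.card - β * n ^ 2 ≤
    ((X ×ˢ Y).filter fun q => H.Adj q.1 q.2).card
  one_le : 1 ≤ m
  le_deg : ∀ v, 2 * m + 3 * b ≤ (univ.filter fun w => H.Adj v w).card
  N_pos : 0 < N
  N_le : N ≤ p * ((m : ℝ) - 1) ^ 2 - β * n ^ 2 - (4 * b + 3 * ℓ) * n
  colDeg_le : ∀ c v, (colDeg H φ c v : ℝ) ≤ ℓ
  used_le : ∀ v, ((univ.filter fun w => H.Adj v w ∧ s(v, w) ∈ U).card : ℝ) ≤ b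
  sat_le : (Sat.card : ℝ) ≤ b
  class_le : ∀ c, (univ.filter fun q : V × V => H.Adj q.1 q.2 ∧ φ s(q.1, q.2) = c).card ≤ n
  lam_pos : 0 < lam
  lam_mul_le : lam * (3 * ℓ) ≤ 1

/-- Two vertices that may be consecutive: joined by `S`, by a new edge in `K`, or by a missing
edge in `T`. -/
def BatchRel (S : V → V → Prop) (K : Finset (Sym2 V)) (T : Finset (V × V)) (x y : V) : Prop :=
  S x y ∨ s(x, y) ∈ K ∨ ∃ q ∈ T, s(x, y) = s(q.1, q.2)

theorem card_colour_mem_le_load (K : Finset (Sym2 V)) (v : V) :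
    (univ.filter fun w => H.Adj v w ∧ φ s(v, w) ∈ K.image φ).card ≤ load H φ K v := by
  refine (card_le_card (t := K.biUnion fun e => univ.filter fun w => H.Adj v w ∧ φ s(v, w) = φ e)
    ?_).trans card_biUnion_le
  intro w hw
  simp only [mem_filter, mem_univ, true_and, mem_image, mem_biUnion] at hw ⊢
  obtain ⟨h1, e, he, h2⟩ := hw
  exact ⟨e, he, h1, h2.symm⟩

theorem two_mul_le_card_freeNbrs (hs : BatchSetup H φ n m p β b ℓ lam N U Sat)
    (h : NewEdges H φ n b lam N U Sat Ends N₀ T K) (v : V) :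
    2 * m ≤ (freeNbrs H φ U K Sat v).card := by
  have hcover : (univ.filter fun w => H.Adj v w) ⊆ freeNbrs H φ U K Sat v ∪
      (univ.filter fun w => H.Adj v w ∧ s(v, w) ∈ U) ∪
      (univ.filter fun w => H.Adj v w ∧ φ s(v, w) ∈ K.image φ) ∪ Sat := by
    intro w hw
    simp only [mem_filter, mem_univ, true_and, mem_union, freeNbrs] at hw ⊢
    tauto
  have hc := (card_le_card hcover).trans ((card_union_le _ _).trans (add_le_add_left
    ((card_union_le _ _).trans (add_le_add_left (card_union_le _ _) _)) _))
  have hc' := (Nat.cast_le (α := ℝ)).2 hc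
  have h1 := hs.le_deg v
  have h2 := hs.used_le v
  have h3 := hs.sat_le
  have h4 := ((Nat.cast_le (α := ℝ)).2 (card_colour_mem_le_load (H := H) (φ := φ) K v)).trans
    (h.load_le hs.N_pos hs.lam_pos v)
  push_cast at hc'
  have : ((2 * m : ℕ) : ℝ) ≤ (freeNbrs H φ U K Sat v).card := by
    push_cast
    linarith
  exact_mod_cast this

theorem exists_new_edges (hs : BatchSetup H φ n m p β b ℓ lam N U Sat)
    (h : NewEdges H φ n b lam N U Sat Ends N₀ T K) {q : V × V} (hq : q ∈ T) (h1 : q.1 ∈ Ends)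
    (h2 : q.2 ∈ Ends) {P Q : V} (hPQ : (P = q.1 ∧ Q = q.2) ∨ (P = q.2 ∧ Q = q.1)) {f : ℕ → V}
    (hf : Set.InjOn f (range n)) {O : Finset (ℕ × ℕ)}
    (hO : ∀ o ∈ O, 0 < o.1 ∧ o.1 ≤ o.2 ∧ o.2 + 1 < n ∧ H.Adj (f (o.1 - 1)) (f (o.2 + 1)) ∧
      f o.1 ∈ freeNbrs H φ U K Sat P ∧ f o.2 ∈ freeNbrs H φ U K Sat Q)
    (hcard : p * ((m : ℝ) - 1) ^ 2 - β * n ^ 2 ≤ O.card) :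
    ∃ o ∈ O, NewEdges H φ n b lam N U Sat Ends N₀ (T.erase q)
      (insert s(P, f o.1) (insert s(Q, f o.2) (insert s(f (o.1 - 1), f (o.2 + 1)) K))) := by
  have hO' : ∀ o ∈ O, 0 < o.1 ∧ o.1 ≤ o.2 ∧ o.2 + 1 < n ∧ H.Adj (f (o.1 - 1)) (f (o.2 + 1)) ∧
      H.Adj P (f o.1) ∧ H.Adj Q (f o.2) := by
    intro o ho
    obtain ⟨i1, i2, i3, i4, i5, i6⟩ := hO o ho
    exact ⟨i1, i2, i3, i4, (mem_filter.1 i5).2.1, (mem_filter.1 i6).2.1⟩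
  have hload : ∀ v, ((univ.filter fun w => H.Adj v w ∧ φ s(v, w) ∈ K.image φ).card : ℝ) ≤ b :=
    fun v => ((Nat.cast_le (α := ℝ)).2 (card_colour_mem_le_load K v)).trans
      (h.load_le hs.N_pos hs.lam_pos v)
  have hG := card_good_exchange H φ hf hO' hs.used_le hs.sat_le hload hs.colDeg_le
  set G := O.filter (GoodExchange φ f P Q U Sat (K.image φ)) with hGdef
  have hGO : ∀ o ∈ G, o ∈ O := fun o ho => (mem_filter.1 ho).1
  have hGN : N ≤ G.card := by linarith [hs.N_le]
  have hGne : G.Nonempty := by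
    rw [← card_pos]
    exact_mod_cast hs.N_pos.trans_le hGN
  set Δ : ℕ × ℕ → V → ℕ := fun o v => colDeg H φ (φ s(P, f o.1)) v + colDeg H φ (φ s(Q, f o.2)) v +
      colDeg H φ (φ s(f (o.1 - 1), f (o.2 + 1))) v with hΔ
  have hΔsum : ∀ v, ∑ o ∈ G, (Δ o v : ℝ) ≤ G.card * expectedLoad H φ n N q v := by
    intro v
    have h3 := sum_exchange_colDeg_le H φ hf hs.card_eq (fun o ho => hO' o (hGO o ho)) hs.class_le v
    have h4 : coMono H φ P v + coMono H φ Q v + n = coMono H φ q.1 v + coMono H φ q.2 v + n := by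
      rcases hPQ with ⟨rfl, rfl⟩ | ⟨rfl, rfl⟩
      · rfl
      · omega
    rw [h4] at h3
    have h5 := (Nat.cast_le (α := ℝ)).2 h3
    rw [Nat.cast_sum] at h5
    refine h5.trans ?_
    rw [expectedLoad, mul_div_assoc', le_div_iff₀ hs.N_pos, mul_comm (G.card : ℝ)]
    gcongr
  obtain ⟨o, ho, hpot⟩ := exists_le_potential (lam := lam) (Δ := fun o v => (Δ o v : ℝ))
    (w := fun v => Real.exp (lam * (load H φ K v + 2 * ∑ q ∈ T.erase q, expectedLoad H φ n N q v)))
    hGne hs.lam_pos.le (fun v => (Real.exp_pos _).le) (fun o _ v => Nat.cast_nonneg _)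
    (fun o _ v => by
      refine le_trans ?_ hs.lam_mul_le
      have i1 := hs.colDeg_le (φ s(P, f o.1)) v
      have i2 := hs.colDeg_le (φ s(Q, f o.2)) v
      have i3 := hs.colDeg_le (φ s(f (o.1 - 1), f (o.2 + 1))) v
      refine mul_le_mul_of_nonneg_left ?_ hs.lam_pos.le
      simp only [hΔ]
      push_cast
      linarith) hΔsum
  obtain ⟨i1, i2, i3, i4, i5, i6⟩ := hO o (hGO o ho)
  obtain ⟨g1, g2, g3, g4, g5, g6, g7⟩ := (mem_filter.1 ho).2
  obtain ⟨-, p1, p2, p3, p4⟩ := mem_filter.1 i5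
  obtain ⟨-, q1, q2, q3, q4⟩ := mem_filter.1 i6
  have hPE : P ∈ Ends := by rcases hPQ with ⟨rfl, rfl⟩ | ⟨rfl, rfl⟩ <;> assumption
  have hQE : Q ∈ Ends := by rcases hPQ with ⟨rfl, rfl⟩ | ⟨rfl, rfl⟩ <;> assumption
  set e₁ := s(P, f o.1) with he₁
  set e₂ := s(Q, f o.2) with he₂
  set e₃ := s(f (o.1 - 1), f (o.2 + 1)) with he₃
  have n₃ : e₃ ∉ K := fun h => g4 (mem_image_of_mem φ h)
  have n₂ : e₂ ∉ insert e₃ K := by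
    rw [mem_insert, not_or]
    exact ⟨fun h => g6 (by rw [h]), fun h => q3 (mem_image_of_mem φ h)⟩
  have n₁ : e₁ ∉ insert e₂ (insert e₃ K) := by
    rw [mem_insert, mem_insert, not_or, not_or]
    exact ⟨fun h => g7 (by rw [h]), fun h => g5 (by rw [h]), fun h => p3 (mem_image_of_mem φ h)⟩
  refine ⟨o, hGO o ho, ?_, ?_, ?_, ?_, ?_, ?_⟩
  · simp only [mem_insert, forall_eq_or_imp]
    exact ⟨p1, q1, i4, h.mem_edgeSet⟩
  · simp only [mem_insert, forall_eq_or_imp]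
    exact ⟨p2, q2, g1, h.notMem⟩
  · have c₃ : φ e₃ ∉ φ '' (K : Set (Sym2 V)) := by
      rw [← coe_image]; exact g4
    have c₂ : φ e₂ ∉ φ '' (insert e₃ K : Set (Sym2 V)) := by
      rw [Set.image_insert_eq, Set.mem_insert_iff, not_or, ← coe_image]
      exact ⟨fun h => g6 h.symm, q3⟩
    have c₁ : φ e₁ ∉ φ '' (insert e₂ (insert e₃ K) : Set (Sym2 V)) := by
      rw [Set.image_insert_eq, Set.image_insert_eq, Set.mem_insert_iff, Set.mem_insert_iff, not_or,
        not_or, ← coe_image]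
      exact ⟨g7, fun h => g5 h.symm, p3⟩
    push_cast
    exact Set.injOn_insert (by exact_mod_cast n₁) |>.2
      ⟨Set.injOn_insert (by exact_mod_cast n₂) |>.2
        ⟨Set.injOn_insert (by exact_mod_cast n₃) |>.2 ⟨h.injOn, c₃⟩, c₂⟩, c₁⟩
  · simp only [mem_insert, forall_eq_or_imp]
    refine ⟨?_, ?_, ?_, h.mem_ends⟩
    · intro x hx hxs
      rcases Sym2.mem_iff.1 hx with rfl | rfl
      · exact hPE
      · exact absurd hxs p4
    · intro x hx hxs
      rcases Sym2.mem_iff.1 hx with rfl | rfl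
      · exact hQE
      · exact absurd hxs q4
    · intro x hx hxs
      rcases Sym2.mem_iff.1 hx with rfl | rfl
      · exact absurd hxs g2
      · exact absurd hxs g3
  · rw [card_insert_of_notMem n₁, card_insert_of_notMem n₂, card_insert_of_notMem n₃,
      card_erase_of_mem hq]
    have := h.card_le
    have := card_pos.2 ⟨q, hq⟩
    omega
  · refine le_trans (le_of_eq ?_) (hpot.trans (le_trans (le_of_eq ?_) h.potential))
    · refine sum_congr rfl fun v _ => ?_
      rw [← Real.exp_add, load, sum_insert n₁, sum_insert n₂, sum_insert n₃, ← load]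
      simp only [hΔ]
      push_cast
      congr 1
      ring
    · refine sum_congr rfl fun v _ => ?_
      rw [← Real.exp_add, ← add_sum_erase T _ hq]
      congr 1
      ring

end Batch

section BatchInduction
open Finset
variable {V : Type*} [Fintype V] [DecidableEq V] {H : SimpleGraph V} [DecidableRel H.Adj]
  {φ : Sym2 V → ℕ} {n m : ℕ} {p β b ℓ lam N : ℝ} {U : Finset (Sym2 V)} {Sat : Finset V}
  {Ends : Set V} {N₀ : ℕ} {T : Finset (V × V)} {K : Finset (Sym2 V)} {S : V → V → Prop}

theorem batchRel_symm {V : Type*} {S : V → V → Prop} {K : Finset (Sym2 V)} {T : Finset (V × V)}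
    (hS : ∀ x y, S x y → S y x) (x y : V) (h : BatchRel S K T x y) : BatchRel S K T y x := by
  unfold BatchRel at h ⊢
  rw [Sym2.eq_swap (a := y)]
  exact h.imp_left (hS x y)

theorem cycle_chain_mono {α : Type*} {R R' : α → α → Prop} (h : ∀ x y, R x y → R' x y) {c : Cycle α}
    (hc : Cycle.Chain R c) : Cycle.Chain R' c := hc.imp h

theorem exists_batch_step (hs : BatchSetup H φ n m p β b ℓ lam N U Sat)
    (hS : ∀ x y, S x y → S y x) (h : NewEdges H φ n b lam N U Sat Ends N₀ T K) {q : V × V}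
    (hq : q ∈ T) (h1 : q.1 ∈ Ends) (h2 : q.2 ∈ Ends) {l : List V} (hl : l.Nodup)
    (hfull : ∀ v, v ∈ l) (hc : Cycle.Chain (BatchRel S K T) (l : Cycle V)) :
    ∃ K' : Finset (Sym2 V), NewEdges H φ n b lam N U Sat Ends N₀ (T.erase q) K' ∧
      ∃ l' : List V, l'.Nodup ∧ (∀ v, v ∈ l') ∧
        Cycle.Chain (BatchRel S K' (T.erase q)) (l' : Cycle V) := by
  obtain ⟨b₀, a₀⟩ := q
  have hlen : ∀ l : List V, l.Nodup → (∀ v, v ∈ l) → l.length = n := by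
    intro l hl hfull
    rw [hs.card_eq, ← List.toFinset_card_of_nodup hl, ← card_univ]
    congr 1
    ext v
    simp [hfull v]
  by_cases hadj : l.formPerm b₀ = a₀ ∨ l.formPerm a₀ = b₀
  · obtain ⟨l', hperm, ha, hb, hchain⟩ := exists_path_of_adjacent (batchRel_symm hS) hl
      (by rw [hlen l hl hfull]; exact hs.three_le) hc (hfull a₀) (hfull b₀) hadj
    have hl' : l'.Nodup := hperm.nodup_iff.2 hl
    have hfull' : ∀ v, v ∈ l' := fun v => hperm.mem_iff.2 (hfull v)
    have hln : l'.length = n := hlen l' hl' hfull'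
    have hchain' : l'.IsChain (BatchRel S K (T.erase (b₀, a₀))) := by
      refine hchain.imp fun x y hxy => ?_
      rcases hxy.1 with h | h | ⟨q, hqT, h⟩
      · exact Or.inl h
      · exact Or.inr (Or.inl h)
      · refine Or.inr (Or.inr ⟨q, mem_erase.2 ⟨?_, hqT⟩, h⟩)
        rintro rfl
        exact hxy.2 h
    set f : ℕ → V := fun i => l'.getD i a₀ with hf
    have hfi : ∀ i (hi : i < l'.length), l'[i] = f i := fun i hi =>
      (List.getD_eq_getElem _ _ hi).symm
    have hfinj : Set.InjOn f (range n) := by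
      intro i hi j hj hij
      have hi' : i < l'.length := by rw [hln]; simpa using hi
      have hj' : j < l'.length := by rw [hln]; simpa using hj
      rw [← hfi i hi', ← hfi j hj'] at hij
      exact hl'.getElem_inj_iff.1 hij
    have hfsurj : ∀ v, ∃ i < n, f i = v := by
      intro v
      obtain ⟨i, hi, hv⟩ := List.getElem_of_mem (hfull' v)
      exact ⟨i, by rw [← hln]; exact hi, by rw [← hfi i hi, hv]⟩
    obtain ⟨O, hO, hOc⟩ := exists_exchange_pairs H hfinj hfsurj hs.p_nonneg hs.disc hs.one_le
      (two_mul_le_card_freeNbrs hs h b₀) (two_mul_le_card_freeNbrs hs h a₀)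
    have finish : ∀ K' : Finset (Sym2 V), K ⊆ K' → ∀ o : ℕ × ℕ, 0 < o.1 → o.1 ≤ o.2 → o.2 + 1 < n →
        s(f (o.1 - 1), f (o.2 + 1)) ∈ K' → ((s(b₀, f o.1) ∈ K' ∧ s(a₀, f o.2) ∈ K') ∨
          (s(a₀, f o.1) ∈ K' ∧ s(b₀, f o.2) ∈ K')) →
        ∃ l' : List V, l'.Nodup ∧ (∀ v, v ∈ l') ∧
        Cycle.Chain (BatchRel S K' (T.erase (b₀, a₀))) (l' : Cycle V) := by
      intro K' hKK o o1 o2 o3 e₁ e₂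
      obtain ⟨l'', hp, hcc⟩ := exists_cycle_of_path (batchRel_symm hS) (lo := o.1) (hi := o.2)
        o1 o2 (by omega) (hchain'.imp fun x y h => h.imp_right (Or.imp_left fun h => hKK h)) ha hb
        (Or.inr (Or.inl (by rw [hfi, hfi]; exact e₁))) (by
          rw [hfi, hfi]
          refine e₂.imp (fun h => ⟨Or.inr (Or.inl h.1), Or.inr (Or.inl ?_)⟩)
            (fun h => ⟨Or.inr (Or.inl h.1), Or.inr (Or.inl ?_)⟩)
          · rw [Sym2.eq_swap]; exact h.2
          · rw [Sym2.eq_swap]; exact h.2)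
      exact ⟨l'', hp.nodup_iff.2 hl', fun v => hp.mem_iff.2 (hfull' v), hcc⟩
    rcases hO with hO | hO
    · obtain ⟨o, ho, hN⟩ := exists_new_edges hs h hq h1 h2 (P := b₀) (Q := a₀) (Or.inl ⟨rfl, rfl⟩)
        hfinj hO hOc
      obtain ⟨o1, o2, o3, -⟩ := hO o ho
      refine ⟨_, hN, finish _ ?_ o o1 o2 o3 (by simp) (Or.inl ⟨by simp, by simp⟩)⟩
      intro e he
      simp [he]
    · obtain ⟨o, ho, hN⟩ := exists_new_edges hs h hq h1 h2 (P := a₀) (Q := b₀) (Or.inr ⟨rfl, rfl⟩)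
        hfinj hO hOc
      obtain ⟨o1, o2, o3, -⟩ := hO o ho
      refine ⟨_, hN, finish _ ?_ o o1 o2 o3 (by simp) (Or.inr ⟨by simp, by simp⟩)⟩
      intro e he
      simp [he]
  · refine ⟨K, h.mono hs.N_pos hs.lam_pos (erase_subset _ _), l, hl, hfull, ?_⟩
    rw [cycle_chain_iff_formPerm hl] at hc ⊢
    intro x hx
    rcases hc x hx with h | h | ⟨q, hqT, h⟩
    · exact Or.inl h
    · exact Or.inr (Or.inl h)
    · refine Or.inr (Or.inr ⟨q, mem_erase.2 ⟨?_, hqT⟩, h⟩)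
      rintro rfl
      rcases Sym2.eq_iff.1 h with ⟨rfl, h⟩ | ⟨rfl, h⟩
      · exact hadj (Or.inl h)
      · exact hadj (Or.inr h)

theorem exists_batch_induction (hs : BatchSetup H φ n m p β b ℓ lam N U Sat)
    (hS : ∀ x y, S x y → S y x) (hT : ∀ q ∈ T, q.1 ∈ Ends ∧ q.2 ∈ Ends)
    (h : NewEdges H φ n b lam N U Sat Ends N₀ T K) {l : List V} (hl : l.Nodup)
    (hfull : ∀ v, v ∈ l) (hc : Cycle.Chain (BatchRel S K T) (l : Cycle V)) :
    ∃ K' : Finset (Sym2 V), NewEdges H φ n b lam N U Sat Ends N₀ ∅ K' ∧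
      ∃ l' : List V, l'.Nodup ∧ (∀ v, v ∈ l') ∧ Cycle.Chain (BatchRel S K' ∅) (l' : Cycle V) := by
  induction hk : T.card generalizing T K l with
  | zero =>
    rw [card_eq_zero] at hk
    subst hk
    exact ⟨K, h, l, hl, hfull, hc⟩
  | succ k ih =>
    obtain ⟨q, hq⟩ := card_pos.1 (by omega : 0 < T.card)
    obtain ⟨K', hK', l', hl', hfull', hc'⟩ :=
      exists_batch_step hs hS h hq (hT q hq).1 (hT q hq).2 hl hfull hc
    exact ih (fun q hq => hT q (mem_of_mem_erase hq)) hK' hl' hfull' hc'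
      (by rw [card_erase_of_mem hq, hk]; rfl)

/-- All missing edges of a cyclic order are replaced by few edges of `H` with distinct colours
that avoid `U` and the saturated vertices. -/
theorem exists_batch (hs : BatchSetup H φ n m p β b ℓ lam N U Sat)
    (hS : ∀ x y, S x y → S y x) {l : List V} (hl : l.Nodup) (hfull : ∀ v, v ∈ l)
    {T : Finset (V × V)}
    (hc : Cycle.Chain (fun x y => S x y ∨ (x, y) ∈ T) (l : Cycle V))
    (hT₁ : Set.InjOn Prod.fst (T : Set (V × V))) (hT₂ : Set.InjOn Prod.snd (T : Set (V × V)))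
    {A B : Finset V} (hA : ∀ q ∈ T, q.1 ∈ A) (hB : ∀ q ∈ T, q.2 ∈ B) {r : ℕ} (hAr : A.card ≤ r)
    (hAc : ∀ c, ∑ v ∈ A, colDeg H φ c v ≤ r) (hBc : ∀ c, ∑ v ∈ B, colDeg H φ c v ≤ r)
    (hpot : n * Real.exp (lam * (6 * n * n * r / N)) ≤ Real.exp (lam * b)) :
    ∃ K : Finset (Sym2 V), ∃ l' : List V, l'.Nodup ∧ (∀ v, v ∈ l') ∧
      Cycle.Chain (fun x y => S x y ∨ s(x, y) ∈ K) (l' : Cycle V) ∧ (∀ e ∈ K, e ∈ H.edgeSet) ∧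
      (∀ e ∈ K, e ∉ U) ∧ Set.InjOn φ K ∧ (∀ e ∈ K, ∀ x ∈ e, x ∈ Sat → x ∈ A ∨ x ∈ B) ∧
      K.card ≤ 3 * r := by
  have hTr : T.card ≤ r := by
    refine le_trans ?_ hAr
    exact card_le_card_of_injOn Prod.fst hA hT₁
  have hsum : ∀ v, ∑ q ∈ T, expectedLoad H φ n N q v ≤ 3 * n * n * r / N := by
    intro v
    simp only [expectedLoad]
    rw [← sum_div]
    refine div_le_div_of_nonneg_right ?_ hs.N_pos.le
    rw [← Nat.cast_sum]
    have e₁ : ∑ q ∈ T, coMono H φ q.1 v ≤ n * r := by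
      rw [← sum_image (f := fun x => coMono H φ x v) hT₁]
      refine (sum_le_sum_of_subset (t := A) ?_).trans
        ((sum_coMono_le H φ hAc).trans_eq (by rw [hs.card_eq]))
      intro x hx
      obtain ⟨q, hq, rfl⟩ := mem_image.1 hx
      exact hA q hq
    have e₂ : ∑ q ∈ T, coMono H φ q.2 v ≤ n * r := by
      rw [← sum_image (f := fun x => coMono H φ x v) hT₂]
      refine (sum_le_sum_of_subset (t := B) ?_).trans
        ((sum_coMono_le H φ hBc).trans_eq (by rw [hs.card_eq]))
      intro x hx
      obtain ⟨q, hq, rfl⟩ := mem_image.1 hx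
      exact hB q hq
    have e₃ : ∑ q ∈ T, n * (coMono H φ q.1 v + coMono H φ q.2 v + n) ≤ 3 * n * n * r := by
      rw [← mul_sum, sum_add_distrib, sum_add_distrib, sum_const, smul_eq_mul]
      nlinarith [Nat.mul_le_mul_right n hTr]
    exact_mod_cast e₃
  have h0 : NewEdges H φ n b lam N U Sat {x | x ∈ A ∨ x ∈ B} (3 * T.card) T ∅ := by
    refine ⟨by simp, by simp, by simp, by simp, by simp, ?_⟩
    refine (sum_le_card_nsmul _ _ (Real.exp (lam * (6 * n * n * r / N))) fun v _ => ?_).trans ?_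
    · rw [Real.exp_le_exp]
      refine mul_le_mul_of_nonneg_left ?_ hs.lam_pos.le
      have := hsum v
      simp only [load, sum_empty, Nat.cast_zero, zero_add]
      calc _ ≤ 2 * (3 * n * n * r / N) := by linarith
        _ = _ := by ring
    · rw [nsmul_eq_mul, card_univ, ← hs.card_eq]
      exact hpot
  obtain ⟨K, hK, l', hl', hfull', hc'⟩ := exists_batch_induction hs hS
    (fun q hq => ⟨Or.inl (hA q hq), Or.inr (hB q hq)⟩) h0 hl hfull
    (cycle_chain_mono (fun x y h => h.imp_right fun h => Or.inr ⟨_, h, rfl⟩) hc)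
  refine ⟨K, l', hl', hfull', cycle_chain_mono (fun x y h => ?_) hc', hK.mem_edgeSet, hK.notMem,
    hK.injOn, hK.mem_ends, ?_⟩
  · rcases h with h | h | ⟨q, hq, -⟩
    · exact Or.inl h
    · exact Or.inr h
    · exact absurd hq (notMem_empty q)
  · have := hK.card_le
    simp only [card_empty] at this
    omega

end BatchInduction

section AllBatches
open Finset
variable {V : Type*} [Fintype V] [DecidableEq V] {H : SimpleGraph V} [DecidableRel H.Adj]
  {φ : Sym2 V → ℕ} {n m : ℕ} {p β b ℓ lam N : ℝ}

theorem sum_card_mem_le (U : Finset (Sym2 V)) :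
    ∑ v, (univ.filter fun w => H.Adj v w ∧ s(v, w) ∈ U).card ≤ 2 * U.card := by
  simp only [card_filter]
  rw [← Fintype.sum_prod_type (f := fun q : V × V => if H.Adj q.1 q.2 ∧ s(q.1, q.2) ∈ U then 1 else 0),
    ← card_filter]
  refine card_le_mul_card_image_of_maps_to (f := fun q : V × V => s(q.1, q.2)) ?_ 2 ?_
  · intro q hq
    exact (mem_filter.1 hq).2.2
  · intro e he
    induction e using Sym2.ind with
    | _ x y =>
      refine (card_le_card (t := {(x, y), (y, x)}) ?_).trans card_le_two
      intro q hq
      have := (mem_filter.1 hq).2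
      rw [Sym2.eq_iff] at this
      rw [mem_insert, mem_singleton, Prod.ext_iff, Prod.ext_iff]
      exact this

theorem exists_batch_restricted {U : Finset (Sym2 V)} {Sat : Finset V} {S : V → V → Prop}
    (hs : BatchSetup H φ n m p β b ℓ lam N U Sat)
    (hS : ∀ x y, S x y → S y x) {l : List V} (hl : l.Nodup) (hfull : ∀ v, v ∈ l)
    {T : Finset (V × V)}
    (hc : Cycle.Chain (fun x y => S x y ∨ (x, y) ∈ T) (l : Cycle V))
    (hT₁ : Set.InjOn Prod.fst (T : Set (V × V))) (hT₂ : Set.InjOn Prod.snd (T : Set (V × V)))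
    {A B : Finset V} (hA : ∀ q ∈ T, q.1 ∈ A) (hB : ∀ q ∈ T, q.2 ∈ B) {r : ℕ} (hAr : A.card ≤ r)
    (hAc : ∀ c, ∑ v ∈ A, colDeg H φ c v ≤ r) (hBc : ∀ c, ∑ v ∈ B, colDeg H φ c v ≤ r)
    (hpot : n * Real.exp (lam * (6 * n * n * r / N)) ≤ Real.exp (lam * b)) :
    ∃ K : Finset (Sym2 V), ∃ l' : List V, l'.Nodup ∧ (∀ v, v ∈ l') ∧
      Cycle.Chain (fun x y => S x y ∨ s(x, y) ∈ K) (l' : Cycle V) ∧ (∀ e ∈ K, e ∈ H.edgeSet) ∧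
      (∀ e ∈ K, e ∉ U) ∧ Set.InjOn φ K ∧ (∀ e ∈ K, ∀ x ∈ e, x ∈ Sat → x ∈ A ∨ x ∈ B) ∧
      K.card ≤ 3 * r ∧ ∀ v, (univ.filter fun w => H.Adj v w ∧ s(v, w) ∈ K).card ≤ 2 := by
  obtain ⟨K, l', h1, h2, h3, h4, h5, h6, h7, h8⟩ :=
    exists_batch hs hS hl hfull hc hT₁ hT₂ hA hB hAr hAc hBc hpot
  refine ⟨K.filter fun e => ∃ x, e = s(x, l'.formPerm x), l', h1, h2, ?_,
    fun e he => h4 e (mem_filter.1 he).1, fun e he => h5 e (mem_filter.1 he).1,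
    h6.mono fun e he => (mem_filter.1 he).1, fun e he => h7 e (mem_filter.1 he).1,
    (card_le_card (filter_subset _ _)).trans h8, ?_⟩
  · rw [cycle_chain_iff_formPerm h1] at h3 ⊢
    exact fun x hx => (h3 x hx).imp_right fun h => mem_filter.2 ⟨h, x, rfl⟩
  · intro v
    refine (card_le_card (t := {l'.formPerm v, l'.formPerm.symm v}) ?_).trans card_le_two
    intro w hw
    obtain ⟨x, hx⟩ := (mem_filter.1 (mem_filter.1 hw).2.2).2
    rw [mem_insert, mem_singleton]
    rcases Sym2.eq_iff.1 hx with ⟨rfl, h⟩ | ⟨h, rfl⟩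
    · exact Or.inl h
    · exact Or.inr (by rw [h, Equiv.symm_apply_apply])

theorem exists_batches {t r : ℕ} (hs : ∀ (U : Finset (Sym2 V)) (Sat : Finset V),
      (∀ v, ((univ.filter fun w => H.Adj v w ∧ s(v, w) ∈ U).card : ℝ) ≤ b) →
      (Sat.card : ℝ) ≤ b → BatchSetup H φ n m p β b ℓ lam N U Sat)
    {S : Fin t → V → V → Prop} (hS : ∀ i x y, S i x y → S i y x) {l : Fin t → List V}
    (hl : ∀ i, (l i).Nodup) (hfull : ∀ i v, v ∈ l i) {T : Fin t → Finset (V × V)}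
    (hc : ∀ i, Cycle.Chain (fun x y => S i x y ∨ (x, y) ∈ T i) (l i : Cycle V))
    (hT₁ : ∀ i, Set.InjOn Prod.fst (T i : Set (V × V)))
    (hT₂ : ∀ i, Set.InjOn Prod.snd (T i : Set (V × V)))
    {A B : Fin t → Finset V} (hA : ∀ i, ∀ q ∈ T i, q.1 ∈ A i) (hB : ∀ i, ∀ q ∈ T i, q.2 ∈ B i)
    (hAr : ∀ i, (A i).card ≤ r) (hAc : ∀ i c, ∑ v ∈ A i, colDeg H φ c v ≤ r)
    (hBc : ∀ i c, ∑ v ∈ B i, colDeg H φ c v ≤ r)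
    (hAt : ∀ v, (univ.filter fun i => v ∈ A i).card ≤ r)
    (hBt : ∀ v, (univ.filter fun i => v ∈ B i).card ≤ r)
    (hpot : n * Real.exp (lam * (6 * n * n * r / N)) ≤ Real.exp (lam * b))
    (hb : 0 < b) (hrb : 4 * (r : ℝ) + 2 ≤ b / 2) (hrt : 12 * (r : ℝ) * t ≤ b ^ 2)
    (I : Finset (Fin t)) :
    ∃ (K : Fin t → Finset (Sym2 V)) (L : Fin t → List V), (∀ i ∈ I, (L i).Nodup ∧ (∀ v, v ∈ L i) ∧
      Cycle.Chain (fun x y => S i x y ∨ s(x, y) ∈ K i) (L i : Cycle V) ∧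
      (∀ e ∈ K i, e ∈ H.edgeSet) ∧ Set.InjOn φ (K i)) ∧
      (∀ i ∈ I, ∀ j ∈ I, i ≠ j → Disjoint (K i) (K j)) ∧
      (∀ v, ((univ.filter fun w => H.Adj v w ∧ s(v, w) ∈ I.biUnion K).card : ℝ) ≤
        b / 2 + 2 + 2 * (I.filter fun i => v ∈ A i ∨ v ∈ B i).card) ∧
      (I.biUnion K).card ≤ 3 * r * I.card := by
  induction I using Finset.induction_on with
  | empty =>
    refine ⟨fun _ => ∅, fun _ => [], by simp, by simp, fun v => ?_, by simp⟩
    simp only [biUnion_empty, notMem_empty, and_false, filter_false, card_empty, filter_empty,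
      Nat.cast_zero]
    positivity
  | insert i I hi ih =>
    obtain ⟨K, L, hprop, hdisj, hcnt, hcard⟩ := ih
    set U := I.biUnion K with hU
    have hused : ∀ v, ((univ.filter fun w => H.Adj v w ∧ s(v, w) ∈ U).card : ℝ) ≤ b := by
      intro v
      have h1 : (I.filter fun i => v ∈ A i ∨ v ∈ B i).card ≤ 2 * r := by
        refine (card_le_card (t := (univ.filter fun i => v ∈ A i) ∪ (univ.filter fun i => v ∈ B i))
          ?_).trans ((card_union_le _ _).trans ?_)
        · intro j hj
          simpa using (mem_filter.1 hj).2
        · linarith [hAt v, hBt v]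
      have h2 := (Nat.cast_le (α := ℝ)).2 h1
      push_cast at h2
      linarith [hcnt v]
    set Sat := univ.filter fun v =>
      b / 2 < ((univ.filter fun w => H.Adj v w ∧ s(v, w) ∈ U).card : ℝ) with hSat
    have hsat : (Sat.card : ℝ) ≤ b := by
      have h1 : (Sat.card : ℝ) * (b / 2) ≤ 2 * U.card := by
        rw [← nsmul_eq_mul]
        refine (card_nsmul_le_sum Sat (fun v =>
          ((univ.filter fun w => H.Adj v w ∧ s(v, w) ∈ U).card : ℝ)) (b / 2)
          fun v hv => (mem_filter.1 hv).2.le).trans ?_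
        refine (sum_le_sum_of_subset_of_nonneg (subset_univ _)
          fun v _ _ => Nat.cast_nonneg _).trans ?_
        exact_mod_cast sum_card_mem_le (H := H) U
      have h2 : (U.card : ℝ) ≤ 3 * r * t := by
        have : U.card ≤ 3 * r * t := hcard.trans (Nat.mul_le_mul_left _ (by
          simpa using card_le_univ I))
        exact_mod_cast this
      by_contra! hcon
      have h3 : b * (b / 2) < Sat.card * (b / 2) := mul_lt_mul_of_pos_right hcon (by positivity)
      nlinarith
    obtain ⟨Ki, li, k1, k2, k3, k4, k5, k6, k7, k8, k9⟩ := exists_batch_restricted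
      (hs U Sat hused hsat) (hS i) (hl i) (hfull i) (hc i) (hT₁ i) (hT₂ i) (hA i) (hB i) (hAr i)
      (hAc i) (hBc i) hpot
    have hKI : ∀ j ∈ I, Function.update K i Ki j = K j := fun j hj =>
      Function.update_of_ne (by rintro rfl; exact hi hj) _ _
    have hLI : ∀ j ∈ I, Function.update L i li j = L j := fun j hj =>
      Function.update_of_ne (by rintro rfl; exact hi hj) _ _
    have hUnew : (insert i I).biUnion (Function.update K i Ki) = Ki ∪ U := by
      rw [biUnion_insert, Function.update_self, hU]
      congr 1
      exact biUnion_congr rfl hKI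
    have hKU : ∀ j ∈ I, Disjoint Ki (K j) := by
      intro j hj
      rw [disjoint_left]
      exact fun e he he' => k5 e he (mem_biUnion.2 ⟨j, hj, he'⟩)
    refine ⟨Function.update K i Ki, Function.update L i li, ?_, ?_, ?_, ?_⟩
    · intro j hj
      rcases mem_insert.1 hj with rfl | hj
      · simp only [Function.update_self]
        exact ⟨k1, k2, k3, k4, k6⟩
      · rw [hKI j hj, hLI j hj]
        exact hprop j hj
    · intro j hj j' hj' hne
      obtain hj₁ | hj₁ := mem_insert.1 hj <;> obtain hj₂ | hj₂ := mem_insert.1 hj'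
      · exact absurd (hj₁.trans hj₂.symm) hne
      · rw [hj₁, Function.update_self, hKI j' hj₂]; exact hKU j' hj₂
      · rw [hj₂, Function.update_self, hKI j hj₁]; exact (hKU j hj₁).symm
      · rw [hKI j hj₁, hKI j' hj₂]; exact hdisj j hj₁ j' hj₂ hne
    · intro v
      rw [hUnew]
      have h1 : (univ.filter fun w => H.Adj v w ∧ s(v, w) ∈ Ki ∪ U).card ≤
          (univ.filter fun w => H.Adj v w ∧ s(v, w) ∈ Ki).card +
          (univ.filter fun w => H.Adj v w ∧ s(v, w) ∈ U).card := by
        refine (card_le_card ?_).trans (card_union_le _ _)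
        intro w hw
        simp only [mem_filter, mem_union, mem_univ, true_and] at hw ⊢
        tauto
      have h2 := (Nat.cast_le (α := ℝ)).2 h1
      push_cast at h2
      have h3 : ((univ.filter fun w => H.Adj v w ∧ s(v, w) ∈ Ki).card : ℝ) ≤ 2 := by
        exact_mod_cast k9 v
      have h4 : ((I.filter fun i => v ∈ A i ∨ v ∈ B i).card : ℝ) ≤
          ((insert i I).filter fun i => v ∈ A i ∨ v ∈ B i).card := by
        exact_mod_cast card_le_card (filter_subset_filter _ (subset_insert _ _))
      by_cases hv : v ∈ Sat
      · by_cases hv' : v ∈ A i ∨ v ∈ B i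
        · rw [filter_insert, if_pos hv', card_insert_of_notMem (by simp [hi])]
          push_cast
          linarith [hcnt v]
        · have h5 : (univ.filter fun w => H.Adj v w ∧ s(v, w) ∈ Ki) = ∅ := by
            rw [filter_eq_empty_iff]
            intro w _ hw
            exact hv' (k7 _ hw.2 v (Sym2.mem_mk_left v w) hv)
          rw [h5, card_empty, Nat.cast_zero] at h2
          linarith [hcnt v]
      · have h5 : ((univ.filter fun w => H.Adj v w ∧ s(v, w) ∈ U).card : ℝ) ≤ b / 2 := by
          by_contra! hcon
          exact hv (mem_filter.2 ⟨mem_univ _, hcon⟩)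
        have h6 : (0 : ℝ) ≤ ((insert i I).filter fun i => v ∈ A i ∨ v ∈ B i).card :=
          Nat.cast_nonneg _
        linarith
    · rw [hUnew, card_insert_of_notMem hi]
      refine (card_union_le _ _).trans ?_
      nlinarith

end AllBatches

section ToWalk
variable {V : Type*} [Fintype V] [DecidableEq V]

theorem exists_isHamiltonianCycle_of_chain {G : SimpleGraph V} {l : List V} (hl : l.Nodup)
    (hfull : ∀ v, v ∈ l) (h3 : 3 ≤ Fintype.card V) (hc : Cycle.Chain G.Adj (l : Cycle V)) :
    ∃ (v : V) (w : G.Walk v v), w.IsHamiltonianCycle := by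
  have hlen : l.length = Fintype.card V := by
    rw [← List.toFinset_card_of_nodup hl, ← Finset.card_univ]
    congr 1
    ext v
    simp [hfull v]
  have hne : l ≠ [] := by
    rintro rfl
    simp at hlen
    omega
  rw [Cycle.chain_ne_nil _ hne, List.isChain_cons] at hc
  have hadj : G.Adj (l.getLast hne) (l.head hne) :=
    hc.1 _ (List.head?_eq_some_head hne)
  have hp : (SimpleGraph.Walk.ofSupport l hne hc.2).IsPath :=
    SimpleGraph.Walk.IsPath.mk' (by rw [SimpleGraph.Walk.support_ofSupport]; exact hl)
  refine ⟨_, .cons hadj (.ofSupport l hne hc.2), ?_⟩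
  rw [SimpleGraph.Walk.isHamiltonianCycle_iff_isCycle_and_length_eq,
    SimpleGraph.Walk.isCycle_iff_isPath_tail_and_le_length, SimpleGraph.Walk.length_cons,
    SimpleGraph.Walk.length_ofSupport, hlen]
  refine ⟨⟨?_, by omega⟩, by omega⟩
  simpa using hp

theorem exists_isHamiltonianCycle_of_rel {G : SimpleGraph V} {R : V → V → Prop}
    (hR : ∀ x y, R x y → R y x) (hRG : ∀ x y, R x y → G.Adj x y) {l : List V} (hl : l.Nodup)
    (hfull : ∀ v, v ∈ l) (h3 : 3 ≤ Fintype.card V) (hc : Cycle.Chain R (l : Cycle V)) :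
    ∃ (v : V) (w : G.Walk v v), w.IsHamiltonianCycle ∧
      ∀ e ∈ w.edges, ∃ x y, e = s(x, y) ∧ R x y := by
  let G' : SimpleGraph V :=
    { Adj := R
      symm := ⟨fun x y => hR x y⟩
      loopless := ⟨fun x h => G.loopless.irrefl x (hRG x x h)⟩ }
  obtain ⟨v, w, hw⟩ := exists_isHamiltonianCycle_of_chain (G := G') hl hfull h3 hc
  have hle : G' ≤ G := fun x y h => hRG x y h
  refine ⟨v, w.map (.ofLE hle), hw.map Function.bijective_id, fun e he => ?_⟩
  have he' : e ∈ w.edges := by simpa [SimpleGraph.Walk.edges_map] using he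
  have := w.edges_subset_edgeSet he'
  induction e using Sym2.ind with
  | _ x y => exact ⟨x, y, rfl, this⟩

/-- Rainbow edge-disjoint forests with colours outside `C`, completed by rainbow edge-disjoint sets
of edges with colours in `C`, give edge-disjoint rainbow Hamilton cycles. -/
theorem exists_rainbow_cycles {t : ℕ} {G : SimpleGraph V} {φ : Sym2 V → ℕ} {C : Finset ℕ}
    {M : Finset (Fin t × V × V)} (hM : ∀ h ∈ M, G.Adj h.2.1 h.2.2 ∧ φ s(h.2.1, h.2.2) ∉ C)
    (hcol : ∀ i, ∀ u v u' v', (i, u, v) ∈ M → (i, u', v') ∈ M →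
      φ s(u, v) = φ s(u', v') → s(u, v) = s(u', v'))
    (hedge : ∀ i j u v u' v', (i, u, v) ∈ M → (j, u', v') ∈ M → s(u, v) = s(u', v') → i = j)
    {K : Fin t → Finset (Sym2 V)} {L : Fin t → List V} (h3 : 3 ≤ Fintype.card V)
    (hL : ∀ i, (L i).Nodup ∧ (∀ v, v ∈ L i) ∧
      Cycle.Chain (fun x y => ((i, x, y) ∈ M ∨ (i, y, x) ∈ M) ∨ s(x, y) ∈ K i) (L i : Cycle V) ∧
      (∀ e ∈ K i, e ∈ G.edgeSet ∧ φ e ∈ C) ∧ Set.InjOn φ (K i))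
    (hK : ∀ i j, i ≠ j → Disjoint (K i) (K j)) :
    ∃ (v : Fin t → V) (w : ∀ i, G.Walk (v i) (v i)), (∀ i, (w i).IsHamiltonianCycle) ∧
      (∀ i, ((w i).edges.map φ).Nodup) ∧
      ∀ i j, i ≠ j → ∀ e ∈ (w i).edges, e ∉ (w j).edges := by
  have key : ∀ i, ∃ (v : V) (w : G.Walk v v), w.IsHamiltonianCycle ∧
      ∀ e ∈ w.edges, e ∈ K i ∨ ∃ x y, e = s(x, y) ∧ (i, x, y) ∈ M := by
    intro i
    obtain ⟨h1, h2, h3', h4, h5⟩ := hL i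
    obtain ⟨v, w, hw, he⟩ := exists_isHamiltonianCycle_of_rel (G := G) (fun x y h => by
      rw [Sym2.eq_swap]; tauto) (fun x y h => by
        rcases h with (h | h) | h
        · exact (hM _ h).1
        · exact (hM _ h).1.symm
        · exact (h4 _ h).1) h1 h2 h3 h3'
    refine ⟨v, w, hw, fun e hee => ?_⟩
    obtain ⟨x, y, rfl, (h | h) | h⟩ := he e hee
    · exact Or.inr ⟨x, y, rfl, h⟩
    · exact Or.inr ⟨y, x, Sym2.eq_swap, h⟩
    · exact Or.inl h
  choose v w hw he using key
  refine ⟨v, w, hw, fun i => ?_, fun i j hij e hi hj => ?_⟩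
  · refine List.Nodup.map_on ?_ (hw i).isCycle.isTrail.edges_nodup
    intro e h e' h' heq
    rcases he i e h with k | ⟨x, y, hxy, k⟩ <;> rcases he i e' h' with k' | ⟨x', y', hxy', k'⟩
    · exact (hL i).2.2.2.2 k k' heq
    · refine absurd ((hL i).2.2.2.1 _ k).2 ?_
      rw [heq, hxy']
      exact (hM _ k').2
    · refine absurd ((hL i).2.2.2.1 _ k').2 ?_
      rw [← heq, hxy]
      exact (hM _ k).2
    · rw [hxy, hxy'] at heq ⊢
      exact hcol i _ _ _ _ k k' heq
  · rcases he i e hi with k | ⟨x, y, hxy, k⟩ <;> rcases he j e hj with k' | ⟨x', y', hxy', k'⟩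
    · exact Finset.disjoint_left.1 (hK i j hij) k k'
    · refine absurd ((hL i).2.2.2.1 _ k).2 ?_
      rw [hxy']
      exact (hM _ k').2
    · refine absurd ((hL j).2.2.2.1 _ k').2 ?_
      rw [hxy]
      exact (hM _ k).2
    · exact hij (hedge i j _ _ _ _ k k' (hxy.symm.trans hxy'))

end ToWalk

section Spread
open Finset
variable {t : ℕ} {V : Type*} [Fintype V]

theorem sum_filter_fst_eq (P : Fin t × V → Prop) [DecidablePred P] (j : Fin t) (f : V → ℝ) :
    ∑ p : Fin t × V with P p, (if p.1 = j then f p.2 else 0) =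
      ∑ u ∈ univ.filter fun u => P (j, u), f u := by
  rw [sum_filter, Fintype.sum_prod_type, sum_eq_single j, sum_filter]
  · simp
  · intro i _ hij
    simp [hij]
  · simp

theorem colDeg_eq_zero_of_notMem {H : SimpleGraph V} [DecidableRel H.Adj] {φ : Sym2 V → ℕ} {c : ℕ}
    (hc : c ∉ univ.image φ) (v : V) : colDeg H φ c v = 0 := by
  rw [colDeg, card_eq_zero, filter_eq_empty_iff]
  rintro u - ⟨-, h⟩
  exact hc (mem_image.2 ⟨_, mem_univ _, h⟩)

variable [DecidableEq V]

theorem sum_filter_snd_eq (P : Fin t × V → Prop) [DecidablePred P] (v : V) (a : ℝ) :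
    ∑ p : Fin t × V with P p, (if p.2 = v then a else 0) =
      (univ.filter fun i => P (i, v)).card * a := by
  rw [sum_filter, Fintype.sum_prod_type_right, sum_eq_single v, card_filter, Nat.cast_sum, sum_mul]
  · refine sum_congr rfl fun i _ => ?_
    simp only [if_true]
    split_ifs <;> simp
  · intro u _ huv
    simp [huv]
  · simp

/-- The weights of the statistics controlling the vertices without an arc. -/
noncomputable def spreadWeight (H : SimpleGraph V) [DecidableRel H.Adj] (φ : Sym2 V → ℕ) :
    (Fin t × ℕ) ⊕ V ⊕ Fin t → Fin t → V → ℝ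
  | .inl (j, c), i, u => if i = j then (colDeg H φ c u : ℝ) / Fintype.card V else 0
  | .inr (.inl v), _, u => if u = v then 1 / (Fintype.card V : ℝ) else 0
  | .inr (.inr j), i, _ => if i = j then 1 / (Fintype.card V : ℝ) else 0

/-- The exceptional sets of a family are spread out: bounded in size, in each colour and at
each vertex. -/
structure IsSpread (H : SimpleGraph V) [DecidableRel H.Adj] (φ : Sym2 V → ℕ) (r : ℕ)
    (A : Fin t → Finset V) : Prop where
  card_le : ∀ i, (A i).card ≤ r
  sum_colDeg_le : ∀ i c, ∑ v ∈ A i, colDeg H φ c v ≤ r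
  card_index_le : ∀ v, (univ.filter fun i => v ∈ A i).card ≤ r

theorem isSpread_of_weight {H : SimpleGraph V} [DecidableRel H.Adj] {φ : Sym2 V → ℕ} {r : ℕ} {μ : ℝ}
    (P : Fin t × V → Prop) [DecidablePred P] (hn : 0 < Fintype.card V)
    (hr : μ * Fintype.card V ≤ r)
    (h1 : ∀ j, ∀ c ∈ univ.image φ,
      ∑ p : Fin t × V with P p, spreadWeight H φ (.inl (j, c)) p.1 p.2 ≤ μ)
    (h2 : ∀ v, ∑ p : Fin t × V with P p, spreadWeight H φ (.inr (.inl v)) p.1 p.2 ≤ μ)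
    (h3 : ∀ j, ∑ p : Fin t × V with P p, spreadWeight H φ (.inr (.inr j)) p.1 p.2 ≤ μ) :
    IsSpread H φ r fun i => univ.filter fun u => P (i, u) := by
  have hn' : (0 : ℝ) < Fintype.card V := Nat.cast_pos.2 hn
  have key : ∀ {x : ℝ}, x / Fintype.card V ≤ μ → x ≤ r := fun h =>
    ((div_le_iff₀ hn').1 h).trans hr
  refine ⟨fun j => ?_, fun j c => ?_, fun v => ?_⟩
  · have h := h3 j
    simp only [spreadWeight] at h
    rw [sum_filter_fst_eq P j (fun _ => 1 / (Fintype.card V : ℝ)), sum_const, nsmul_eq_mul,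
      mul_one_div] at h
    exact_mod_cast key h
  · by_cases hc : c ∈ univ.image φ
    · have h := h1 j c hc
      simp only [spreadWeight] at h
      rw [sum_filter_fst_eq P j (fun u => (colDeg H φ c u : ℝ) / Fintype.card V), ← sum_div] at h
      exact_mod_cast key h
    · simp [colDeg_eq_zero_of_notMem hc]
  · have h := h2 v
    simp only [spreadWeight] at h
    rw [sum_filter_snd_eq, mul_one_div] at h
    simpa using key h

theorem spreadWeight_bounds {H : SimpleGraph V} [DecidableRel H.Adj] {φ : Sym2 V → ℕ} {θ : ℝ}
    (hn : 0 < Fintype.card V) (hθ : 1 ≤ θ * Fintype.card V)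
    (hcd : ∀ c v, (colDeg H φ c v : ℝ) ≤ θ * Fintype.card V)
    (q : (Fin t × ℕ) ⊕ V ⊕ Fin t) (i : Fin t) (u : V) :
    0 ≤ spreadWeight H φ q i u ∧ spreadWeight H φ q i u ≤ θ := by
  have hn' : (0 : ℝ) < Fintype.card V := Nat.cast_pos.2 hn
  have hθ0 : 0 ≤ θ := (pos_of_mul_pos_left (zero_lt_one.trans_le hθ) hn'.le).le
  rcases q with ⟨j, c⟩ | v | j <;> simp only [spreadWeight] <;> split_ifs <;>
    refine ⟨by positivity, ?_⟩ <;> first | exact hθ0 | rw [div_le_iff₀ hn']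
  · exact hcd c u
  · exact hθ
  · exact hθ

theorem sum_spreadWeight_le {H : SimpleGraph V} [DecidableRel H.Adj] {φ : Sym2 V → ℕ}
    (ht : t ≤ Fintype.card V) (hn : 0 < Fintype.card V)
    (hcls : ∀ c, ∑ v, colDeg H φ c v ≤ Fintype.card V)
    (q : (Fin t × ℕ) ⊕ V ⊕ Fin t) :
    ∑ p : Fin t × V, spreadWeight H φ q p.1 p.2 ≤ 1 := by
  have hn' : (0 : ℝ) < Fintype.card V := Nat.cast_pos.2 hn
  have h0 : ∑ p : Fin t × V, spreadWeight H φ q p.1 p.2 =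
      ∑ p : Fin t × V with True, spreadWeight H φ q p.1 p.2 := by simp
  rw [h0]
  rcases q with ⟨j, c⟩ | v | j <;> simp only [spreadWeight]
  · rw [sum_filter_fst_eq _ j (fun u => (colDeg H φ c u : ℝ) / Fintype.card V), ← sum_div,
      div_le_one hn']
    simpa using (by exact_mod_cast hcls c : ∑ v, (colDeg H φ c v : ℝ) ≤ Fintype.card V)
  · rw [sum_filter_snd_eq, mul_one_div, div_le_one hn']
    simpa using ht
  · rw [sum_filter_fst_eq _ j (fun _ => 1 / (Fintype.card V : ℝ)), sum_const, nsmul_eq_mul,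
      mul_one_div, div_le_one hn']
    simp

end Spread

section Forests
open Finset Slot
variable {t : ℕ} {V : Type*} [Fintype V] [DecidableEq V]

theorem exists_spread_forests {R : V → V → Prop} [DecidableRel R] {H : SimpleGraph V}
    [DecidableRel H.Adj] {φ : Sym2 V → ℕ} {r : ℕ} {D θ L ξ₀ δ n : ℝ}
    (hR : ∀ u v, R u v → R v u) (hRi : ∀ u, ¬ R u u) (hne : ∃ u v, R u v)
    (hn : n = Fintype.card V) (hn1 : 1 ≤ n) (htn : (t : ℝ) ≤ n)
    (hD : 0 < D) (hθ : 0 < θ) (hθD : 2 ≤ θ * D) (hθt : 1 ≤ θ * t)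
    (hcol : ∀ c, ((univ.filter fun q : V × V => R q.1 q.2 ∧ φ s(q.1, q.2) = c).card : ℝ) ≤ D)
    (hdeg : ∀ u, (1 - ξ₀ / 2) * D ≤ (univ.filter fun v => R u v).card ∧
      ((univ.filter fun v => R u v).card : ℝ) ≤ (1 + ξ₀ / 2) * D)
    (ht : (1 - ξ₀ / 2) * D ≤ 2 * t ∧ 2 * t ≤ D)
    (hloc : ∀ u c, ((univ.filter fun v => R u v ∧ φ s(u, v) = c).card : ℝ) ≤ θ * D)
    (hcd : ∀ c v, (colDeg H φ c v : ℝ) ≤ θ * n) (hcls : ∀ c, ∑ v, (colDeg H φ c v : ℝ) ≤ n)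
    (hδ0 : 0 < δ) (hδ1 : δ ≤ 1 / 2) (hξ0 : 0 < ξ₀) (hξδ : 4 * ξ₀ ≤ δ ^ 60)
    (hθξ : 6 * θ ≤ ξ₀ * δ ^ 4) (hL : 0 < L) (hLθ : 100 * L * θ ≤ ξ₀ * δ ^ 4)
    (hexp : 14 * n ^ 3 * Real.exp (-(L * (ξ₀ / 2))) < 1) (hr : 4 * δ * n ≤ r) :
    ∃ M : Finset (Fin t × V × V), (∀ h ∈ M, R h.2.1 h.2.2) ∧
      (∀ i x, ¬ Relation.TransGen (fun u v => (i, u, v) ∈ M) x x) ∧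
      (∀ h ∈ M, ∀ h' ∈ M, h ≠ h' → Disjoint (ends φ h) (ends φ h')) ∧
      IsSpread H φ r (fun i => univ.filter fun u => ∀ v, (i, u, v) ∉ M) ∧
      IsSpread H φ r (fun i => univ.filter fun v => ∀ u, (i, u, v) ∉ M) := by
  have hnpos : 0 < Fintype.card V := by
    have : (0 : ℝ) < Fintype.card V := by rw [← hn]; linarith
    exact_mod_cast this
  have htn' : t ≤ Fintype.card V := by
    rw [hn] at htn
    exact_mod_cast htn
  have hθn : 1 ≤ θ * Fintype.card V := by
    rw [← hn]
    nlinarith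
  let Qs : Finset ((Fin t × ℕ) ⊕ V ⊕ Fin t) := (univ ×ˢ univ.image φ).disjSum univ
  have hQs : (Qs.card : ℝ) ≤ 3 * n ^ 3 := by
    have h1 : (univ.image φ).card ≤ Fintype.card V ^ 2 := by
      refine card_image_le.trans ?_
      rw [card_univ, sq, ← Fintype.card_prod]
      exact Fintype.card_le_of_surjective (fun q : V × V => s(q.1, q.2)) fun e => by
        induction e using Sym2.ind with
        | _ x y => exact ⟨(x, y), rfl⟩
    have h2 : Qs.card = t * (univ.image φ).card + (Fintype.card V + t) := by
      simp [Qs, card_disjSum]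
    have h3 : Qs.card ≤ Fintype.card V * Fintype.card V ^ 2 + (Fintype.card V + Fintype.card V) := by
      rw [h2]
      gcongr
    have h4 : (Qs.card : ℝ) ≤ n * n ^ 2 + (n + n) := by
      rw [hn]
      exact_mod_cast h3
    nlinarith [mul_nonneg (sub_nonneg.2 hn1) (sub_nonneg.2 hn1),
      mul_nonneg (by linarith : 0 ≤ n) (mul_nonneg (sub_nonneg.2 hn1) (by linarith : 0 ≤ n + 1))]
  obtain ⟨M, hM1, hM2, hM3, hA, hB⟩ := exists_rainbow_forests hR hRi hne φ Qs (spreadWeight H φ)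
    hD hθ hθD hθt hcol hdeg ht hloc (fun q _ => spreadWeight_bounds hnpos hθn (by rwa [← hn]) q)
    (fun q _ => sum_spreadWeight_le htn' hnpos (fun c => by
      have := hcls c
      rw [hn] at this
      exact_mod_cast this) q) hδ0 hδ1 hξ0 hξδ hθξ hL hLθ (by
        refine lt_of_le_of_lt (mul_le_mul_of_nonneg_right ?_ (Real.exp_pos _).le) hexp
        rw [← hn]
        have : (t : ℝ) * n ^ 2 ≤ n * n ^ 2 := by gcongr
        nlinarith)
  have hmem1 : ∀ j, ∀ c ∈ univ.image φ, Sum.inl (j, c) ∈ Qs := by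
    intro j c hc
    simp only [Qs, inl_mem_disjSum, mem_product, mem_univ, true_and]
    exact hc
  have hmem2 : ∀ x, Sum.inr x ∈ Qs := by
    intro x
    simp [Qs]
  refine ⟨M, hM1, hM2, hM3, ?_, ?_⟩
  · exact isSpread_of_weight (fun p => ∀ v, (p.1, p.2, v) ∉ M) hnpos (by rwa [← hn])
      (fun j c hc => hA _ (hmem1 j c hc)) (fun v => hA _ (hmem2 _)) fun j => hA _ (hmem2 _)
  · exact isSpread_of_weight (fun p => ∀ u, (p.1, u, p.2) ∉ M) hnpos (by rwa [← hn])
      (fun j c hc => hB _ (hmem1 j c hc)) (fun v => hB _ (hmem2 _)) fun j => hB _ (hmem2 _)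

end Forests

section Assembly
open Finset Slot
variable {t : ℕ} {V : Type*} [Fintype V] [DecidableEq V]

theorem exists_rainbow_cycles_of_setup {G H : SimpleGraph V} [DecidableRel G.Adj]
    [DecidableRel H.Adj] {φ : Sym2 V → ℕ} {C : Finset ℕ} {r m : ℕ}
    {D θ L ξ₀ δ p β b ℓ lam N : ℝ} {n : ℕ}
    (hH : ∀ x y, H.Adj x y ↔ G.Adj x y ∧ φ s(x, y) ∈ C)
    (hne : ∃ u v, G.Adj u v ∧ φ s(u, v) ∉ C) (htn : t ≤ n)
    (hD : 0 < D) (hθ : 0 < θ) (hθD : 2 ≤ θ * D) (hθt : 1 ≤ θ * t)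
    (hcol : ∀ c, ((univ.filter fun q : V × V => (G.Adj q.1 q.2 ∧ φ s(q.1, q.2) ∉ C) ∧
      φ s(q.1, q.2) = c).card : ℝ) ≤ D)
    (hdeg : ∀ u, (1 - ξ₀ / 2) * D ≤ (univ.filter fun v => G.Adj u v ∧ φ s(u, v) ∉ C).card ∧
      ((univ.filter fun v => G.Adj u v ∧ φ s(u, v) ∉ C).card : ℝ) ≤ (1 + ξ₀ / 2) * D)
    (ht : (1 - ξ₀ / 2) * D ≤ 2 * t ∧ 2 * t ≤ D)
    (hloc : ∀ u c, ((univ.filter fun v => (G.Adj u v ∧ φ s(u, v) ∉ C) ∧ φ s(u, v) = c).card : ℝ) ≤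
      θ * D) (hℓθ : ℓ ≤ θ * n)
    (hδ0 : 0 < δ) (hδ1 : δ ≤ 1 / 2) (hξ0 : 0 < ξ₀) (hξδ : 4 * ξ₀ ≤ δ ^ 60)
    (hθξ : 6 * θ ≤ ξ₀ * δ ^ 4) (hL : 0 < L) (hLθ : 100 * L * θ ≤ ξ₀ * δ ^ 4)
    (hexp : 14 * (n : ℝ) ^ 3 * Real.exp (-(L * (ξ₀ / 2))) < 1) (hr : 4 * δ * n ≤ r)
    (hs : ∀ (U : Finset (Sym2 V)) (Sat : Finset V),
      (∀ v, ((univ.filter fun w => H.Adj v w ∧ s(v, w) ∈ U).card : ℝ) ≤ b) →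
      (Sat.card : ℝ) ≤ b → BatchSetup H φ n m p β b ℓ lam N U Sat)
    (hpot : n * Real.exp (lam * (6 * n * n * r / N)) ≤ Real.exp (lam * b))
    (hb : 0 < b) (hrb : 4 * (r : ℝ) + 2 ≤ b / 2) (hrt : 12 * (r : ℝ) * t ≤ b ^ 2) :
    ∃ (v : Fin t → V) (w : ∀ i, G.Walk (v i) (v i)), (∀ i, (w i).IsHamiltonianCycle) ∧
      (∀ i, ((w i).edges.map φ).Nodup) ∧ ∀ i j, i ≠ j → ∀ e ∈ (w i).edges, e ∉ (w j).edges := by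
  have hs0 : BatchSetup H φ n m p β b ℓ lam N ∅ ∅ := hs ∅ ∅ (by simp [hb.le]) (by simp [hb.le])
  obtain ⟨M, hM, hac, hdisj, hA, hB⟩ := exists_spread_forests (t := t) (n := (n : ℝ))
    (R := fun u v => G.Adj u v ∧ φ s(u, v) ∉ C) (H := H) (φ := φ)
    (fun u v h => ⟨h.1.symm, by rw [Sym2.eq_swap]; exact h.2⟩) (fun u h => h.1.ne rfl) hne
    (by rw [hs0.card_eq]) (by exact_mod_cast (by linarith [hs0.three_le] : 1 ≤ n))
    (by exact_mod_cast htn) hD hθ hθD hθt hcol hdeg ht hloc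
    (fun c v => (hs0.colDeg_le c v).trans hℓθ) (fun c => by
      have h := hs0.class_le c
      have h2 : ∑ v, colDeg H φ c v = (univ.filter fun q : V × V =>
          H.Adj q.1 q.2 ∧ φ s(q.1, q.2) = c).card := by
        simp only [colDeg, card_filter]
        rw [Fintype.sum_prod_type]
      rw [← h2] at h
      exact_mod_cast h) hδ0 hδ1 hξ0 hξδ hθξ hL hLθ hexp hr
  have heq : ∀ h ∈ M, ∀ h' ∈ M, (∃ x, x ∈ ends φ h ∧ x ∈ ends φ h') → h = h' := by
    rintro h hh h' hh' ⟨x, hx, hx'⟩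
    by_contra hne
    exact Finset.disjoint_left.1 (hdisj h hh h' hh' hne) hx hx'
  have hV : Nonempty V := ⟨hne.choose⟩
  have hcyc := fun i => exists_cyclic_list (r := fun u v => (i, u, v) ∈ M)
    (fun u v w h h' => by
      have := heq _ h _ h' ⟨arc false i w, by simp [arc_false_mem_ends]⟩
      simpa using this)
    (fun u v v' h h' => by
      have := heq _ h _ h' ⟨arc true i u, by simp [arc_true_mem_ends]⟩
      simpa using this) (hac i)
  choose l hl hfull T hc hT hT1 hT2 using hcyc
  obtain ⟨K, L', hL', hK, -, -⟩ := exists_batches (t := t) (r := r) hs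
    (S := fun i x y => (i, x, y) ∈ M ∨ (i, y, x) ∈ M) (fun i x y h => h.symm) hl hfull
    (fun i => cycle_chain_mono (fun x y h => h.imp_left Or.inl) (hc i))
    (fun i q hq q' hq' h => hT1 i q hq q' hq' h) (fun i q hq q' hq' h => hT2 i q hq q' hq' h)
    (A := fun i => univ.filter fun u => ∀ v, (i, u, v) ∉ M)
    (B := fun i => univ.filter fun v => ∀ u, (i, u, v) ∉ M)
    (fun i q hq => by simpa using (hT i q hq).1) (fun i q hq => by simpa using (hT i q hq).2)
    hA.card_le hA.sum_colDeg_le hB.sum_colDeg_le hA.card_index_le hB.card_index_le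
    hpot hb hrb hrt univ
  refine exists_rainbow_cycles (C := C) (M := M) (K := K) (L := L') hM ?_ ?_
    (hs0.card_eq ▸ hs0.three_le) ?_ fun i j hij => hK i (mem_univ i) j (mem_univ j) hij
  · intro i u v u' v' h h' e
    have := heq _ h _ h' ⟨col i (φ s(u, v)), by simp [col_mem_ends, e]⟩
    simp only [Prod.mk.injEq, true_and] at this
    rw [this.1, this.2]
  · intro i j u v u' v' h h' e
    have := heq _ h _ h' ⟨edge s(u, v), by simp [edge_mem_ends, e]⟩
    exact congrArg Prod.fst this
  · intro i
    obtain ⟨h1, h2, h3, h4, h5⟩ := hL' i (mem_univ i)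
    refine ⟨h1, h2, h3, fun e he => ?_, h5⟩
    have := h4 e he
    induction e using Sym2.ind with
    | _ x y =>
      rw [SimpleGraph.mem_edgeSet] at this ⊢
      exact (hH x y).1 this

end Assembly

section Constants

/-- The hierarchy of constants in the proof of the main theorem. -/
structure Constants (α d₀ β δ ξ₀ ξ η : ℝ) : Prop where
  α_pos : 0 < α
  α_lt_one : α < 1
  d₀_pos : 0 < d₀
  d₀_le_one : d₀ ≤ 1
  β_eq : 512 * β = (α / 4 * d₀) ^ 3
  δ_eq : 4000 * δ = β ^ 2
  ξ₀_eq : 4 * ξ₀ = δ ^ 60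
  ξ_eq : 16 * ξ = β ^ 2 * (ξ₀ * d₀)
  η_eq : 16 * η = ξ ^ 2

variable {α d₀ β δ ξ₀ ξ η : ℝ}

theorem exists_constants (hα : 0 < α) (hα1 : α < 1) (hd : 0 < d₀) (hd1 : d₀ ≤ 1) :
    ∃ β δ ξ₀ ξ η, Constants α d₀ β δ ξ₀ ξ η := by
  refine ⟨(α / 4 * d₀) ^ 3 / 512, ((α / 4 * d₀) ^ 3 / 512) ^ 2 / 4000, _, _, _,
    hα, hα1, hd, hd1, by ring, by ring, mul_div_cancel₀ _ four_ne_zero,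
    mul_div_cancel₀ _ (by norm_num), mul_div_cancel₀ _ (by norm_num)⟩

namespace Constants

theorem p_pos (h : Constants α d₀ β δ ξ₀ ξ η) : 0 < α / 4 * d₀ :=
  mul_pos (div_pos h.α_pos four_pos) h.d₀_pos

theorem p_le (h : Constants α d₀ β δ ξ₀ ξ η) : α / 4 * d₀ ≤ 1 / 4 := by
  have := mul_le_mul_of_nonneg_left h.d₀_le_one (div_pos h.α_pos four_pos).le
  linarith [h.α_lt_one]

theorem β_pos (h : Constants α d₀ β δ ξ₀ ξ η) : 0 < β := by
  have := pow_pos h.p_pos 3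
  linarith [h.β_eq]

theorem β_le (h : Constants α d₀ β δ ξ₀ ξ η) : 8192 * β ≤ α / 4 * d₀ := by
  have h1 : (α / 4 * d₀) ^ 3 ≤ α / 4 * d₀ * (1 / 16) := by
    rw [pow_succ', sq]
    have := h.p_le
    have := h.p_pos
    refine mul_le_mul_of_nonneg_left ?_ this.le
    nlinarith
  linarith [h.β_eq]

theorem β_le' (h : Constants α d₀ β δ ξ₀ ξ η) : 32768 * β ≤ 1 := by linarith [h.β_le, h.p_le]

theorem β_le_α (h : Constants α d₀ β δ ξ₀ ξ η) : β ≤ α := by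
  have := mul_le_mul_of_nonneg_left h.d₀_le_one (div_pos h.α_pos four_pos).le
  linarith [h.β_le, h.β_pos, h.α_pos]

theorem β_le_d₀ (h : Constants α d₀ β δ ξ₀ ξ η) : β ≤ d₀ / 4 := by
  have := mul_le_mul_of_nonneg_right h.α_lt_one.le h.d₀_pos.le
  linarith [h.β_le, h.β_pos]

theorem δ_pos (h : Constants α d₀ β δ ξ₀ ξ η) : 0 < δ := by
  have := pow_pos h.β_pos 2
  linarith [h.δ_eq]

theorem δ_le (h : Constants α d₀ β δ ξ₀ ξ η) : 4000 * δ ≤ β := by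
  have := h.β_pos
  have := h.β_le'
  rw [h.δ_eq]
  nlinarith

theorem δ_le_one (h : Constants α d₀ β δ ξ₀ ξ η) : δ ≤ 1 := by linarith [h.δ_le, h.β_le', h.δ_pos]

theorem ξ₀_pos (h : Constants α d₀ β δ ξ₀ ξ η) : 0 < ξ₀ := by
  have := pow_pos h.δ_pos 60
  linarith [h.ξ₀_eq]

theorem ξ₀_le (h : Constants α d₀ β δ ξ₀ ξ η) : 4 * ξ₀ ≤ δ := by
  rw [h.ξ₀_eq]
  exact pow_le_of_le_one h.δ_pos.le h.δ_le_one (by norm_num)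

theorem ξ₀_le_one (h : Constants α d₀ β δ ξ₀ ξ η) : ξ₀ ≤ 1 := by linarith [h.ξ₀_le, h.δ_le_one, h.ξ₀_pos]

theorem ξ₀_mul_pos (h : Constants α d₀ β δ ξ₀ ξ η) : 0 < ξ₀ * d₀ := mul_pos h.ξ₀_pos h.d₀_pos

theorem ξ₀_mul_le (h : Constants α d₀ β δ ξ₀ ξ η) : ξ₀ * d₀ ≤ 1 :=
  mul_le_one₀ h.ξ₀_le_one h.d₀_pos.le h.d₀_le_one

theorem ξ_pos (h : Constants α d₀ β δ ξ₀ ξ η) : 0 < ξ := by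
  have := mul_pos (pow_pos h.β_pos 2) h.ξ₀_mul_pos
  linarith [h.ξ_eq]

theorem ξ_le (h : Constants α d₀ β δ ξ₀ ξ η) : 16 * ξ ≤ β ^ 2 := by
  rw [h.ξ_eq]
  exact mul_le_of_le_one_right (sq_nonneg β) h.ξ₀_mul_le

theorem ξ_le_β (h : Constants α d₀ β δ ξ₀ ξ η) : 16 * ξ ≤ β := h.ξ_le.trans (pow_le_of_le_one h.β_pos.le
  (by linarith [h.β_le', h.β_pos]) two_ne_zero)

theorem ξ_le_one (h : Constants α d₀ β δ ξ₀ ξ η) : ξ ≤ 1 := by linarith [h.ξ_le_β, h.β_le', h.ξ_pos, h.β_pos]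

theorem ξ_le' (h : Constants α d₀ β δ ξ₀ ξ η) : 16 * ξ ≤ ξ₀ * d₀ := by
  rw [h.ξ_eq]
  exact mul_le_of_le_one_left h.ξ₀_mul_pos.le
    (pow_le_one₀ h.β_pos.le (by linarith [h.β_le', h.β_pos]))

theorem η_pos (h : Constants α d₀ β δ ξ₀ ξ η) : 0 < η := by
  have := pow_pos h.ξ_pos 2
  linarith [h.η_eq]

theorem η_le (h : Constants α d₀ β δ ξ₀ ξ η) : 16 * η ≤ ξ := by
  rw [h.η_eq]
  exact pow_le_of_le_one h.ξ_pos.le h.ξ_le_one two_ne_zero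

end Constants

/-- The lower bounds required of `log n`. -/
structure LargeConstant (α d₀ δ ξ₀ ξ K : ℝ) : Prop where
  three_le : 3 ≤ K
  le_δ : 800 ≤ K * (ξ₀ ^ 2 * δ ^ 4)
  le_ξ : 1 ≤ K * ξ
  le_p : 16 ≤ K * (α / 4 * d₀)
  le_ξ₀ : 6 ≤ K * (ξ₀ * d₀)

theorem exists_largeConstant (h : Constants α d₀ β δ ξ₀ ξ η) : ∃ K, LargeConstant α d₀ δ ξ₀ ξ K := by
  have h1 : 0 < ξ₀ ^ 2 * δ ^ 4 := mul_pos (pow_pos h.ξ₀_pos 2) (pow_pos h.δ_pos 4)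
  have hξ := h.ξ_pos
  have hp := h.p_pos
  have h4 := h.ξ₀_mul_pos
  have e1 := div_pos (show (0 : ℝ) < 800 by norm_num) h1
  have e2 := div_pos one_pos hξ
  have e3 := div_pos (show (0 : ℝ) < 16 by norm_num) hp
  have e4 := div_pos (show (0 : ℝ) < 6 by norm_num) h4
  refine ⟨3 + 800 / (ξ₀ ^ 2 * δ ^ 4) + 1 / ξ + 16 / (α / 4 * d₀) + 6 / (ξ₀ * d₀),
    by linarith, ?_, ?_, ?_, ?_⟩
  · rw [← div_le_iff₀ h1]; linarith
  · rw [← div_le_iff₀ hξ]; linarith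
  · rw [← div_le_iff₀ hp]; linarith
  · rw [← div_le_iff₀ h4]; linarith

theorem eventually_large (K : ℝ) :
    ∃ n₀ : ℕ, ∀ n : ℕ, n₀ ≤ n → K ≤ Real.log n ∧ K * Real.log n ^ 2 ≤ n := by
  have h1 : ∀ᶠ x : ℝ in Filter.atTop, K ≤ Real.log x :=
    Real.tendsto_log_atTop.eventually_ge_atTop K
  have h2 : ∀ᶠ x : ℝ in Filter.atTop, K * Real.log x ^ 2 ≤ x := by
    have := (Real.isLittleO_pow_log_id_atTop (n := 2)).bound
      (show (0 : ℝ) < 1 / (|K| + 1) by positivity)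
    filter_upwards [this, Filter.eventually_ge_atTop 0] with x hx hx0
    rw [Real.norm_of_nonneg (sq_nonneg _), id, Real.norm_of_nonneg hx0, one_div,
      ← div_eq_inv_mul, le_div_iff₀ (by positivity)] at hx
    nlinarith [sq_nonneg (Real.log x), le_abs_self K]
  obtain ⟨n₀, hn₀⟩ := Filter.eventually_atTop.1
    (tendsto_natCast_atTop_atTop.eventually (h1.and h2))
  exact ⟨n₀, hn₀⟩

theorem mul_pow_mul_exp_lt_one {a n y : ℝ} {k : ℕ} (hn : 0 < n) (ha : a < Real.exp (Real.log n))
    (hy : (k + 1) * Real.log n ≤ y) : a * n ^ k * Real.exp (-y) < 1 := by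
  rw [Real.exp_neg, ← div_eq_mul_inv, div_lt_one (Real.exp_pos y)]
  have h1 : n ^ k = Real.exp (k * Real.log n) := by
    rw [Real.exp_nat_mul, Real.exp_log hn]
  refine lt_of_lt_of_le ?_ (Real.exp_le_exp.2 hy)
  rw [add_one_mul, add_comm, Real.exp_add, h1]
  exact mul_lt_mul_of_pos_right ha (Real.exp_pos _)

theorem fourteen_lt_exp {x : ℝ} (hx : 3 ≤ x) : 14 < Real.exp x := by
  have h1 : Real.exp 3 ≤ Real.exp x := Real.exp_le_exp.2 hx
  have h2 : Real.exp 3 = Real.exp 1 ^ 3 := by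
    rw [← Real.exp_nat_mul]
    norm_num
  have h3 := Real.exp_one_gt_d9
  have h4 : (2.7 : ℝ) ^ 3 ≤ Real.exp 1 ^ 3 := pow_le_pow_left₀ (by norm_num) (by linarith) 3
  norm_num at h4
  linarith

end Constants

section Parameters
open Finset
variable {V : Type*} [Fintype V] [DecidableEq V] {G H : SimpleGraph V} [DecidableRel G.Adj]
  [DecidableRel H.Adj] {φ : Sym2 V → ℕ} {n : ℕ} {α d₀ β δ ξ₀ ξ η K d : ℝ}

namespace LargeConstant

theorem nine_mul_le (hK : LargeConstant α d₀ δ ξ₀ ξ K) (hlog : K ≤ Real.log n)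
    (hlin : K * Real.log n ^ 2 ≤ n) : 9 * K ≤ n := by
  have := hK.three_le
  nlinarith

theorem mul_le (hK : LargeConstant α d₀ δ ξ₀ ξ K) (hlog : K ≤ Real.log n)
    (hlin : K * Real.log n ^ 2 ≤ n) {a x : ℝ} (hx : 0 ≤ x) (h : a ≤ K * x) : 9 * a ≤ x * n := by
  have := mul_le_mul_of_nonneg_left (hK.nine_mul_le hlog hlin) hx
  linarith

theorem n_pos (hK : LargeConstant α d₀ δ ξ₀ ξ K) (hlog : K ≤ Real.log n)
    (hlin : K * Real.log n ^ 2 ≤ n) : (0 : ℝ) < n := by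
  have := hK.three_le
  have := hK.nine_mul_le hlog hlin
  linarith

end LargeConstant

theorem exists_reserve (hn : n = Fintype.card V) (hc : Constants α d₀ β δ ξ₀ ξ η)
    (hK : LargeConstant α d₀ δ ξ₀ ξ K) (hlog : K ≤ Real.log n) (hlin : K * Real.log n ^ 2 ≤ n)
    (hd : d₀ ≤ d) (hd1 : d ≤ 1 + η)
    (hdeg : ∀ v, |((univ.filter fun u => G.Adj v u).card : ℝ) - d * n| ≤ η * n)
    (hcodeg : ((univ.filter fun q : V × V => q.1 ≠ q.2 ∧
      ¬ |((univ.filter fun w => G.Adj q.1 w ∧ G.Adj q.2 w).card : ℝ) - d ^ 2 * n| ≤ η * n).card : ℝ) ≤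
        2 * η * n ^ 2)
    (hℓ : ∀ v c, ((univ.filter fun u => G.Adj v u ∧ φ s(v, u) = c).card : ℝ) ≤
      η * n / Real.log n ^ 4) :
    ∃ T : Finset ℕ, (∀ v, |((univ.filter fun u => G.Adj v u ∧ φ s(v, u) ∈ T).card : ℝ) -
      α / 4 * d * n| ≤ (η + ξ) * n) ∧
      ∀ X Y : Finset V, α / 4 * d * X.card * Y.card - β * n ^ 2 ≤
        ((X ×ˢ Y).filter fun q => G.Adj q.1 q.2 ∧ φ s(q.1, q.2) ∈ T).card := by
  have hx : 3 ≤ Real.log n := hK.three_le.trans hlog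
  have hnpos := hK.n_pos hlog hlin
  have hη := hc.η_pos
  have hξ := hc.ξ_pos
  have hηξ := hc.η_le
  have hα := hc.α_pos
  have hα1 := hc.α_lt_one
  have hd0 := hc.d₀_pos
  have hξ1 := hc.ξ_le_one
  have hx4 : 1 ≤ Real.log n ^ 4 := one_le_pow₀ (by linarith)
  have hξn := hK.mul_le hlog hlin hξ.le hK.le_ξ
  refine exists_reserve_colours G φ (n := (n : ℝ)) (lam := ξ * Real.log n ^ 4 / (8 * (η * n)))
    (by rw [hn]) (by linarith) (by linarith) (by linarith) ?_ hη.le hξ hξ1 hc.β_pos ?_ ?_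
    hdeg hcodeg hℓ (by positivity) ?_ (by positivity) ?_ ?_
  · nlinarith
  · linarith [hc.ξ_le]
  · linarith
  · refine (div_le_self (by positivity) hx4).trans (mul_le_mul_of_nonneg_right ?_ hnpos.le)
    linarith [hc.η_eq]
  · refine le_of_eq ?_
    field_simp
  · refine mul_pow_mul_exp_lt_one hnpos (by linarith [fourteen_lt_exp hx]) ?_
    have : ξ * Real.log n ^ 4 / (8 * (η * n)) * ξ * n / 2 = Real.log n ^ 4 := by
      rw [show η = ξ ^ 2 / 16 by linarith [hc.η_eq]]
      field_simp
      norm_num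
    rw [this]
    push_cast
    have h3 : (3 : ℝ) ^ 3 ≤ Real.log n ^ 3 := pow_le_pow_left₀ (by norm_num) hx 3
    nlinarith

theorem batchSetup_of_reserve (hn : n = Fintype.card V) (hc : Constants α d₀ β δ ξ₀ ξ η)
    (hK : LargeConstant α d₀ δ ξ₀ ξ K) (hlog : K ≤ Real.log n) (hlin : K * Real.log n ^ 2 ≤ n)
    (hd : d₀ ≤ d)
    (hdeg : ∀ v, |((univ.filter fun u => H.Adj v u).card : ℝ) - α / 4 * d * n| ≤ (η + ξ) * n)
    (hdisc : ∀ X Y : Finset V, α / 4 * d * X.card * Y.card - β * n ^ 2 ≤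
        ((X ×ˢ Y).filter fun q => H.Adj q.1 q.2).card)
    (hℓ : ∀ c v, (colDeg H φ c v : ℝ) ≤ η * n / Real.log n ^ 4)
    (hcls : ∀ c, (univ.filter fun q : V × V => H.Adj q.1 q.2 ∧ φ s(q.1, q.2) = c).card ≤ n)
    {U : Finset (Sym2 V)} {Sat : Finset V}
    (hU : ∀ v, ((univ.filter fun w => H.Adj v w ∧ s(v, w) ∈ U).card : ℝ) ≤ β / 8 * n)
    (hSat : (Sat.card : ℝ) ≤ β / 8 * n) :
    BatchSetup H φ n ⌊α / 4 * d * n / 4⌋₊ (α / 4 * d) β (β / 8 * n) (η * n / Real.log n ^ 4)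
      (16 * Real.log n / (β * n)) (4 * β * n ^ 2) U Sat := by
  have hx : 3 ≤ Real.log n := hK.three_le.trans hlog
  have hnpos := hK.n_pos hlog hlin
  have hβ := hc.β_pos
  have hη := hc.η_pos
  have hp0 := hc.p_pos
  have hp : α / 4 * d₀ ≤ α / 4 * d := mul_le_mul_of_nonneg_left hd (div_pos hc.α_pos four_pos).le
  have hpn0 := hK.mul_le hlog hlin hp0.le hK.le_p
  have hpn : α / 4 * d₀ * n ≤ α / 4 * d * n := mul_le_mul_of_nonneg_right hp hnpos.le
  have hx4 : 1 ≤ Real.log n ^ 4 := one_le_pow₀ (by linarith)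
  have hℓn : η * n / Real.log n ^ 4 ≤ η * n := div_le_self (by positivity) hx4
  have hηβ : 256 * η ≤ β := by linarith [hc.η_le, hc.ξ_le_β]
  set p := α / 4 * d with hpdef
  set p₀ := α / 4 * d₀ with hp₀def
  have hfl : (⌊p * n / 4⌋₊ : ℝ) ≤ p * n / 4 := Nat.floor_le (by linarith)
  have hfl' : p * n / 4 < ⌊p * n / 4⌋₊ + 1 := Nat.lt_floor_add_one _
  refine
    { card_eq := hn
      three_le := ?_
      p_nonneg := hp0.le.trans hp
      disc := hdisc
      one_le := ?_
      le_deg := fun v => ?_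
      N_pos := by positivity
      N_le := ?_
      colDeg_le := hℓ
      used_le := hU
      sat_le := hSat
      class_le := hcls
      lam_pos := by positivity
      lam_mul_le := ?_ }
  · have := hK.nine_mul_le hlog hlin
    have := hK.three_le
    exact_mod_cast (by linarith : (3 : ℝ) ≤ n)
  · exact Nat.le_floor (by push_cast; linarith)
  · have h1 := (abs_le.1 (hdeg v)).1
    have h2 : (3 / 8 * β + (η + ξ)) * n ≤ p₀ / 2 * n := by
      refine mul_le_mul_of_nonneg_right ?_ hnpos.le
      linarith [hc.β_le, hc.ξ_le_β]
    linarith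
  · have h1 : p₀ * n / 8 ≤ (⌊p * n / 4⌋₊ : ℝ) - 1 := by linarith
    have h2 : (p₀ * n / 8) ^ 2 ≤ ((⌊p * n / 4⌋₊ : ℝ) - 1) ^ 2 := pow_le_pow_left₀ (by positivity) h1 2
    have h3 : p₀ * (p₀ * n / 8) ^ 2 ≤ p * ((⌊p * n / 4⌋₊ : ℝ) - 1) ^ 2 :=
      mul_le_mul hp h2 (sq_nonneg _) (hp0.le.trans hp)
    have h4 : p₀ * (p₀ * n / 8) ^ 2 = 8 * β * (n : ℝ) ^ 2 := by
      rw [show 8 * β = p₀ ^ 3 / 64 by linarith [show 512 * β = p₀ ^ 3 from hc.β_eq]]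
      ring
    have h5 : 3 * (η * n / Real.log n ^ 4) * n ≤ 3 * (η * n) * n := by gcongr
    have h6 : 3 * (η * n) * n ≤ β * (n : ℝ) ^ 2 := by
      have : 3 * η * (n : ℝ) ^ 2 ≤ β * (n : ℝ) ^ 2 :=
        mul_le_mul_of_nonneg_right (by linarith) (sq_nonneg _)
      linarith
    have h7 : 0 ≤ β * (n : ℝ) ^ 2 := by positivity
    linarith
  · have : 16 * Real.log n / (β * n) * (3 * (η * n / Real.log n ^ 4)) =
        48 * η / (β * Real.log n ^ 3) := by
      field_simp
      norm_num
    rw [this, div_le_one (by positivity)]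
    have h3 : (1 : ℝ) ≤ Real.log n ^ 3 := one_le_pow₀ (by linarith)
    nlinarith

theorem batch_potential_le (hc : Constants α d₀ β δ ξ₀ ξ η)
    (hK : LargeConstant α d₀ δ ξ₀ ξ K) (hlog : K ≤ Real.log n) (hlin : K * Real.log n ^ 2 ≤ n)
    {r : ℝ} (hr : r ≤ 5 * δ * n) :
    n * Real.exp (16 * Real.log n / (β * n) * (6 * n * n * r / (4 * β * n ^ 2))) ≤
      Real.exp (16 * Real.log n / (β * n) * (β / 8 * n)) := by
  have hx : 3 ≤ Real.log n := hK.three_le.trans hlog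
  have hnpos := hK.n_pos hlog hlin
  have hβ := hc.β_pos
  have h1 : 16 * Real.log n / (β * n) * (6 * n * n * r / (4 * β * n ^ 2)) ≤ Real.log n := by
    have e : 16 * Real.log n / (β * n) * (6 * n * n * r / (4 * β * n ^ 2)) =
        24 * Real.log n * r / (β ^ 2 * n) := by
      field_simp
      ring
    rw [e, div_le_iff₀ (by positivity)]
    have : 24 * r ≤ β ^ 2 * n := by
      have := hc.δ_eq
      rw [← this]
      nlinarith [hc.δ_pos]
    nlinarith
  have h2 : 16 * Real.log n / (β * n) * (β / 8 * n) = Real.log n + Real.log n := by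
    field_simp
    norm_num
  rw [h2, Real.exp_add, Real.exp_log hnpos]
  refine mul_le_mul_of_nonneg_left ?_ hnpos.le
  rw [← Real.le_log_iff_exp_le hnpos]
  exact h1

end Parameters

section Core
open Finset
variable {V : Type*} {G : SimpleGraph V} {φ : Sym2 V → ℕ} {n : ℕ} {α d₀ β δ ξ₀ ξ η K d : ℝ}

/-- The subgraph formed by the edges with colour in `C`. -/
def colourSubgraph (G : SimpleGraph V) (φ : Sym2 V → ℕ) (C : Finset ℕ) : SimpleGraph V where
  Adj x y := G.Adj x y ∧ φ s(x, y) ∈ C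
  symm := ⟨fun x y h => ⟨h.1.symm, by rw [Sym2.eq_swap]; exact h.2⟩⟩
  loopless := ⟨fun _ h => h.1.ne rfl⟩

theorem colourSubgraph_le (C : Finset ℕ) : colourSubgraph G φ C ≤ G := fun _ _ h => h.1

variable [DecidableRel G.Adj]

instance (C : Finset ℕ) : DecidableRel (colourSubgraph G φ C).Adj := fun x y =>
  inferInstanceAs (Decidable (G.Adj x y ∧ φ s(x, y) ∈ C))

variable [Fintype V]

theorem card_filter_adj_split (C : Finset ℕ) (u : V) :
    ((univ.filter fun v => (colourSubgraph G φ C).Adj u v).card : ℝ) +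
      (univ.filter fun v => G.Adj u v ∧ φ s(u, v) ∉ C).card =
      (univ.filter fun v => G.Adj u v).card := by
  have h := card_filter_add_card_filter_not (s := univ.filter fun v => G.Adj u v)
    (fun v => φ s(u, v) ∈ C)
  rw [filter_filter, filter_filter] at h
  exact_mod_cast h

theorem density_le (hn : n = Fintype.card V) (hnpos : (0 : ℝ) < n)
    (hdeg : ∀ v, |((univ.filter fun u => G.Adj v u).card : ℝ) - d * n| ≤ η * n) : d ≤ 1 + η := by
  obtain ⟨v⟩ : Nonempty V := Fintype.card_pos_iff.1 (hn ▸ Nat.cast_pos.1 hnpos)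
  have h1 := (abs_le.1 (hdeg v)).1
  have h2 : ((univ.filter fun u => G.Adj v u).card : ℝ) ≤ n := by
    rw [hn]
    exact_mod_cast card_le_univ _
  have h3 : d * n ≤ (1 + η) * n := by linarith
  exact le_of_mul_le_mul_right h3 hnpos

variable [DecidableEq V]

theorem exists_reserve_subgraph (hn : n = Fintype.card V) (hc : Constants α d₀ β δ ξ₀ ξ η)
    (hK : LargeConstant α d₀ δ ξ₀ ξ K) (hlog : K ≤ Real.log n) (hlin : K * Real.log n ^ 2 ≤ n)
    (hd : d₀ ≤ d) (hd1 : d ≤ 1 + η)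
    (hdeg : ∀ v, |((univ.filter fun u => G.Adj v u).card : ℝ) - d * n| ≤ η * n)
    (hcodeg : ((univ.filter fun q : V × V => q.1 ≠ q.2 ∧
      ¬ |((univ.filter fun w => G.Adj q.1 w ∧ G.Adj q.2 w).card : ℝ) - d ^ 2 * n| ≤ η * n).card : ℝ) ≤
        2 * η * n ^ 2)
    (hℓ : ∀ v c, ((univ.filter fun u => G.Adj v u ∧ φ s(v, u) = c).card : ℝ) ≤
      η * n / Real.log n ^ 4) :
    ∃ C : Finset ℕ, (∀ v, |((univ.filter fun u => (colourSubgraph G φ C).Adj v u).card : ℝ) -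
      α / 4 * d * n| ≤ (η + ξ) * n) ∧
      ∀ X Y : Finset V, α / 4 * d * X.card * Y.card - β * n ^ 2 ≤
        ((X ×ˢ Y).filter fun q => (colourSubgraph G φ C).Adj q.1 q.2).card :=
  exists_reserve hn hc hK hlog hlin hd hd1 hdeg hcodeg hℓ

theorem batchSetup_colourSubgraph (hn : n = Fintype.card V) (hc : Constants α d₀ β δ ξ₀ ξ η)
    (hK : LargeConstant α d₀ δ ξ₀ ξ K) (hlog : K ≤ Real.log n) (hlin : K * Real.log n ^ 2 ≤ n)
    (hd : d₀ ≤ d) (hd1 : d ≤ 1 + η)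
    (hℓ : ∀ v c, ((univ.filter fun u => G.Adj v u ∧ φ s(v, u) = c).card : ℝ) ≤
      η * n / Real.log n ^ 4)
    (hcls : ∀ c, ((univ.filter fun q : V × V => G.Adj q.1 q.2 ∧ φ s(q.1, q.2) = c).card : ℝ) ≤
      (1 - α) * d * n) {C : Finset ℕ}
    (hdeg : ∀ v, |((univ.filter fun u => (colourSubgraph G φ C).Adj v u).card : ℝ) -
      α / 4 * d * n| ≤ (η + ξ) * n)
    (hdisc : ∀ X Y : Finset V, α / 4 * d * X.card * Y.card - β * n ^ 2 ≤
        ((X ×ˢ Y).filter fun q => (colourSubgraph G φ C).Adj q.1 q.2).card)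
    {U : Finset (Sym2 V)} {Sat : Finset V}
    (hU : ∀ v, ((univ.filter fun w => (colourSubgraph G φ C).Adj v w ∧ s(v, w) ∈ U).card : ℝ) ≤
      β / 8 * n)
    (hSat : (Sat.card : ℝ) ≤ β / 8 * n) :
    BatchSetup (colourSubgraph G φ C) φ n ⌊α / 4 * d * n / 4⌋₊ (α / 4 * d) β (β / 8 * n)
      (η * n / Real.log n ^ 4) (16 * Real.log n / (β * n)) (4 * β * n ^ 2) U Sat := by
  refine batchSetup_of_reserve hn hc hK hlog hlin hd hdeg hdisc (fun c v => ?_) (fun c => ?_) hU hSat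
  · refine le_trans (Nat.cast_le.2 (card_le_card (monotone_filter_right _ fun u _ h => ?_))) (hℓ v c)
    exact ⟨colourSubgraph_le C h.1, h.2⟩
  · have h1 : ((univ.filter fun q : V × V => (colourSubgraph G φ C).Adj q.1 q.2 ∧
        φ s(q.1, q.2) = c).card : ℝ) ≤
        (univ.filter fun q : V × V => G.Adj q.1 q.2 ∧ φ s(q.1, q.2) = c).card :=
      Nat.cast_le.2 (card_le_card (monotone_filter_right _ fun u _ h => ⟨colourSubgraph_le C h.1, h.2⟩))
    have h2 : (1 - α) * d * n ≤ 1 * n := by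
      refine mul_le_mul_of_nonneg_right ?_ (hK.n_pos hlog hlin).le
      have h3 : η ≤ α := by
        linarith [hc.η_le, hc.ξ_le_β, hc.β_le_α, hc.β_pos, hc.ξ_pos, hc.η_pos]
      nlinarith [hc.α_pos, hc.α_lt_one]
    have := (h1.trans (hcls c)).trans h2
    rw [one_mul] at this
    exact_mod_cast this

theorem exists_rainbow_cycles_of_quasirandom (hn : n = Fintype.card V)
    (hc : Constants α d₀ β δ ξ₀ ξ η)
    (hK : LargeConstant α d₀ δ ξ₀ ξ K) (hlog : K ≤ Real.log n) (hlin : K * Real.log n ^ 2 ≤ n)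
    (hd : d₀ ≤ d)
    (hdeg : ∀ v, |((univ.filter fun u => G.Adj v u).card : ℝ) - d * n| ≤ η * n)
    (hcodeg : ((univ.filter fun q : V × V => q.1 ≠ q.2 ∧
      ¬ |((univ.filter fun w => G.Adj q.1 w ∧ G.Adj q.2 w).card : ℝ) - d ^ 2 * n| ≤ η * n).card : ℝ) ≤
        2 * η * n ^ 2)
    (hℓ : ∀ v c, ((univ.filter fun u => G.Adj v u ∧ φ s(v, u) = c).card : ℝ) ≤
      η * n / Real.log n ^ 4)
    (hcls : ∀ c, ((univ.filter fun q : V × V => G.Adj q.1 q.2 ∧ φ s(q.1, q.2) = c).card : ℝ) ≤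
      (1 - α) * d * n) :
    ∃ (t : ℕ) (v : Fin t → V) (w : ∀ i, G.Walk (v i) (v i)), (∀ i, (w i).IsHamiltonianCycle) ∧
      (∀ i, ((w i).edges.map φ).Nodup) ∧ (∀ i j, i ≠ j → ∀ e ∈ (w i).edges, e ∉ (w j).edges) ∧
      (1 - α) * ((d + η) * n) ≤ 2 * t := by
  have hx : 3 ≤ Real.log n := hK.three_le.trans hlog
  have hnpos := hK.n_pos hlog hlin
  have hβ := hc.β_pos
  have hη := hc.η_pos
  have hξ := hc.ξ_pos
  have hδ := hc.δ_pos
  have hξ₀ := hc.ξ₀_pos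
  have hα := hc.α_pos
  have hα1 := hc.α_lt_one
  have hd0 := hc.d₀_pos
  have hd1 := density_le hn hnpos hdeg
  obtain ⟨C, hCdeg, hCdisc⟩ := exists_reserve_subgraph hn hc hK hlog hlin hd hd1 hdeg hcodeg hℓ
  set D := (1 - α / 4) * d * n with hD
  have hDlow : 3 / 4 * d₀ * n ≤ D := by
    refine mul_le_mul_of_nonneg_right ?_ hnpos.le
    exact mul_le_mul (by linarith) hd hd0.le (by linarith)
  have hDn : D ≤ 2 * n := by
    refine mul_le_mul_of_nonneg_right ?_ hnpos.le
    have := mul_le_mul (by linarith : 1 - α / 4 ≤ 1) hd1 (hd0.le.trans hd) zero_le_one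
    linarith [hc.η_le, hc.ξ_le_one]
  have hξD : 4 ≤ ξ₀ * D := by
    have h1 := hK.mul_le hlog hlin hc.ξ₀_mul_pos.le hK.le_ξ₀
    have h2 := mul_le_mul_of_nonneg_left hDlow hξ₀.le
    linarith
  have hDpos : 4 ≤ D := by
    have := hc.ξ₀_le_one
    nlinarith
  have hmul : (2 * η + ξ) * n ≤ ξ₀ / 2 * D := by
    have h1 : (2 * η + ξ) * n ≤ 3 / 8 * (ξ₀ * d₀) * n :=
      mul_le_mul_of_nonneg_right (by linarith [hc.η_le, hc.ξ_le']) hnpos.le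
    have h2 := mul_le_mul_of_nonneg_left hDlow hξ₀.le
    linarith
  have hRdeg : ∀ u, (1 - ξ₀ / 2) * D ≤ (univ.filter fun v => G.Adj u v ∧ φ s(u, v) ∉ C).card ∧
      ((univ.filter fun v => G.Adj u v ∧ φ s(u, v) ∉ C).card : ℝ) ≤ (1 + ξ₀ / 2) * D := by
    intro u
    have h1 := abs_le.1 (hdeg u)
    have h2 := abs_le.1 (hCdeg u)
    have h3 := card_filter_adj_split (G := G) (φ := φ) C u
    constructor <;> linarith
  have hlog2 : 0 < Real.log n ^ 2 := by positivity
  have hθlog : ∀ x, x * Real.log n ^ 2 ≤ D → x ≤ 1 / Real.log n ^ 2 * D := fun x h => by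
    rwa [one_div_mul_eq_div, le_div_iff₀ hlog2]
  have hθD : 4 ≤ 1 / Real.log n ^ 2 * D := by
    refine hθlog _ ?_
    have h1 : 6 ≤ K * d₀ := by
      have := hK.le_ξ₀
      have h2 : K * (ξ₀ * d₀) ≤ K * (1 * d₀) := by
        have := hK.three_le
        gcongr
        exact hc.ξ₀_le_one
      linarith
    have h2 := mul_le_mul_of_nonneg_right h1 hlog2.le
    have h3 := mul_le_mul_of_nonneg_left hlin hd0.le
    linarith
  have hℓ24 : η * n / Real.log n ^ 4 ≤ 1 / Real.log n ^ 2 * (η * n) := by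
    rw [one_div_mul_eq_div]
    exact div_le_div_of_nonneg_left (by positivity) hlog2
      (pow_le_pow_right₀ (by linarith) (by norm_num))
  have hηn : η * n ≤ D := by
    refine le_trans (mul_le_mul_of_nonneg_right ?_ hnpos.le) hDlow
    linarith [hc.η_le, hc.ξ_le_β, hc.β_le_d₀]
  set t := ⌊D / 2⌋₊ with ht
  have htD : 2 * (t : ℝ) ≤ D := by
    have := Nat.floor_le (show 0 ≤ D / 2 by linarith)
    linarith
  have htD' : D - 2 ≤ 2 * t := by
    have := Nat.lt_floor_add_one (D / 2)
    linarith
  have htn : t ≤ n := by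
    have : (t : ℝ) ≤ n := by linarith
    exact_mod_cast this
  have hδn : 9 ≤ δ * n := by
    have h1 := hK.mul_le hlog hlin hξ.le hK.le_ξ
    have h2 : ξ ≤ δ := by
      have := mul_le_of_le_one_right hξ₀.le hc.d₀_le_one
      linarith [hc.ξ_le', hc.ξ₀_le]
    have := mul_le_mul_of_nonneg_right h2 hnpos.le
    linarith
  set r := ⌈4 * δ * n⌉₊ with hr
  have hr1 : 4 * δ * n ≤ r := Nat.le_ceil _
  have hr2 : (r : ℝ) ≤ 5 * δ * n := by
    have := Nat.ceil_lt_add_one (show 0 ≤ 4 * δ * n by positivity)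
    linarith
  have hsd : 0 < ξ₀ * δ ^ 4 := by positivity
  have hKδ : 800 ≤ Real.log n * (ξ₀ ^ 2 * δ ^ 4) :=
    hK.le_δ.trans (mul_le_mul_of_nonneg_right hlog (by positivity))
  have hs : ∀ (U : Finset (Sym2 V)) (Sat : Finset V), _ → _ → _ := fun U Sat hU hSat =>
    batchSetup_colourSubgraph hn hc hK hlog hlin hd hd1 hℓ hcls hCdeg hCdisc (U := U) (Sat := Sat)
      hU hSat
  have hmain := exists_rainbow_cycles_of_setup (t := t) (G := G) (H := colourSubgraph G φ C) (φ := φ) (C := C) (r := r)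
    (D := D) (θ := 1 / Real.log n ^ 2) (L := ξ₀ * δ ^ 4 * Real.log n ^ 2 / 100) (ξ₀ := ξ₀) (δ := δ)
    (fun x y => Iff.rfl) ?_ htn (by linarith) (by positivity) (by linarith) ?_ ?_ hRdeg ⟨by linarith, htD⟩ ?_
    ?_ hδ (by linarith [hc.δ_le, hc.β_le']) hξ₀ hc.ξ₀_eq.le ?_ (by positivity) ?_ ?_ hr1 hs
    (batch_potential_le hc hK hlog hlin hr2) (by positivity) ?_ ?_
  · obtain ⟨v, w, h1, h2, h3⟩ := hmain
    refine ⟨t, v, w, h1, h2, h3, ?_⟩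
    have h4 : α / 4 * d₀ * n ≤ α / 4 * d * n :=
      mul_le_mul_of_nonneg_right (mul_le_mul_of_nonneg_left hd (by linarith)) hnpos.le
    have h5 := mul_le_mul_of_nonneg_right hc.β_le hnpos.le
    have h6 : (η + δ) * n ≤ 8192 * β * n :=
      mul_le_mul_of_nonneg_right (by linarith [hc.η_le, hc.ξ_le_β, hc.δ_le]) hnpos.le
    have h7 : 0 ≤ α * (η * n) := by positivity
    have h8 : 0 ≤ η * n := by positivity
    linarith
  · obtain ⟨v⟩ : Nonempty V := Fintype.card_pos_iff.1 (hn ▸ Nat.cast_pos.1 hnpos)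
    have h1 : 0 < (1 - ξ₀ / 2) * D := mul_pos (by linarith [hc.ξ₀_le_one]) (by linarith)
    have h2 := Nat.cast_pos.1 (h1.trans_le (hRdeg v).1)
    obtain ⟨u, hu⟩ := card_pos.1 h2
    exact ⟨v, u, (mem_filter.1 hu).2⟩
  · have h1 : D / 4 ≤ t := by linarith
    have h2 := mul_le_mul_of_nonneg_left h1 (one_div_pos.2 hlog2).le
    linarith
  · intro c
    refine le_trans (Nat.cast_le.2 (card_le_card (monotone_filter_right _
      fun u hu h => ⟨h.1.1, h.2⟩))) ((hcls c).trans ?_)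
    refine mul_le_mul_of_nonneg_right ?_ hnpos.le
    exact mul_le_mul_of_nonneg_right (by linarith) (by linarith)
  · intro u c
    refine le_trans (Nat.cast_le.2 (card_le_card (monotone_filter_right _
      fun u hu h => ⟨h.1.1, h.2⟩))) ((hℓ u c).trans (hℓ24.trans ?_))
    exact mul_le_mul_of_nonneg_left hηn (one_div_pos.2 hlog2).le
  · refine hℓ24.trans (mul_le_mul_of_nonneg_left ?_ (one_div_pos.2 hlog2).le)
    exact mul_le_of_le_one_left hnpos.le (by linarith [hc.η_le, hc.ξ_le_one])
  · rw [mul_one_div, div_le_iff₀ hlog2]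
    have h1 : ξ₀ ^ 2 * δ ^ 4 ≤ ξ₀ * δ ^ 4 := by
      refine mul_le_mul_of_nonneg_right ?_ (by positivity)
      exact pow_le_of_le_one hξ₀.le hc.ξ₀_le_one two_ne_zero
    have h2 : Real.log n * (ξ₀ ^ 2 * δ ^ 4) ≤ Real.log n ^ 2 * (ξ₀ * δ ^ 4) := by
      refine mul_le_mul ?_ h1 (by positivity) hlog2.le
      nlinarith
    linarith
  · refine le_of_eq ?_
    field_simp
  · refine mul_pow_mul_exp_lt_one hnpos (fourteen_lt_exp hx) ?_
    push_cast
    have h1 := mul_le_mul_of_nonneg_right hKδ (show 0 ≤ Real.log n by linarith)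
    linarith
  · nlinarith [hc.δ_le]
  · have h1 : (r : ℝ) * t ≤ 5 * δ * n * n := mul_le_mul hr2 (by linarith) t.cast_nonneg (by positivity)
    have h2 : 4000 * δ * (n : ℝ) ^ 2 = β ^ 2 * (n : ℝ) ^ 2 := by rw [hc.δ_eq]
    have h3 : 0 ≤ δ * (n : ℝ) ^ 2 := by positivity
    linarith

end Core

section Conversion
open Finset
variable {V : Type*} [Fintype V] {G : SimpleGraph V} [DecidableRel G.Adj]

theorem card_filter_prod_le_two_mul_ncard {V : Type*} [Fintype V] {P : V × V → Prop} [DecidablePred P] {S : Set (Sym2 V)}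
    (h : ∀ q, P q → s(q.1, q.2) ∈ S) : (univ.filter P).card ≤ 2 * S.ncard := by
  classical
  rw [Set.ncard_eq_toFinset_card']
  refine (card_le_mul_card_image_of_maps_to (f := fun q : V × V => s(q.1, q.2)) ?_ 2 ?_)
  · intro q hq
    exact Set.mem_toFinset.2 (h q (mem_filter.1 hq).2)
  · intro e _
    induction e using Sym2.ind with
    | _ x y =>
      refine (card_le_card (t := {(x, y), (y, x)}) ?_).trans card_le_two
      intro q hq
      have := (mem_filter.1 hq).2
      rw [Sym2.eq_iff] at this
      rw [mem_insert, mem_singleton, Prod.ext_iff, Prod.ext_iff]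
      exact this

theorem ncard_setOf_eq_card_filter {V : Type*} [Fintype V] (P : V → Prop) [DecidablePred P] :
    {v | P v}.ncard = (univ.filter P).card := by
  rw [← Set.ncard_coe_finset]
  congr
  ext
  simp

theorem degIn_univ (v : V) : degIn G v Set.univ = (univ.filter fun u => G.Adj v u).card := by
  rw [degIn, Set.inter_univ]
  exact ncard_setOf_eq_card_filter _

theorem codegIn_univ (u v : V) :
    codegIn G u v Set.univ = (univ.filter fun w => G.Adj u w ∧ G.Adj v w).card := by
  rw [codegIn, Set.inter_univ]
  exact ncard_setOf_eq_card_filter fun w => G.Adj u w ∧ G.Adj v w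

theorem Paper.Quasirandom.deg {n : ℕ} {ε d : ℝ} (hn : n = Fintype.card V) (h : Quasirandom G ε d)
    (v : V) : |((univ.filter fun u => G.Adj v u).card : ℝ) - d * n| ≤ ε * n := by
  have := h.1 v (Set.mem_univ v)
  rwa [degIn_univ, Set.ncard_univ, Nat.card_eq_fintype_card, ← hn] at this

theorem Paper.Quasirandom.card_bad_le [DecidableEq V] {n : ℕ} {ε d : ℝ} (hn : n = Fintype.card V)
    (h : Quasirandom G ε d) :
    ((univ.filter fun q : V × V => q.1 ≠ q.2 ∧
      ¬ |((univ.filter fun w => G.Adj q.1 w ∧ G.Adj q.2 w).card : ℝ) - d ^ 2 * n| ≤ ε * n).card : ℝ) ≤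
        2 * ε * n ^ 2 := by
  have h2 := h.2
  have h1 : (univ.filter fun q : V × V => q.1 ≠ q.2 ∧
      ¬ |((univ.filter fun w => G.Adj q.1 w ∧ G.Adj q.2 w).card : ℝ) - d ^ 2 * n| ≤ ε * n).card ≤
      2 * {p : Sym2 V | ∃ u v, p = s(u, v) ∧ u ≠ v ∧ u ∈ (Set.univ : Set V) ∧ v ∈ (Set.univ : Set V) ∧
        ¬ (|(codegIn G u v Set.univ : ℝ) - d ^ 2 * (Set.univ : Set V).ncard| ≤
          ε * (Set.univ : Set V).ncard)}.ncard := by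
    refine card_filter_prod_le_two_mul_ncard fun q hq => ?_
    refine ⟨q.1, q.2, rfl, hq.1, Set.mem_univ _, Set.mem_univ _, ?_⟩
    rw [codegIn_univ, Set.ncard_univ, Nat.card_eq_fintype_card, ← hn]
    exact hq.2
  have h3 := (Nat.cast_le (α := ℝ)).2 h1
  rw [Set.ncard_univ, Nat.card_eq_fintype_card, ← hn] at h2 h3
  push_cast at h3
  linarith

theorem Paper.GBounded.card_le {φ : Sym2 V → ℕ} {g : ℝ} (h : GBounded G φ g) (c : ℕ) :
    ((univ.filter fun q : V × V => G.Adj q.1 q.2 ∧ φ s(q.1, q.2) = c).card : ℝ) ≤ 2 * g := by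
  have h1 := card_filter_prod_le_two_mul_ncard
    (P := fun q : V × V => G.Adj q.1 q.2 ∧ φ s(q.1, q.2) = c) (S := colourCls G φ c)
    fun q hq => ⟨hq.1, hq.2⟩
  have h2 := (Nat.cast_le (α := ℝ)).2 h1
  push_cast at h2
  linarith [h c]

theorem Paper.LBounded.card_le {φ : Sym2 V → ℕ} {l : ℝ} (h : LBounded G φ l) (v : V) (c : ℕ) :
    ((univ.filter fun u => G.Adj v u ∧ φ s(v, u) = c).card : ℝ) ≤ l := by
  have := h v c
  rwa [ncard_setOf_eq_card_filter] at this

theorem two_mul_ncard_edgeSet_le {n : ℕ} {ε d : ℝ} (hn : n = Fintype.card V)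
    (hdeg : ∀ v, |((univ.filter fun u => G.Adj v u).card : ℝ) - d * n| ≤ ε * n) :
    2 * (G.edgeSet.ncard : ℝ) ≤ (d + ε) * n * n := by
  have h1 : ∑ v, (univ.filter fun u => G.Adj v u).card = 2 * G.edgeSet.ncard := by
    rw [Set.ncard_eq_toFinset_card', ← SimpleGraph.edgeFinset, ← G.sum_degrees_eq_twice_card_edges]
    refine sum_congr rfl fun v _ => ?_
    rw [← SimpleGraph.card_neighborFinset_eq_degree, SimpleGraph.neighborFinset_eq_filter]
  have h2 : (2 * (G.edgeSet.ncard : ℝ)) = ∑ v, ((univ.filter fun u => G.Adj v u).card : ℝ) := by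
    exact_mod_cast h1.symm
  rw [h2]
  refine (sum_le_card_nsmul univ _ ((d + ε) * n) fun v _ => ?_).trans (le_of_eq ?_)
  · linarith [(abs_le.1 (hdeg v)).2]
  · rw [card_univ, ← hn, nsmul_eq_mul, mul_comm]

theorem ncard_edgeSet_diff_iUnion_add {V : Type*} [Fintype V] [DecidableEq V]
    {G : SimpleGraph V} {t n : ℕ} (hn : n = Fintype.card V) {v : Fin t → V}
    {w : ∀ i, G.Walk (v i) (v i)} (hw : ∀ i, (w i).IsHamiltonianCycle)
    (hdisj : ∀ i j, i ≠ j → ∀ e ∈ (w i).edges, e ∉ (w j).edges) :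
    (G.edgeSet \ ⋃ i, {e | e ∈ (w i).edges}).ncard + t * n = G.edgeSet.ncard := by
  classical
  have h1 : (⋃ i, {e | e ∈ (w i).edges}) = (univ.biUnion fun i => (w i).edges.toFinset : Finset (Sym2 V)) := by
    ext e
    simp
  have h2 : (univ.biUnion fun i => (w i).edges.toFinset : Finset (Sym2 V)).card = t * n := by
    rw [card_biUnion]
    · rw [sum_congr rfl fun i _ => show (w i).edges.toFinset.card = n by
        rw [List.toFinset_card_of_nodup (hw i).isCycle.edges_nodup, SimpleGraph.Walk.length_edges,
          (hw i).length_eq, hn]]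
      simp
    · intro i _ j _ hij
      refine disjoint_left.2 fun e he he' => ?_
      exact hdisj i j hij e (List.mem_toFinset.1 he) (List.mem_toFinset.1 he')
  have h3 : (⋃ i, {e | e ∈ (w i).edges}) ⊆ G.edgeSet := by
    refine Set.iUnion_subset fun i e he => (w i).edges_subset_edgeSet he
  rw [← h2, ← Set.ncard_coe_finset, ← h1]
  exact Set.ncard_sdiff_add_ncard_of_subset h3

end Conversion

/-- Theorem 1.7: approximate decomposition of a quasirandom graph into rainbow
Hamilton cycles. -/
theorem stmt_6 :
    ∀ α d₀ : ℝ, 0 < α → 0 < d₀ →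
    ∃ η : ℝ, 0 < η ∧ ∃ n₀ : ℕ, ∀ n : ℕ, n₀ ≤ n → ∀ d : ℝ, d₀ ≤ d →
    ∀ G : SimpleGraph (Fin n), Quasirandom G η d →
    ∀ φ : Sym2 (Fin n) → ℕ,
      GBounded G φ ((1 - α) * d * n / 2) →
      LBounded G φ (η * n / (Real.log n) ^ 4) →
      ∃ (t : ℕ) (v : Fin t → Fin n) (w : ∀ i : Fin t, G.Walk (v i) (v i)),
        (∀ i, (w i).IsHamiltonianCycle) ∧
        (∀ i, ((w i).edges.map φ).Nodup) ∧
        (∀ i j, i ≠ j → ∀ e ∈ (w i).edges, e ∉ (w j).edges) ∧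
        ((G.edgeSet \ ⋃ i, {e | e ∈ (w i).edges}).ncard : ℝ)
          ≤ α * (G.edgeSet.ncard : ℝ) := by
  intro α d₀ hα hd₀
  rcases le_or_gt 1 α with hα1 | hα1
  · refine ⟨1, one_pos, 0, fun n _ d _ G _ φ _ _ => ⟨0, Fin.elim0, fun i => i.elim0,
      fun i => i.elim0, fun i => i.elim0, fun i => i.elim0, ?_⟩⟩
    refine le_trans (Nat.cast_le.2 (Set.ncard_le_ncard Set.sdiff_subset (Set.toFinite _))) ?_
    exact le_mul_of_one_le_left (Nat.cast_nonneg _) hα1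
  obtain ⟨β, δ, ξ₀, ξ, η, hc⟩ := exists_constants hα hα1 (lt_min hd₀ one_pos) (min_le_right d₀ 1)
  obtain ⟨K, hK⟩ := exists_largeConstant hc
  obtain ⟨n₀, hn₀⟩ := eventually_large K
  refine ⟨η, hc.η_pos, n₀, fun n hn d hd G hG φ hg hl => ?_⟩
  classical
  obtain ⟨hlog, hlin⟩ := hn₀ n hn
  have hcard : n = Fintype.card (Fin n) := (Fintype.card_fin n).symm
  obtain ⟨t, v, w, hw, hrb, hdisj, ht⟩ := exists_rainbow_cycles_of_quasirandom hcard hc hK hlog hlin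
    ((min_le_left d₀ 1).trans hd) (hG.deg hcard) (hG.card_bad_le hcard) hl.card_le
    fun c => (hg.card_le c).trans (by linarith)
  refine ⟨t, v, w, hw, hrb, hdisj, ?_⟩
  have h1 := ncard_edgeSet_diff_iUnion_add hcard hw hdisj
  have h2 := two_mul_ncard_edgeSet_le hcard (hG.deg hcard)
  have h3 : ((G.edgeSet \ ⋃ i, {e | e ∈ (w i).edges}).ncard : ℝ) + t * n = G.edgeSet.ncard := by
    exact_mod_cast h1
  have h4 := mul_le_mul_of_nonneg_right ht (n.cast_nonneg : (0 : ℝ) ≤ n)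
  have h5 := mul_le_mul_of_nonneg_left h2 (by linarith : 0 ≤ 1 - α)
  linarith
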